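/- arXiv:2301.01672 — 10 statements merged into one kernel-verified Lean document; each statement's English description precedes it below -/
import Mathlib

section
/- A mean φ on L^∞(ℝ) is topologically invariant if and only if φ(ψ) ≤ p̄(ψ) holds for every real-valued ψ ∈ L^∞(ℝ). -/
open MeasureTheory Filter

/-- `p̄(ψ) = limsup_{θ→∞} sup_{x∈ℝ} (1/(2θ)) ∫_{x−θ}^{x+θ} ψ(t) dt` for a real-valued
function `ψ`. -/
noncomputable def pbar (ψ : ℝ → ℝ) : ℝ :=
  limsup (fun θ : ℝ => ⨆ x : ℝ, (1 / (2 * θ)) * ∫ t in (x - θ)..(x + θ), ψ t) atTop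

/-- A mean on `L^∞(ℝ)`: a continuous linear functional which is positive on a.e.
nonnegative real-valued functions and sends the constant function `1` to `1`. -/
def IsMean (φ : Lp ℂ ⊤ (volume : Measure ℝ) →L[ℂ] ℂ) : Prop :=
  (∀ ψ : Lp ℂ ⊤ (volume : Measure ℝ),
      (∀ᵐ x ∂(volume : Measure ℝ), 0 ≤ (ψ x).re ∧ (ψ x).im = 0) →
      0 ≤ (φ ψ).re ∧ (φ ψ).im = 0) ∧
  (∀ ψ : Lp ℂ ⊤ (volume : Measure ℝ),
      (⇑ψ : ℝ → ℂ) =ᵐ[volume] (fun _ => 1) → φ ψ = 1)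

/-- A mean `φ` on `L^∞(ℝ)` is topologically invariant if `φ(f*ψ) = φ(ψ)` for every
`ψ ∈ L^∞(ℝ)` and every `f ∈ P(ℝ)` (nonnegative, integral one).  Here `g` ranges over
the elements of `L^∞(ℝ)` representing the convolution `f*ψ`. -/
def IsTopologicallyInvariant (φ : Lp ℂ ⊤ (volume : Measure ℝ) →L[ℂ] ℂ) : Prop :=
  ∀ f : ℝ → ℝ, Integrable f volume → 0 ≤ᵐ[volume] f → (∫ t, f t) = 1 →
    ∀ ψ g : Lp ℂ ⊤ (volume : Measure ℝ),
      (⇑g : ℝ → ℂ) =ᵐ[volume] (fun x => ∫ t, (f t : ℂ) * ψ (x - t)) →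
      φ g = φ ψ


lemma aux_rep (ψ : Lp ℂ ⊤ (volume : Measure ℝ)) :
    ∃ u : ℝ → ℂ, Measurable u ∧ (∃ M : ℝ, 0 ≤ M ∧ ∀ x, ‖u x‖ ≤ M) ∧ u =ᵐ[volume] ψ := by
  have hb := ae_le_lpNorm_exponent_top (Lp.memLp ψ)
  set M := lpNorm (⇑ψ) ⊤ volume with hMdef
  have hM : 0 ≤ M := lpNorm_nonneg
  have hmeas : Measurable (⇑ψ : ℝ → ℂ) := (Lp.stronglyMeasurable ψ).measurable
  have hS : MeasurableSet {x | ‖ψ x‖ ≤ M} := measurableSet_le hmeas.norm measurable_const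
  refine ⟨Set.indicator {x | ‖ψ x‖ ≤ M} ψ, hmeas.indicator hS, ⟨M, hM, ?_⟩, ?_⟩
  · intro x
    by_cases hx : ‖ψ x‖ ≤ M
    · rw [Set.indicator_of_mem (by exact hx)]; exact hx
    · rw [Set.indicator_of_notMem (by exact hx)]; simpa using hM
  · filter_upwards [hb] with x hx
    rw [Set.indicator_of_mem (by exact hx)]

lemma aux_interval {u : ℝ → ℂ} (hu : Measurable u) {M : ℝ} (hM : ∀ x, ‖u x‖ ≤ M) (a b : ℝ) :
    IntervalIntegrable u volume a b := by
  rw [intervalIntegrable_iff]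
  have : IsFiniteMeasure (volume.restrict (Set.uIoc a b)) := by
    rw [Set.uIoc]; infer_instance
  exact Integrable.of_bound (C := M) hu.aestronglyMeasurable (Eventually.of_forall hM)

lemma aux_core (f : ℝ → ℝ) (hf : Integrable f volume) (hf0 : 0 ≤ᵐ[volume] f)
    (hf1 : (∫ t, f t) = 1) (u : ℝ → ℂ) (hu : Measurable u) (M : ℝ) (hM0 : 0 ≤ M)
    (hM : ∀ x, ‖u x‖ ≤ M) (θ : ℝ) (hθ : 0 < θ) (x : ℝ) :
    ‖∫ s in (x - θ)..(x + θ), ((∫ t, (f t : ℂ) * u (s - t)) - u s)‖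
      ≤ ∫ t, f t * min (2 * |t| * M) (4 * θ * M) := by
  have hfc : Integrable (fun t => (f t : ℂ)) volume := hf.ofReal
  have h1 : ∀ s, ((∫ t, (f t : ℂ) * u (s - t)) - u s) = ∫ t, (f t : ℂ) * (u (s - t) - u s) := by
    intro s
    have e : (∫ t, (f t : ℂ) * u s) = u s := by
      rw [integral_mul_const, integral_complex_ofReal, hf1]; simp
    conv_lhs => rw [← e]
    rw [← integral_sub]
    · simp_rw [mul_sub]
    · refine hfc.mul_bdd (c := M) ?_ (Eventually.of_forall fun t => hM _)
      exact (hu.comp (measurable_const.sub measurable_id)).aestronglyMeasurable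
    · exact hfc.mul_const _
  simp_rw [h1]
  rw [MeasureTheory.intervalIntegral_integral_swap]
  swap
  · have : IsFiniteMeasure (volume.restrict (Set.uIoc (x - θ) (x + θ))) := by
      rw [Set.uIoc]; infer_instance
    have h2 : Integrable (fun z : ℝ × ℝ => (1 : ℂ) * (f z.2 : ℂ))
      ((volume.restrict (Set.uIoc (x - θ) (x + θ))).prod volume) :=
      Integrable.mul_prod (integrable_const _) hfc
    simp only [one_mul] at h2
    refine h2.mul_bdd (c := 2 * M) ?_ (Eventually.of_forall fun z => ?_)
    · exact ((hu.comp (measurable_fst.sub measurable_snd)).sub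
        (hu.comp measurable_fst)).aestronglyMeasurable
    · refine (norm_sub_le _ _).trans ?_
      linarith [hM (z.1 - z.2), hM z.1]
  refine norm_integral_le_of_norm_le ?_ ?_
  · refine hf.mul_bdd (c := 4 * θ * M) ?_ (Eventually.of_forall fun t => ?_)
    · exact (by fun_prop : Continuous fun t : ℝ => min (2 * |t| * M) (4 * θ * M)).aestronglyMeasurable
    · rw [Real.norm_of_nonneg (by positivity)]
      exact min_le_right _ _
  · filter_upwards [hf0] with t ht
    rw [intervalIntegral.integral_const_mul, norm_mul, Complex.norm_real, Real.norm_of_nonneg ht]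
    refine mul_le_mul_of_nonneg_left (le_min ?_ ?_) ht
    · rw [intervalIntegral.integral_sub]
      rotate_left
      · exact aux_interval (hu.comp (measurable_id.sub measurable_const)) (fun x => hM _) _ _
      · exact aux_interval hu hM _ _
      rw [intervalIntegral.integral_comp_sub_right (fun s => u s),
        intervalIntegral.integral_interval_sub_interval_comm (aux_interval hu hM _ _)
        (aux_interval hu hM _ _) (aux_interval hu hM _ _)]
      refine (norm_sub_le _ _).trans ?_
      have k1 := intervalIntegral.norm_integral_le_of_norm_le_const (f := u) (C := M)
        (a := x - θ - t) (b := x - θ) (fun s _ => hM s)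
      have k2 := intervalIntegral.norm_integral_le_of_norm_le_const (f := u) (C := M)
        (a := x + θ - t) (b := x + θ) (fun s _ => hM s)
      simp only [sub_sub_cancel] at k1 k2
      linarith
    · have k := intervalIntegral.norm_integral_le_of_norm_le_const
        (f := fun s => u (s - t) - u s) (C := 2 * M)
        (a := x - θ) (b := x + θ) (fun s _ => by
          refine (norm_sub_le _ _).trans ?_
          linarith [hM (s - t), hM s])
      refine k.trans (le_of_eq ?_)
      rw [abs_of_pos (by linarith)]; ring

lemma aux_eps (f : ℝ → ℝ) (hf : Integrable f volume) (M : ℝ) (hM0 : 0 ≤ M) :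
    Tendsto (fun θ : ℝ => (1 / (2 * θ)) * ∫ t, f t * min (2 * |t| * M) (4 * θ * M))
      atTop (nhds 0) := by
  simp_rw [← integral_const_mul]
  have : (0 : ℝ) = ∫ t : ℝ, (0 : ℝ) := by simp
  rw [this]
  refine tendsto_integral_filter_of_dominated_convergence (fun t => 2 * M * |f t|) ?_ ?_ ?_ ?_
  · refine Eventually.of_forall fun θ => ?_
    refine (hf.aestronglyMeasurable.mul ?_).const_mul _
    exact (by fun_prop : Continuous fun t : ℝ => min (2 * |t| * M) (4 * θ * M)).aestronglyMeasurable
  · filter_upwards [eventually_gt_atTop 0] with θ hθ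
    refine Eventually.of_forall fun t => ?_
    have h0 : 0 ≤ min (2 * |t| * M) (4 * θ * M) := by positivity
    rw [norm_mul, norm_mul, Real.norm_of_nonneg h0, Real.norm_of_nonneg (by positivity), Real.norm_eq_abs]
    calc 1 / (2 * θ) * (|f t| * min (2 * |t| * M) (4 * θ * M))
        ≤ 1 / (2 * θ) * (|f t| * (4 * θ * M)) := by
          gcongr; exact min_le_right _ _
      _ = 2 * M * |f t| := by field_simp; ring
  · exact hf.abs.const_mul _
  · refine Eventually.of_forall fun t => ?_
    have hz : Tendsto (fun θ : ℝ => |f t| * (2 * |t| * M) / (2 * θ)) atTop (nhds 0) :=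
      Tendsto.const_div_atTop (tendsto_id.const_mul_atTop (by norm_num)) _
    refine squeeze_zero_norm' ?_ hz
    filter_upwards [eventually_gt_atTop 0] with θ hθ
    have h0 : 0 ≤ min (2 * |t| * M) (4 * θ * M) := by positivity
    rw [norm_mul, norm_mul, Real.norm_of_nonneg h0, Real.norm_of_nonneg (by positivity), Real.norm_eq_abs]
    calc 1 / (2 * θ) * (|f t| * min (2 * |t| * M) (4 * θ * M))
        ≤ 1 / (2 * θ) * (|f t| * (2 * |t| * M)) := by
          gcongr; exact min_le_left _ _
      _ = _ := by ring

lemma aux_pbar_congr {u v : ℝ → ℝ} (h : u =ᵐ[volume] v) : pbar u = pbar v := by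
  unfold pbar
  congr 1
  ext θ
  congr 1
  ext x
  congr 1
  exact intervalIntegral.integral_congr_ae (h.mono fun x hx _ => hx)

lemma aux_pbar_zero (h : ℝ → ℂ) (hi : ∀ a b, IntervalIntegrable h volume a b) (ε : ℝ → ℝ)
    (hε : Tendsto (fun θ : ℝ => (1 / (2 * θ)) * ε θ) atTop (nhds 0))
    (hb : ∀ θ, 0 < θ → ∀ x, ‖∫ s in (x - θ)..(x + θ), h s‖ ≤ ε θ) :
    pbar (fun x => (h x).re) = 0 := by
  unfold pbar
  refine Tendsto.limsup_eq ?_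
  refine squeeze_zero_norm' ?_ hε
  filter_upwards [eventually_gt_atTop 0] with θ hθ
  have key : ∀ x, |(1 / (2 * θ)) * ∫ t in (x - θ)..(x + θ), (h t).re| ≤ (1 / (2 * θ)) * ε θ := by
    intro x
    rw [abs_mul, abs_of_pos (by positivity : 0 < 1 / (2 * θ))]
    refine mul_le_mul_of_nonneg_left ?_ (by positivity)
    have := Complex.reCLM.intervalIntegral_comp_comm (hi (x - θ) (x + θ))
    simp only [Complex.reCLM_apply] at this
    rw [this]
    exact (Complex.abs_re_le_norm _).trans (hb θ hθ x)
  rw [Real.norm_eq_abs, abs_le]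
  constructor
  · refine (abs_le.1 (key 0)).1.trans ?_
    exact le_ciSup (f := fun x : ℝ => (1 / (2 * θ)) * ∫ t in (x - θ)..(x + θ), (h t).re)
      ⟨_, by rintro _ ⟨x, rfl⟩; exact (abs_le.1 (key x)).2⟩ 0
  · exact ciSup_le fun x => (abs_le.1 (key x)).2

/-- The constant function one in `L^∞`. -/
noncomputable def auxOne : Lp ℂ ⊤ (volume : Measure ℝ) :=
  (memLp_top_const (1 : ℂ)).toLp (fun _ : ℝ => (1 : ℂ))

lemma auxOne_coe : (⇑auxOne : ℝ → ℂ) =ᵐ[volume] fun _ => 1 := MemLp.coeFn_toLp _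

/-- If `g` is real and bounded above by `C`, then `φ g ≤ C` and it is real. -/
lemma aux_le {φ : Lp ℂ ⊤ (volume : Measure ℝ) →L[ℂ] ℂ} (hφ : IsMean φ)
    (g : Lp ℂ ⊤ (volume : Measure ℝ)) (C : ℝ)
    (hg : ∀ᵐ x ∂(volume : Measure ℝ), (g x).re ≤ C ∧ (g x).im = 0) :
    (φ g).re ≤ C ∧ (φ g).im = 0 := by
  have h := hφ.1 ((C : ℂ) • auxOne - g) (by
    filter_upwards [hg, auxOne_coe, Lp.coeFn_sub ((C : ℂ) • auxOne) g,
      Lp.coeFn_smul (C : ℂ) auxOne] with x h1 h2 h3 h4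
    rw [h3, Pi.sub_apply, h4, Pi.smul_apply, h2]
    simp [h1.1, h1.2])
  rw [map_sub, map_smul, hφ.2 _ auxOne_coe] at h
  simp at h
  exact h

lemma aux_real {φ : Lp ℂ ⊤ (volume : Measure ℝ) →L[ℂ] ℂ} (hφ : IsMean φ)
    (g : Lp ℂ ⊤ (volume : Measure ℝ))
    (hg : ∀ᵐ x ∂(volume : Measure ℝ), (g x).im = 0) : (φ g).im = 0 := by
  refine (aux_le hφ g (lpNorm (⇑g) ⊤ volume) ?_).2
  filter_upwards [hg, ae_le_lpNorm_exponent_top (Lp.memLp g)] with x h1 h2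
  exact ⟨(Complex.re_le_norm _).trans h2, h1⟩

/-- real part in `L^∞` -/
lemma aux_re {φ : Lp ℂ ⊤ (volume : Measure ℝ) →L[ℂ] ℂ} (hφ : IsMean φ)
    (g : Lp ℂ ⊤ (volume : Measure ℝ)) :
    ∃ r : Lp ℂ ⊤ (volume : Measure ℝ), (⇑r =ᵐ[volume] fun x => ((g x).re : ℂ)) ∧
      (φ r).re = (φ g).re := by
  refine ⟨(Complex.ofRealCLM.comp Complex.reCLM).compLp g, ?_, ?_⟩
  · exact (Complex.ofRealCLM.comp Complex.reCLM).coeFn_compLp' g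
  · set r := (Complex.ofRealCLM.comp Complex.reCLM).compLp g
    have hr : ⇑r =ᵐ[volume] fun x => ((g x).re : ℂ) :=
      (Complex.ofRealCLM.comp Complex.reCLM).coeFn_compLp' g
    have h := aux_real hφ (Complex.I • (g - r)) (by
      filter_upwards [hr, Lp.coeFn_sub g r, Lp.coeFn_smul Complex.I (g - r)] with x h1 h2 h3
      rw [h3, Pi.smul_apply, h2, Pi.sub_apply, h1]
      simp)
    rw [map_smul, map_sub] at h
    simp at h
    linarith

lemma aux_bwd {φ : Lp ℂ ⊤ (volume : Measure ℝ) →L[ℂ] ℂ} (hφ : IsMean φ)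
    (H : ∀ ψ : Lp ℂ ⊤ (volume : Measure ℝ),
        (∀ᵐ x ∂(volume : Measure ℝ), (ψ x).im = 0) →
        (φ ψ).re ≤ pbar (fun x => (ψ x).re))
    (f : ℝ → ℝ) (hf : Integrable f volume) (hf0 : 0 ≤ᵐ[volume] f) (hf1 : (∫ t, f t) = 1)
    (ψ g : Lp ℂ ⊤ (volume : Measure ℝ))
    (hg : (⇑g : ℝ → ℂ) =ᵐ[volume] (fun x => ∫ t, (f t : ℂ) * ψ (x - t))) :
    (φ (g - ψ)).re ≤ 0 := by
  obtain ⟨r, hr, hre⟩ := aux_re hφ (g - ψ)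
  rw [← hre]
  refine (H r (by filter_upwards [hr] with x hx; rw [hx]; simp)).trans (le_of_eq ?_)
  obtain ⟨u, hu, ⟨M, hM0, hM⟩, huψ⟩ := aux_rep ψ
  obtain ⟨v, hv, ⟨N, hN0, hN⟩, hvg⟩ := aux_rep g
  have hconv : ∀ x, (∫ t, (f t : ℂ) * ψ (x - t)) = ∫ t, (f t : ℂ) * u (x - t) := by
    intro x
    refine integral_congr_ae ?_
    have := (quasiMeasurePreserving_sub_left volume x).ae_eq_comp huψ
    filter_upwards [this] with t ht
    simp only [Function.comp] at ht
    rw [ht]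
  have hh : (fun s => v s - u s) =ᵐ[volume] fun s => (∫ t, (f t : ℂ) * u (s - t)) - u s := by
    filter_upwards [hvg, hg] with x h1 h2
    rw [h1, h2, hconv]
  rw [aux_pbar_congr (v := fun x => (v x - u x).re)]
  · refine aux_pbar_zero _ (fun a b => (aux_interval hv hN a b).sub (aux_interval hu hM a b)) _
      (aux_eps f hf M hM0) ?_
    intro θ hθ x
    rw [intervalIntegral.integral_congr_ae (hh.mono fun x hx _ => hx)]
    exact aux_core f hf hf0 hf1 u hu M hM0 hM θ hθ x
  · filter_upwards [hr, hvg, huψ, Lp.coeFn_sub g ψ] with x h1 h2 h3 h4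
    rw [h1, h2, h3, h4]
    simp

lemma aux_fwd {φ : Lp ℂ ⊤ (volume : Measure ℝ) →L[ℂ] ℂ} (hφ : IsMean φ)
    (H : IsTopologicallyInvariant φ) (ψ : Lp ℂ ⊤ (volume : Measure ℝ))
    (hψ : ∀ᵐ x ∂(volume : Measure ℝ), (ψ x).im = 0) :
    (φ ψ).re ≤ pbar (fun x => (ψ x).re) := by
  obtain ⟨u, hu, ⟨M, hM0, hM⟩, huψ⟩ := aux_rep ψ
  have hre : (fun x => (ψ x).re) =ᵐ[volume] fun x => (u x).re := by
    filter_upwards [huψ] with x hx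
    rw [hx]
  rw [aux_pbar_congr hre]
  have hcu : (⇑ψ : ℝ → ℂ) =ᵐ[volume] fun x => ((u x).re : ℂ) := by
    filter_upwards [huψ, hψ] with x h1 h2
    rw [h1]
    apply Complex.ext <;> simp [h2]
  have hii : ∀ a b, IntervalIntegrable (fun x => (u x).re) volume a b := by
    intro a b
    rw [intervalIntegrable_iff]
    exact ((intervalIntegrable_iff.1 (aux_interval hu hM a b))).re
  have hbd : ∀ θ, 0 < θ → ∀ x, |(1 / (2 * θ)) * ∫ t in (x - θ)..(x + θ), (u t).re| ≤ M := by
    intro θ hθ x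
    have k := intervalIntegral.norm_integral_le_of_norm_le_const
        (f := fun s => (u s).re) (C := M)
        (a := x - θ) (b := x + θ) (fun s _ => (Complex.abs_re_le_norm _).trans (hM s))
    rw [abs_mul, abs_of_pos (by positivity : 0 < 1 / (2 * θ))]
    rw [Real.norm_eq_abs, show x + θ - (x - θ) = 2 * θ by ring,
      abs_of_pos (by positivity : 0 < 2 * θ)] at k
    calc _ ≤ 1 / (2 * θ) * (M * (2 * θ)) := by gcongr
      _ = M := by field_simp
  have hS : ∀ θ, 0 < θ → ∀ x, (1 / (2 * θ)) * ∫ t in (x - θ)..(x + θ), (u t).re ≤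
      ⨆ x : ℝ, (1 / (2 * θ)) * ∫ t in (x - θ)..(x + θ), (u t).re := by
    intro θ hθ x
    exact le_ciSup (f := fun x : ℝ => (1 / (2 * θ)) * ∫ t in (x - θ)..(x + θ), (u t).re)
      ⟨M, by rintro _ ⟨x, rfl⟩; exact (abs_le.1 (hbd θ hθ x)).2⟩ x
  unfold pbar
  refine Filter.le_limsup_of_frequently_le ?_ ?_
  swap
  · refine ⟨M, ?_⟩
    rw [eventually_map]
    filter_upwards [eventually_gt_atTop 0] with θ hθ
    exact ciSup_le fun x => (abs_le.1 (hbd θ hθ x)).2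
  refine Eventually.frequently ?_
  filter_upwards [eventually_gt_atTop 0] with θ hθ
  set A : ℝ → ℝ := fun x => (1 / (2 * θ)) * ∫ t in (x - θ)..(x + θ), (u t).re with hA
  have hAc : Continuous A := by
    have hP := intervalIntegral.continuous_primitive (fun a b => hii a b) 0
    have : A = fun x => (1 / (2 * θ)) * ((∫ t in (0:ℝ)..(x + θ), (u t).re)
        - ∫ t in (0:ℝ)..(x - θ), (u t).re) := by
      ext x
      rw [intervalIntegral.integral_interval_sub_left (hii _ _) (hii _ _)]
    rw [this]
    exact continuous_const.mul ((hP.comp (continuous_id.add continuous_const)).sub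
      (hP.comp (continuous_id.sub continuous_const)))
  have hmem : MemLp (fun x => (A x : ℂ)) ⊤ (volume : Measure ℝ) := by
    refine memLp_top_of_bound (Complex.continuous_ofReal.comp hAc).aestronglyMeasurable M
      (Eventually.of_forall fun x => ?_)
    rw [Complex.norm_real]
    exact hbd θ hθ x
  have hgc := hmem.coeFn_toLp
  have hφg := H (Set.indicator (Set.Ioc (-θ) θ) fun _ => 1 / (2 * θ)) ?_ ?_ ?_ ψ (hmem.toLp _) ?_
  · rw [← hφg]
    refine (aux_le hφ _ _ ?_).1
    filter_upwards [hgc] with x hx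
    rw [hx]
    exact ⟨by rw [Complex.ofReal_re]; exact hS θ hθ x, Complex.ofReal_im _⟩
  · exact (integrable_indicator_iff measurableSet_Ioc).2 (integrableOn_const (by simp))
  · exact Eventually.of_forall fun x => Set.indicator_nonneg (fun _ _ => by positivity) x
  · rw [integral_indicator measurableSet_Ioc, setIntegral_const, measureReal_def, Real.volume_Ioc,
      ENNReal.toReal_ofReal (by linarith), smul_eq_mul]
    field_simp
    ring
  · filter_upwards [hgc] with x hx
    rw [hx]
    have e1 : (fun t => ((Set.indicator (Set.Ioc (-θ) θ) (fun _ => 1 / (2 * θ)) t : ℝ) : ℂ) * ψ (x - t))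
        = Set.indicator (Set.Ioc (-θ) θ) fun t => ((1 / (2 * θ) : ℝ) : ℂ) * ψ (x - t) := by
      ext t
      by_cases ht : t ∈ Set.Ioc (-θ) θ <;> simp [ht]
    rw [e1, integral_indicator measurableSet_Ioc, ← intervalIntegral.integral_of_le (by linarith),
      intervalIntegral.integral_const_mul, intervalIntegral.integral_comp_sub_left (fun s => ψ s),
      sub_neg_eq_add, intervalIntegral.integral_congr_ae (hcu.mono fun x hx _ => hx),
      intervalIntegral.integral_ofReal, hA]
    push_cast
    rfl

/-- A mean `φ` on `L^∞(ℝ)` is topologically invariant iff `φ(ψ) ≤ p̄(ψ)` for every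
real-valued `ψ ∈ L^∞(ℝ)`. -/
theorem isTopologicallyInvariant_iff_le_pbar
    (φ : Lp ℂ ⊤ (volume : Measure ℝ) →L[ℂ] ℂ) (hφ : IsMean φ) :
    IsTopologicallyInvariant φ ↔
      ∀ ψ : Lp ℂ ⊤ (volume : Measure ℝ),
        (∀ᵐ x ∂(volume : Measure ℝ), (ψ x).im = 0) →
        (φ ψ).re ≤ pbar (fun x => (ψ x).re) := by
  refine ⟨fun H ψ hψ => aux_fwd hφ H ψ hψ, fun H f hf hf0 hf1 ψ g hg => ?_⟩
  have key : ∀ c : ℂ, (c * (φ g - φ ψ)).re ≤ 0 := by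
    intro c
    have h := aux_bwd hφ H f hf hf0 hf1 (c • ψ) (c • g) (by
      filter_upwards [hg, Lp.coeFn_smul c g] with x h1 h2
      rw [h2, Pi.smul_apply, h1, smul_eq_mul, ← integral_const_mul]
      refine integral_congr_ae ?_
      have := (quasiMeasurePreserving_sub_left volume x).ae_eq_comp (Lp.coeFn_smul c ψ)
      filter_upwards [this] with t ht
      simp only [Function.comp, Pi.smul_apply, smul_eq_mul] at ht
      rw [ht]
      ring)
    rw [← smul_sub, map_smul, map_sub, smul_eq_mul] at h
    exact h
  have h := key (starRingEnd ℂ (φ g - φ ψ))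
  rw [← Complex.normSq_eq_conj_mul_self, Complex.ofReal_re] at h
  exact sub_eq_zero.1 (Complex.normSq_eq_zero.1 (le_antisymm h (Complex.normSq_nonneg _)))
end

section
/- For every real-valued ψ ∈ L^∞(ℝ) and every f ∈ P(ℝ), one has p̄(ψ − f*ψ) = 0 and p_(ψ − f*ψ) = 0. -/
open MeasureTheory Filter

/-- `p_(ψ) := −p̄(−ψ)`. -/
noncomputable def punder (ψ : ℝ → ℝ) : ℝ := -pbar (fun x => -ψ x)

lemma pbar_eq_zero_of_bound (φ : ℝ → ℝ) (g : ℝ → ℝ) (hg : Tendsto g atTop (nhds 0))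
    (h : ∀ θ : ℝ, 0 < θ → ∀ x : ℝ, |(1 / (2 * θ)) * ∫ t in (x - θ)..(x + θ), φ t| ≤ g θ) :
    pbar φ = 0 := by
  unfold pbar
  apply Tendsto.limsup_eq
  apply squeeze_zero_norm' _ hg
  filter_upwards [eventually_gt_atTop 0] with θ hθ
  rw [Real.norm_eq_abs, abs_le]
  constructor
  · refine le_trans (abs_le.1 (h θ hθ 0)).1 ?_
    exact le_ciSup (f := fun x : ℝ => (1 / (2 * θ)) * ∫ t in (x - θ)..(x + θ), φ t)
      ⟨g θ, by rintro _ ⟨x, rfl⟩; exact (abs_le.1 (h θ hθ x)).2⟩ 0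
  · exact ciSup_le fun x => (abs_le.1 (h θ hθ x)).2

lemma key_bound (ψ : ℝ → ℝ) (hmeas : Measurable ψ)
    (C : ℝ) (hC : ∀ x, |ψ x| ≤ C)
    (f : ℝ → ℝ) (hf : Integrable f volume) 
    (hf1 : (∫ t, f t) = 1) (θ : ℝ) (hθ : 0 < θ) (x : ℝ) :
    |(1 / (2 * θ)) * ∫ s in (x - θ)..(x + θ), (ψ s - ∫ t, f t * ψ (s - t))| ≤
      ∫ t, |f t| * min (2 * C) (C * |t| / θ) := by
  have hC0 : 0 ≤ C := (abs_nonneg _).trans (hC 0)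
  have hψi : ∀ a b : ℝ, IntervalIntegrable ψ volume a b := fun a b => by
    refine (intervalIntegrable_const (c := C)).mono_fun hmeas.aestronglyMeasurable ?_
    refine Eventually.of_forall fun y => ?_
    simpa [abs_of_nonneg hC0] using hC y
  set a := x - θ with ha
  set b := x + θ with hb
  have hab : a ≤ b := by linarith
  have hint : Integrable (Function.uncurry fun s t : ℝ => f t * ψ (s - t))
      ((volume.restrict (Set.uIoc a b)).prod volume) := by
    have h1 : Integrable (fun p : ℝ × ℝ => f p.2)
      ((volume.restrict (Set.uIoc a b)).prod volume) := by
      have : IsFiniteMeasure (volume.restrict (Set.uIoc a b)) := by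
        rw [Set.uIoc]; infer_instance
      exact hf.comp_snd _
    exact h1.mul_bdd (c := C) (hmeas.comp (measurable_fst.sub measurable_snd)).aestronglyMeasurable
      (Eventually.of_forall fun p => hC _)
  have hconv : IntervalIntegrable (fun s => ∫ t, f t * ψ (s - t)) volume a b := by
    rw [intervalIntegrable_iff]
    exact hint.integral_prod_left
  have hswap : ∫ s in a..b, ∫ t, f t * ψ (s - t) = ∫ t, f t * ∫ s in (a - t)..(b - t), ψ s := by
    rw [intervalIntegral_integral_swap hint]
    congr 1; ext t
    rw [intervalIntegral.integral_const_mul, intervalIntegral.integral_comp_sub_right]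
  have hJ : Continuous fun t : ℝ => ∫ s in (a - t)..(b - t), ψ s := by
    have hp := intervalIntegral.continuous_primitive hψi 0
    have : (fun t : ℝ => ∫ s in (a - t)..(b - t), ψ s) =
        fun t => (∫ s in (0:ℝ)..(b - t), ψ s) - ∫ s in (0:ℝ)..(a - t), ψ s := by
      ext t
      rw [intervalIntegral.integral_interval_sub_left (hψi _ _) (hψi _ _)]
    rw [this]
    exact (hp.comp (continuous_const.sub continuous_id)).sub
      (hp.comp (continuous_const.sub continuous_id))
  have hbd : ∀ u v : ℝ, |∫ s in u..v, ψ s| ≤ C * |v - u| := fun u v => by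
    rw [← Real.norm_eq_abs (∫ s in u..v, ψ s)]
    exact intervalIntegral.norm_integral_le_of_norm_le_const fun y _ => hC y
  have hJi : Integrable fun t => f t * ∫ s in (a - t)..(b - t), ψ s := by
    refine hf.mul_bdd (c := C * |b - a|) hJ.aestronglyMeasurable (Eventually.of_forall fun t => ?_)
    simpa using hbd (a - t) (b - t)
  have e : ∫ s in a..b, (ψ s - ∫ t, f t * ψ (s - t)) =
      ∫ t, f t * ((∫ s in a..b, ψ s) - ∫ s in (a - t)..(b - t), ψ s) := by
    rw [intervalIntegral.integral_sub (hψi _ _) hconv, hswap]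
    simp_rw [mul_sub]
    rw [integral_sub (hf.mul_const _) hJi, integral_mul_const, hf1, one_mul]
  rw [e, ← integral_const_mul, ← Real.norm_eq_abs]
  apply norm_integral_le_of_norm_le
  · refine hf.abs.mul_bdd (c := 2 * C) (by fun_prop) (Eventually.of_forall fun t => ?_)
    rw [Real.norm_eq_abs, abs_of_nonneg (le_min (by positivity) (by positivity))]
    exact min_le_left _ _
  · refine Eventually.of_forall fun t => ?_
    have h2 : |(∫ s in a..b, ψ s) - ∫ s in (a - t)..(b - t), ψ s| ≤ 2 * θ * min (2 * C) (C * |t| / θ) := by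
      rw [mul_min_of_nonneg _ _ (by positivity)]
      refine le_min ?_ ?_
      · have h3 := hbd a b
        have h4 := hbd (a - t) (b - t)
        have h5 : b - a = 2 * θ := by rw [ha, hb]; ring
        rw [show b - t - (a - t) = b - a by ring] at h4
        rw [h5, abs_of_pos (by positivity : 0 < 2 * θ)] at h3 h4
        refine (abs_sub _ _).trans ?_
        linarith
      · rw [intervalIntegral.integral_interval_sub_interval_comm (hψi _ _) (hψi _ _) (hψi _ _)]
        have h3 := hbd a (a - t)
        have h4 := hbd b (b - t)
        rw [show a - t - a = - t by ring, abs_neg] at h3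
        rw [show b - t - b = - t by ring, abs_neg] at h4
        refine (abs_sub _ _).trans ?_
        have : 2 * θ * (C * |t| / θ) = 2 * (C * |t|) := by field_simp
        linarith
    rw [Real.norm_eq_abs, abs_mul, abs_mul, abs_of_pos (by positivity : 0 < 1 / (2 * θ))]
    calc _ ≤ 1 / (2 * θ) * (|f t| * (2 * θ * min (2 * C) (C * |t| / θ))) := by gcongr
      _ = _ := by field_simp

lemma g_tendsto (C : ℝ) (hC0 : 0 ≤ C) (f : ℝ → ℝ) (hf : Integrable f volume) :
    Tendsto (fun θ : ℝ => ∫ t, |f t| * min (2 * C) (C * |t| / θ)) atTop (nhds 0) := by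
  have : (0:ℝ) = ∫ t : ℝ, (0:ℝ) := by simp
  rw [this]
  refine tendsto_integral_filter_of_dominated_convergence (fun t => |f t| * (2 * C)) ?_ ?_
    (hf.abs.mul_const _) ?_
  · refine Eventually.of_forall fun θ => ?_
    exact hf.abs.aestronglyMeasurable.mul (by fun_prop)
  · filter_upwards [eventually_gt_atTop 0] with θ hθ
    refine Eventually.of_forall fun t => ?_
    have hm : 0 ≤ min (2 * C) (C * |t| / θ) := le_min (by positivity) (by positivity)
    rw [Real.norm_eq_abs, abs_mul, abs_abs, abs_of_nonneg hm]
    gcongr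
    exact min_le_left _ _
  · refine Eventually.of_forall fun t => ?_
    have h1 : Tendsto (fun θ : ℝ => C * |t| / θ) atTop (nhds 0) :=
      tendsto_const_nhds.div_atTop tendsto_id
    have h2 := ((tendsto_const_nhds (x := 2 * C)).min h1).const_mul |f t|
    rwa [min_eq_right (by positivity), mul_zero] at h2

/-- For every real-valued `ψ ∈ L^∞(ℝ)` and every `f ∈ P(ℝ)` (nonnegative with
integral one), one has `p̄(ψ − f*ψ) = 0` and `p_(ψ − f*ψ) = 0`. -/
theorem pbar_punder_sub_conv_eq_zero (ψ : ℝ → ℝ) (hmeas : Measurable ψ)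
    (hbdd : ∃ C : ℝ, ∀ x, |ψ x| ≤ C)
    (f : ℝ → ℝ) (hf : Integrable f volume) (hf0 : 0 ≤ᵐ[volume] f)
    (hf1 : (∫ t, f t) = 1) :
    pbar (fun x => ψ x - ∫ t, f t * ψ (x - t)) = 0 ∧
    punder (fun x => ψ x - ∫ t, f t * ψ (x - t)) = 0 := by
  obtain ⟨C, hC⟩ := hbdd
  have hC0 : 0 ≤ C := (abs_nonneg _).trans (hC 0)
  have hk := key_bound ψ hmeas C hC f hf hf1
  refine ⟨pbar_eq_zero_of_bound _ _ (g_tendsto C hC0 f hf) hk, ?_⟩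
  unfold punder
  rw [pbar_eq_zero_of_bound _ _ (g_tendsto C hC0 f hf), neg_zero]
  intro θ hθ x
  rw [intervalIntegral.integral_neg, mul_neg, abs_neg]
  exact hk θ hθ x
end

section
/- Let ψ ∈ L^∞(ℝ) (complex-valued) and α ∈ ℂ. Then φ(ψ) = α for every topologically invariant mean φ on L^∞(ℝ) if and only if lim_{θ→∞} (1/(2θ)) ∫_{x−θ}^{x+θ} ψ(t) dt = α uniformly in x ∈ ℝ (i.e., for every ε > 0 there is Θ such that for all θ ≥ Θ and all x ∈ ℝ, |(1/(2θ)) ∫_{x−θ}^{x+θ} ψ(t) dt − α| < ε). -/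
open MeasureTheory Filter

noncomputable abbrev LinfR := Lp ℂ ⊤ (volume : Measure ℝ)

lemma linf_ae_le (h : LinfR) : ∀ᵐ x ∂(volume : Measure ℝ), ‖h x‖ ≤ ‖h‖ := by
  have h1 := ae_le_eLpNormEssSup (f := (h : ℝ → ℂ)) (μ := (volume : Measure ℝ))
  filter_upwards [h1] with x hx
  rw [Lp.norm_def, eLpNorm_exponent_top]
  have h2 : eLpNormEssSup (h : ℝ → ℂ) volume ≠ ⊤ := by
    have := Lp.eLpNorm_ne_top h
    rwa [eLpNorm_exponent_top] at this
  have := ENNReal.toReal_mono h2 hx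
  simpa using this

lemma linf_norm_le (h : LinfR) (C : ℝ) (hC : 0 ≤ C)
    (hb : ∀ᵐ x ∂(volume : Measure ℝ), ‖h x‖ ≤ C) : ‖h‖ ≤ C := by
  rw [Lp.norm_def, eLpNorm_exponent_top]
  exact ENNReal.toReal_le_of_le_ofReal hC (eLpNormEssSup_le_of_ae_bound hb)

lemma linf_ii (h : LinfR) (a b : ℝ) : IntervalIntegrable h volume a b := by
  rw [intervalIntegrable_iff]
  have : IsFiniteMeasure ((volume : Measure ℝ).restrict (Set.uIoc a b)) := by
    unfold Set.uIoc; infer_instance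
  exact ((Lp.memLp h).restrict _).integrable le_top

lemma linf_int_le (h : LinfR) (a b : ℝ) : ‖∫ t in a..b, h t‖ ≤ ‖h‖ * |b - a| := by
  apply intervalIntegral.norm_integral_le_of_norm_le_const_ae
  filter_upwards [linf_ae_le h] with x hx _ using hx

noncomputable def avg (θ x : ℝ) (h : LinfR) : ℂ :=
  ((1 / (2 * θ) : ℝ) : ℂ) * (∫ t in (x - θ)..(x + θ), h t)

lemma avg_norm_le (θ x : ℝ) (hθ : 0 < θ) (h : LinfR) : ‖avg θ x h‖ ≤ ‖h‖ := by
  unfold avg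
  rw [norm_mul, Complex.norm_real, Real.norm_of_nonneg (by positivity)]
  have := linf_int_le h (x - θ) (x + θ)
  have e : |x + θ - (x - θ)| = 2 * θ := by
    rw [show x + θ - (x - θ) = 2 * θ by ring]; exact abs_of_pos (by positivity)
  rw [e] at this
  calc 1 / (2 * θ) * _ ≤ 1 / (2 * θ) * (‖h‖ * (2 * θ)) := by gcongr
    _ = ‖h‖ := by field_simp

lemma avg_congr (θ x : ℝ) (h : LinfR) (k : ℝ → ℂ) (hk : (h : ℝ → ℂ) =ᵐ[volume] k) :
    avg θ x h = ((1 / (2 * θ) : ℝ) : ℂ) * (∫ t in (x - θ)..(x + θ), k t) := by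
  unfold avg
  congr 1
  apply intervalIntegral.integral_congr_ae
  filter_upwards [hk] with t ht _ using ht

lemma avg_add (θ x : ℝ) (h k : LinfR) : avg θ x (h + k) = avg θ x h + avg θ x k := by
  rw [avg_congr θ x (h + k) _ (Lp.coeFn_add h k)]
  simp only [Pi.add_apply]
  rw [intervalIntegral.integral_add (linf_ii h _ _) (linf_ii k _ _)]
  unfold avg; ring

lemma avg_smul (θ x : ℝ) (c : ℂ) (h : LinfR) : avg θ x (c • h) = c * avg θ x h := by
  rw [avg_congr θ x (c • h) _ (Lp.coeFn_smul c h)]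
  simp only [Pi.smul_apply, smul_eq_mul]
  rw [intervalIntegral.integral_const_mul]
  unfold avg; ring

lemma avg_one (θ x : ℝ) (hθ : 0 < θ) (h : LinfR) (hk : (h : ℝ → ℂ) =ᵐ[volume] (fun _ => 1)) :
    avg θ x h = 1 := by
  rw [avg_congr θ x h _ hk, intervalIntegral.integral_const]
  rw [Complex.real_smul, ← Complex.ofReal_one, ← Complex.ofReal_mul, ← Complex.ofReal_mul]
  congr 1
  field_simp
  ring

lemma avg_pos (θ x : ℝ) (hθ : 0 < θ) (h : LinfR)
    (hh : ∀ᵐ x ∂(volume : Measure ℝ), 0 ≤ (h x).re ∧ (h x).im = 0) :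
    0 ≤ (avg θ x h).re ∧ (avg θ x h).im = 0 := by
  have hk : (h : ℝ → ℂ) =ᵐ[volume] (fun t => ((h t).re : ℂ)) := by
    filter_upwards [hh] with t ht
    apply Complex.ext <;> simp [ht.2]
  rw [avg_congr θ x h _ hk, intervalIntegral.integral_ofReal, ← Complex.ofReal_mul]
  refine ⟨?_, Complex.ofReal_im _⟩
  rw [Complex.ofReal_re]
  apply mul_nonneg (by positivity)
  apply intervalIntegral.integral_nonneg_of_ae (by linarith)
  filter_upwards [hh] with t ht using ht.1

lemma linf_shift (h : LinfR) (a b t : ℝ) :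
    ‖(∫ x in (a - t)..(b - t), h x) - ∫ x in a..b, h x‖ ≤ 2 * ‖h‖ * |t| := by
  rw [intervalIntegral.integral_interval_sub_interval_comm (linf_ii h _ _) (linf_ii h _ _)
    (linf_ii h _ _)]
  have h1 := linf_int_le h (a - t) a
  have h2 := linf_int_le h (b - t) b
  simp only [sub_sub_cancel] at h1 h2
  have := norm_sub_le (∫ x in (a - t)..a, h x) (∫ x in (b - t)..b, h x)
  linarith

lemma linf_fubini (f : ℝ → ℝ) (hf : Integrable f volume) (h : LinfR) (a b : ℝ) (hab : a ≤ b) :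
    ∫ x in a..b, (∫ t, (f t : ℂ) * h (x - t)) = ∫ t, (f t : ℂ) * ∫ x in (a - t)..(b - t), h x := by
  rw [intervalIntegral.integral_of_le hab, integral_integral_swap]
  · congr 1
    ext t
    rw [integral_const_mul, ← intervalIntegral.integral_of_le hab,
      intervalIntegral.integral_comp_sub_right (fun x => h x)]
  · have h1 : Integrable (fun p : ℝ × ℝ => (f p.2 : ℂ))
        ((volume.restrict (Set.Ioc a b)).prod volume) :=
      (hf.ofReal (𝕜 := ℂ)).comp_snd _
    refine Integrable.mul_bdd (c := ‖h‖) h1 ?_ ?_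
    · exact ((Lp.stronglyMeasurable h).comp_measurable
        (measurable_fst.sub measurable_snd)).aestronglyMeasurable
    · have q := (quasiMeasurePreserving_sub (volume : Measure ℝ) (volume : Measure ℝ)).ae
        (linf_ae_le h)
      exact (Measure.AbsolutelyContinuous.prod Measure.restrict_le_self.absolutelyContinuous
        Measure.AbsolutelyContinuous.rfl).ae_le q

lemma avg_conv (θ x : ℝ) (hθ : 0 < θ) (f : ℝ → ℝ) (hf : Integrable f volume)
    (hf1 : (∫ t, f t) = 1) (h g : LinfR)
    (hg : (g : ℝ → ℂ) =ᵐ[volume] (fun x => ∫ t, (f t : ℂ) * h (x - t))) :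
    ‖avg θ x g - avg θ x h‖ ≤ ∫ t, |f t| * (‖h‖ * min 2 (|t| / θ)) := by
  have hc : Continuous fun t => ∫ y in (x - θ - t)..(x + θ - t), h y := by
    have hp := intervalIntegral.continuous_primitive (fun a b => linf_ii h a b) 0
    have : (fun t => ∫ y in (x - θ - t)..(x + θ - t), h y) =
        fun t => (∫ y in (0:ℝ)..(x + θ - t), h y) - ∫ y in (0:ℝ)..(x - θ - t), h y := by
      ext t
      rw [intervalIntegral.integral_interval_sub_left (linf_ii h _ _) (linf_ii h _ _)]
    rw [this]
    exact (hp.comp (by fun_prop)).sub (hp.comp (by fun_prop))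
  have hl : ∀ t, |x + θ - t - (x - θ - t)| = 2 * θ := fun t => by
    rw [show x + θ - t - (x - θ - t) = 2 * θ by ring]; exact abs_of_pos (by positivity)
  have i1 : Integrable (fun t => (f t : ℂ) * ∫ y in (x - θ - t)..(x + θ - t), h y) := by
    refine Integrable.mul_bdd (c := ‖h‖ * (2 * θ)) (hf.ofReal (𝕜 := ℂ)) hc.aestronglyMeasurable ?_
    refine Eventually.of_forall fun t => ?_
    have := linf_int_le h (x - θ - t) (x + θ - t)
    rwa [hl] at this
  have i2 : Integrable (fun t => (f t : ℂ) * ∫ y in (x - θ)..(x + θ), h y) :=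
    (hf.ofReal (𝕜 := ℂ)).mul_const _
  have e2 : ∫ y in (x - θ)..(x + θ), h y = ∫ t, (f t : ℂ) * ∫ y in (x - θ)..(x + θ), h y := by
    rw [integral_mul_const, integral_complex_ofReal, hf1]; simp
  rw [avg_congr θ x g _ hg, linf_fubini f hf h _ _ (by linarith)]
  unfold avg
  rw [← mul_sub]
  conv_lhs => rw [e2]
  rw [← integral_sub i1 i2, ← integral_const_mul]
  apply norm_integral_le_of_norm_le
  · refine Integrable.mul_bdd (c := ‖h‖ * 2) hf.abs (Continuous.aestronglyMeasurable (by fun_prop)) ?_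
    refine Eventually.of_forall fun t => ?_
    rw [Real.norm_of_nonneg (by positivity)]
    gcongr
    exact min_le_left _ _
  · refine Eventually.of_forall fun t => ?_
    rw [← mul_sub, norm_mul, norm_mul, Complex.norm_real, Complex.norm_real,
      Real.norm_of_nonneg (by positivity : 0 ≤ 1 / (2 * θ)), Real.norm_eq_abs]
    set D := ‖(∫ y in (x - θ - t)..(x + θ - t), h y) - ∫ y in (x - θ)..(x + θ), h y‖ with hD
    have b1 : D ≤ 2 * ‖h‖ * |t| := linf_shift h _ _ t
    have b2 : D ≤ ‖h‖ * (2 * θ) + ‖h‖ * (2 * θ) := by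
      refine (norm_sub_le _ _).trans ?_
      have h1 := linf_int_le h (x - θ - t) (x + θ - t)
      have h2 := linf_int_le h (x - θ) (x + θ)
      have h3 := hl 0
      simp only [sub_zero] at h3
      rw [hl] at h1
      rw [h3] at h2
      exact add_le_add h1 h2
    have : 1 / (2 * θ) * D ≤ ‖h‖ * min 2 (|t| / θ) := by
      rw [mul_min_of_nonneg _ _ (norm_nonneg h)]
      apply le_min
      · calc 1 / (2 * θ) * D ≤ 1 / (2 * θ) * (‖h‖ * (2 * θ) + ‖h‖ * (2 * θ)) := by gcongr
          _ = ‖h‖ * 2 := by field_simp; ring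
      · calc 1 / (2 * θ) * D ≤ 1 / (2 * θ) * (2 * ‖h‖ * |t|) := by gcongr
          _ = ‖h‖ * (|t| / θ) := by field_simp
    calc _ = |f t| * (1 / (2 * θ) * D) := by ring
      _ ≤ _ := by gcongr

lemma avg_conv_tendsto (θ x : ℕ → ℝ) (hθ : ∀ n, 0 < θ n) (hθt : Tendsto θ atTop atTop)
    (f : ℝ → ℝ) (hf : Integrable f volume)
    (hf1 : (∫ t, f t) = 1) (h g : LinfR)
    (hg : (g : ℝ → ℂ) =ᵐ[volume] (fun x => ∫ t, (f t : ℂ) * h (x - t))) :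
    Tendsto (fun n => avg (θ n) (x n) g - avg (θ n) (x n) h) atTop (nhds 0) := by
  apply squeeze_zero_norm (fun n => avg_conv (θ n) (x n) (hθ n) f hf hf1 h g hg)
  have : (0 : ℝ) = ∫ t : ℝ, (0 : ℝ) := by simp
  rw [this]
  apply tendsto_integral_of_dominated_convergence (fun t => |f t| * (‖h‖ * 2))
  · intro n
    exact hf.abs.aestronglyMeasurable.mul (Continuous.aestronglyMeasurable (by fun_prop))
  · exact hf.abs.mul_const _
  · intro n
    refine Eventually.of_forall fun t => ?_
    have := hθ n
    rw [Real.norm_of_nonneg (by positivity)]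
    gcongr
    exact min_le_left _ _
  · refine Eventually.of_forall fun t => ?_
    have h1 : Tendsto (fun n => |t| / θ n) atTop (nhds 0) := tendsto_const_nhds.div_atTop hθt
    have h2 : Tendsto (fun n => min 2 (|t| / θ n)) atTop (nhds (min 2 0)) :=
      tendsto_const_nhds.min h1
    have h3 := (h2.const_mul ‖h‖).const_mul |f t|
    simpa using h3

lemma exists_limit_mean (θ x : ℕ → ℝ) (hθ : ∀ n, 0 < θ n) (hθt : Tendsto θ atTop atTop) :
    ∃ φ : Lp ℂ ⊤ (volume : Measure ℝ) →L[ℂ] ℂ, IsMean φ ∧ IsTopologicallyInvariant φ ∧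
      ∀ h, Tendsto (fun n => avg (θ n) (x n) h) (hyperfilter ℕ : Filter ℕ) (nhds (φ h)) := by
  have ex : ∀ h : LinfR, ∃ z : ℂ,
      Tendsto (fun n => avg (θ n) (x n) h) (hyperfilter ℕ : Filter ℕ) (nhds z) := by
    intro h
    obtain ⟨z, -, hz⟩ := (isCompact_closedBall (0 : ℂ) ‖h‖).ultrafilter_le_nhds
      ((hyperfilter ℕ).map (fun n => avg (θ n) (x n) h)) (by
        rw [le_principal_iff]
        refine Filter.mem_map.2 (Filter.univ_mem' fun n => ?_)
        simpa using avg_norm_le (θ n) (x n) (hθ n) h)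
    exact ⟨z, hz⟩
  choose L hL using ex
  let φ0 : LinfR →ₗ[ℂ] ℂ :=
    { toFun := L
      map_add' := fun h k => by
        refine tendsto_nhds_unique (hL (h + k)) ?_
        simpa only [avg_add] using (hL h).add (hL k)
      map_smul' := fun c h => by
        refine tendsto_nhds_unique (hL (c • h)) ?_
        simpa only [avg_smul, RingHom.id_apply, smul_eq_mul] using (hL h).const_mul c }
  have hb : ∀ h, ‖φ0 h‖ ≤ 1 * ‖h‖ := fun h => by
    rw [one_mul]
    exact le_of_tendsto (hL h).norm
      (Eventually.of_forall fun n => avg_norm_le (θ n) (x n) (hθ n) h)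
  refine ⟨φ0.mkContinuous 1 hb, ⟨?_, ?_⟩, ?_, hL⟩
  · intro h hh
    have hp := fun n => avg_pos (θ n) (x n) (hθ n) h hh
    change 0 ≤ (L h).re ∧ (L h).im = 0
    constructor
    · exact ge_of_tendsto' ((Complex.continuous_re.tendsto _).comp (hL h)) fun n => (hp n).1
    · refine tendsto_nhds_unique ((Complex.continuous_im.tendsto _).comp (hL h)) ?_
      exact tendsto_const_nhds.congr fun n => ((hp n).2).symm
  · intro h hh
    refine tendsto_nhds_unique (hL h) ?_
    exact tendsto_const_nhds.congr fun n => (avg_one (θ n) (x n) (hθ n) h hh).symm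
  · intro f hf _ hf1 h g hg
    change L g = L h
    have h0 := (avg_conv_tendsto θ x hθ hθt f hf hf1 h g hg).mono_left
      (Nat.hyperfilter_le_atTop)
    exact sub_eq_zero.1 (tendsto_nhds_unique ((hL g).sub (hL h)) h0)

lemma avg_continuous (θ : ℝ) (h : LinfR) : Continuous fun x => avg θ x h := by
  have hp := intervalIntegral.continuous_primitive (fun a b => linf_ii h a b) 0
  have : (fun x => avg θ x h) = fun x => ((1 / (2 * θ) : ℝ) : ℂ) *
      ((∫ y in (0:ℝ)..(x + θ), h y) - ∫ y in (0:ℝ)..(x - θ), h y) := by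
    ext x
    rw [intervalIntegral.integral_interval_sub_left (linf_ii h _ _) (linf_ii h _ _)]
    rfl
  rw [this]
  exact continuous_const.mul ((hp.comp (by fun_prop)).sub (hp.comp (by fun_prop)))

lemma mean_sub_le (φ : Lp ℂ ⊤ (volume : Measure ℝ) →L[ℂ] ℂ) (hm : IsMean φ)
    (ht : IsTopologicallyInvariant φ) (ψ : LinfR) (α : ℂ) (θ ε : ℝ) (hθ : 0 < θ) (hε : 0 < ε)
    (hb : ∀ x, ‖avg θ x ψ - α‖ < ε) : ‖φ ψ - α‖ ≤ ‖φ‖ * ε := by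
  have m1 : MemLp (fun _ : ℝ => (1 : ℂ)) ⊤ volume :=
    memLp_top_of_bound aestronglyMeasurable_const 1 (by simp)
  have m2 : MemLp (fun x => avg θ x ψ) ⊤ volume :=
    memLp_top_of_bound (avg_continuous θ ψ).aestronglyMeasurable ‖ψ‖
      (Eventually.of_forall fun x => avg_norm_le θ x hθ ψ)
  have e1 : φ (m1.toLp _) = 1 := hm.2 _ m1.coeFn_toLp
  have e2 : φ (m2.toLp _) = φ ψ := by
    refine ht ((Set.Ioc (-θ) θ).indicator fun _ => 1 / (2 * θ)) ?_ ?_ ?_ ψ _ ?_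
    · exact (integrable_indicator_iff measurableSet_Ioc).2 (integrableOn_const (by simp))
    · exact Eventually.of_forall fun t => Set.indicator_nonneg (fun _ _ => by positivity) t
    · rw [integral_indicator measurableSet_Ioc, ← intervalIntegral.integral_of_le (by linarith),
        intervalIntegral.integral_const, smul_eq_mul]
      field_simp
      ring
    · refine m2.coeFn_toLp.trans (Eventually.of_forall fun x => ?_)
      have : (fun t => (((Set.Ioc (-θ) θ).indicator (fun _ => 1 / (2 * θ)) t : ℝ) : ℂ) * ψ (x - t))
          = (Set.Ioc (-θ) θ).indicator fun t => ((1 / (2 * θ) : ℝ) : ℂ) * ψ (x - t) := by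
        ext t
        by_cases htt : t ∈ Set.Ioc (-θ) θ
        · rw [Set.indicator_of_mem htt, Set.indicator_of_mem htt]
        · rw [Set.indicator_of_notMem htt, Set.indicator_of_notMem htt]; simp
      dsimp only
      rw [this, integral_indicator measurableSet_Ioc,
        ← intervalIntegral.integral_of_le (by linarith), intervalIntegral.integral_const_mul,
        intervalIntegral.integral_comp_sub_left (fun y => ψ y), sub_neg_eq_add]
      rfl
  have e3 : φ ψ - α = φ (m2.toLp _ - α • m1.toLp _) := by
    rw [map_sub, map_smul, e1, e2]; simp
  rw [e3]
  refine (φ.le_opNorm _).trans ?_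
  gcongr
  apply linf_norm_le _ _ hε.le
  filter_upwards [Lp.coeFn_sub (m2.toLp _) (α • m1.toLp _), Lp.coeFn_smul α (m1.toLp _),
    m1.coeFn_toLp, m2.coeFn_toLp] with x h1 h2 h3 h4
  rw [h1, Pi.sub_apply, h2, Pi.smul_apply, h3, h4]
  simpa using (hb x).le

/-- `ψ ∈ L^∞(ℝ)` satisfies `φ(ψ) = α` for every topologically invariant mean `φ` iff
`(1/(2θ)) ∫_{x−θ}^{x+θ} ψ(t) dt → α` as `θ → ∞`, uniformly in `x ∈ ℝ`. -/
theorem almostConvergent_iff_uniform_means (ψ : Lp ℂ ⊤ (volume : Measure ℝ)) (α : ℂ) :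
    (∀ φ : Lp ℂ ⊤ (volume : Measure ℝ) →L[ℂ] ℂ,
        IsMean φ → IsTopologicallyInvariant φ → φ ψ = α) ↔
    (∀ ε > (0 : ℝ), ∃ Θ : ℝ, ∀ θ : ℝ, Θ ≤ θ → ∀ x : ℝ,
      ‖((1 / (2 * θ) : ℝ) : ℂ) * (∫ t in (x - θ)..(x + θ), ψ t) - α‖ < ε) := by
  constructor
  · intro H
    by_contra hc
    push Not at hc
    obtain ⟨ε, hε, hc⟩ := hc
    choose θ hθ x hx using fun n : ℕ => hc ((n : ℝ) + 1)
    have hpos : ∀ n, 0 < θ n := fun n => lt_of_lt_of_le (by positivity) (hθ n)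
    have htop : Tendsto θ atTop atTop :=
      tendsto_atTop_mono (fun n => (le_add_of_nonneg_right zero_le_one).trans (hθ n))
        tendsto_natCast_atTop_atTop
    obtain ⟨φ, hm, ht, hL⟩ := exists_limit_mean θ x hpos htop
    have h1 := ((hL ψ).sub_const α).norm
    rw [H φ hm ht, sub_self, norm_zero] at h1
    exact absurd (ge_of_tendsto' h1 hx) (not_le.2 hε)
  · intro H φ hm ht
    by_contra hne
    have hd : 0 < ‖φ ψ - α‖ := norm_pos_iff.2 (sub_ne_zero.2 hne)
    have hn : 0 < ‖φ‖ + 1 := by positivity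
    obtain ⟨Θ, hΘ⟩ := H (‖φ ψ - α‖ / (‖φ‖ + 1)) (by positivity)
    have hle := mean_sub_le φ hm ht ψ α (max Θ 1) _ (by positivity) (by positivity)
      (hΘ _ (le_max_left _ _))
    rw [mul_div_assoc', le_div_iff₀ hn] at hle
    nlinarith
end

section
/- Let ψ : ℝ → ℂ be a bounded measurable function and α ∈ ℂ. Suppose (1) for every f ∈ L^1(ℝ), ∫_ℝ f(t)ψ(x−t)dt → α·∫_ℝ f(t)dt as |x| → ∞, and (2) ψ is slowly oscillating, i.e., for every ε > 0 there exist δ > 0 and R > 0 such that |ψ(x) − ψ(y)| < ε whenever |x − y| < δ and |x| > R. Then ψ(x) → α as |x| → ∞, i.e., for every ε > 0 there is R > 0 with |ψ(x) − α| < ε whenever |x| > R. -/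
open MeasureTheory

/-- If a bounded measurable `ψ : ℝ → ℂ` converges to `α` at infinity in the weak*
sense (its translates tested against every `f ∈ L^1(ℝ)`) and `ψ` is slowly
oscillating, then `ψ(x) → α` as `|x| → ∞`. -/
theorem weakStar_and_slowlyOscillating_implies_convergence
    (ψ : ℝ → ℂ) (hmeas : Measurable ψ) (hbdd : ∃ C : ℝ, ∀ x, ‖ψ x‖ ≤ C) (α : ℂ)
    (hweak : ∀ f : ℝ → ℂ, Integrable f volume →
      ∀ ε > (0 : ℝ), ∃ R > (0 : ℝ), ∀ x : ℝ, R < |x| →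
        ‖(∫ t, f t * ψ (x - t)) - α * ∫ t, f t‖ < ε)
    (hso : ∀ ε > (0 : ℝ), ∃ δ > (0 : ℝ), ∃ R > (0 : ℝ), ∀ x y : ℝ,
      |x - y| < δ → R < |x| → ‖ψ x - ψ y‖ < ε) :
    ∀ ε > (0 : ℝ), ∃ R > (0 : ℝ), ∀ x : ℝ, R < |x| → ‖ψ x - α‖ < ε := by
  intro ε hε
  obtain ⟨C, hC⟩ := hbdd
  obtain ⟨δ, hδ, R₁, hR₁, h₁⟩ := hso (ε / 2) (by positivity)
  set d : ℝ := δ / 2 with hd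
  have hd0 : 0 < d := by positivity
  have hfin : volume (Set.Ioc (0 : ℝ) d) < ⊤ := by simp
  have hvol : volume.real (Set.Ioc (0 : ℝ) d) = d := by
    simp [Measure.real, hd0.le]
  have hf : Integrable ((Set.Ioc (0 : ℝ) d).indicator (fun _ => (1 : ℂ))) volume :=
    (integrable_indicator_iff measurableSet_Ioc).2 (integrableOn_const hfin.ne)
  obtain ⟨R₂, hR₂, h₂⟩ := hweak _ hf (ε / 2 * d) (by positivity)
  refine ⟨max R₁ R₂, lt_max_of_lt_left hR₁, fun x hx => ?_⟩
  have hx₁ := (le_max_left R₁ R₂).trans_lt hx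
  have h₂ := h₂ x ((le_max_right R₁ R₂).trans_lt hx)
  have e1 : (∫ t, (Set.Ioc (0 : ℝ) d).indicator (fun _ => (1 : ℂ)) t * ψ (x - t))
      = ∫ t in Set.Ioc (0 : ℝ) d, ψ (x - t) := by
    rw [← integral_indicator measurableSet_Ioc]
    congr 1
    ext t
    by_cases ht : t ∈ Set.Ioc (0 : ℝ) d <;> simp [Set.indicator, ht]
  have e2 : (∫ t, (Set.Ioc (0 : ℝ) d).indicator (fun _ => (1 : ℂ)) t) = (d : ℂ) := by
    rw [integral_indicator measurableSet_Ioc, setIntegral_const, hvol]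
    simp
  rw [e1, e2] at h₂
  have hint : IntegrableOn (fun t => ψ (x - t)) (Set.Ioc (0 : ℝ) d) volume := by
    refine Integrable.mono' (integrableOn_const (C := C) hfin.ne)
      (hmeas.comp (measurable_const.sub measurable_id)).aestronglyMeasurable ?_
    exact Filter.Eventually.of_forall fun t => hC _
  have h₃ : ‖∫ t in Set.Ioc (0 : ℝ) d, (ψ x - ψ (x - t))‖ ≤ ε / 2 * d := by
    have := norm_setIntegral_le_of_norm_le_const (μ := volume) (s := Set.Ioc (0 : ℝ) d)
      (f := fun t => ψ x - ψ (x - t)) (C := ε / 2) hfin (fun t ht => by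
        refine (h₁ x (x - t) ?_ hx₁).le
        rw [sub_sub_cancel, abs_of_pos ht.1]
        have := ht.2
        linarith)
    rwa [hvol] at this
  have hcst : IntegrableOn (fun _ : ℝ => ψ x) (Set.Ioc (0 : ℝ) d) volume :=
    integrableOn_const hfin.ne
  rw [integral_sub hcst.integrable hint.integrable, setIntegral_const, hvol] at h₃
  have h₄ : ‖(d : ℂ) * (ψ x - α)‖ < ε * d := by
    have e : (d : ℂ) * (ψ x - α) = (d • ψ x - ∫ t in Set.Ioc (0 : ℝ) d, ψ (x - t))
        + ((∫ t in Set.Ioc (0 : ℝ) d, ψ (x - t)) - α * d) := by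
      rw [Complex.real_smul]; ring
    rw [e]
    refine (norm_add_le _ _).trans_lt ?_
    linarith
  rw [norm_mul, Complex.norm_real, Real.norm_of_nonneg hd0.le, mul_comm] at h₄
  exact lt_of_mul_lt_mul_right h₄ hd0.le
end

section
/- Let ψ : ℝ → ℂ be a bounded measurable function and α ∈ ℂ. Suppose (1) ψ is almost convergent to α, i.e., lim_{θ→∞} (1/(2θ)) ∫_{x−θ}^{x+θ} ψ(t) dt = α uniformly in x ∈ ℝ, and (2) for every s ∈ ℝ and every f ∈ L^1(ℝ), ∫_ℝ f(t)(ψ(x−t) − ψ(x−t+s))dt → 0 as |x| → ∞. Then for every f ∈ L^1(ℝ), ∫_ℝ f(t)ψ(x−t)dt → α·∫_ℝ f(t)dt as |x| → ∞. -/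
open MeasureTheory

/-- If a bounded measurable `ψ : ℝ → ℂ` is almost convergent to `α` and
`ψ − ψ_s → 0` at infinity in the weak* sense for every `s ∈ ℝ`, then `ψ → α`
at infinity in the weak* sense. -/
theorem almostConvergent_and_translates_implies_weakStar
    (ψ : ℝ → ℂ) (hmeas : Measurable ψ) (hbdd : ∃ C : ℝ, ∀ x, ‖ψ x‖ ≤ C) (α : ℂ)
    (hac : ∀ ε > (0 : ℝ), ∃ Θ : ℝ, ∀ θ : ℝ, Θ ≤ θ → ∀ x : ℝ,
      ‖((1 / (2 * θ) : ℝ) : ℂ) * (∫ t in (x - θ)..(x + θ), ψ t) - α‖ < ε)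
    (hdiff : ∀ s : ℝ, ∀ f : ℝ → ℂ, Integrable f volume →
      ∀ ε > (0 : ℝ), ∃ R > (0 : ℝ), ∀ x : ℝ, R < |x| →
        ‖∫ t, f t * (ψ (x - t) - ψ (x - t + s))‖ < ε) :
    ∀ f : ℝ → ℂ, Integrable f volume →
      ∀ ε > (0 : ℝ), ∃ R > (0 : ℝ), ∀ x : ℝ, R < |x| →
        ‖(∫ t, f t * ψ (x - t)) - α * ∫ t, f t‖ < ε := by
  intro f hf ε hε
  obtain ⟨C, hC⟩ := hbdd
  have hN : 0 ≤ ∫ t, ‖f t‖ := integral_nonneg fun _ => norm_nonneg _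
  set N := ∫ t, ‖f t‖ with hNdef
  have hε1 : 0 < ε / (2 * (N + 1)) := by positivity
  set ε1 := ε / (2 * (N + 1)) with hε1def
  obtain ⟨Θ, hΘ⟩ := hac ε1 hε1
  set θ := max Θ 1 with hθdef
  have hθ : 0 < θ := lt_of_lt_of_le one_pos (le_max_right _ _)
  have hA := hΘ θ (le_max_left _ _)
  set ν : Measure ℝ := volume.restrict (Set.Ioc (-θ) θ) with hν
  have hprod : ∀ x : ℝ, Integrable
      (fun p : ℝ × ℝ => f p.2 * (ψ (x - p.2) - ψ (x - p.2 + p.1))) (ν.prod volume) := by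
    intro x
    have h1 : Integrable (fun p : ℝ × ℝ => f p.2) (ν.prod volume) := by
      simpa using (integrable_const (1 : ℂ) (μ := ν)).mul_prod hf
    refine h1.mul_bdd (c := C + C) (Measurable.aestronglyMeasurable (by fun_prop)) ?_
    exact Filter.Eventually.of_forall fun p =>
      (norm_sub_le _ _).trans (add_le_add (hC _) (hC _))
  have hfψ : ∀ x : ℝ, Integrable (fun t => f t * ψ (x - t)) volume := fun x =>
    hf.mul_bdd (c := C) (Measurable.aestronglyMeasurable (by fun_prop))
      (Filter.Eventually.of_forall fun _ => hC _)
  have hlim : Filter.Tendsto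
      (fun x : ℝ => ∫ s, (∫ t, f t * (ψ (x - t) - ψ (x - t + s))) ∂ν)
      (Filter.comap (fun x : ℝ => |x|) Filter.atTop) (nhds (∫ _s, (0 : ℂ) ∂ν)) := by
    refine tendsto_integral_filter_of_dominated_convergence (fun _ => N * (C + C)) ?_ ?_
      (integrable_const _) ?_
    · exact Filter.Eventually.of_forall fun x => (hprod x).integral_prod_left.aestronglyMeasurable
    · refine Filter.Eventually.of_forall fun x => Filter.Eventually.of_forall fun s => ?_
      rw [hNdef, ← integral_mul_const]
      refine norm_integral_le_of_norm_le (hf.norm.mul_const _)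
        (Filter.Eventually.of_forall fun t => ?_)
      rw [norm_mul]
      exact mul_le_mul_of_nonneg_left ((norm_sub_le _ _).trans (add_le_add (hC _) (hC _)))
        (norm_nonneg _)
    · refine Filter.Eventually.of_forall fun s => ?_
      rw [Metric.tendsto_nhds]
      intro δ hδ
      obtain ⟨R, _, hR⟩ := hdiff s f hf δ hδ
      have := (Filter.tendsto_comap (f := fun x : ℝ => |x|) (x := Filter.atTop)).eventually
        (Filter.eventually_gt_atTop R)
      filter_upwards [this] with x hx
      simpa using hR x hx
  have hδ : 0 < θ * ε := by positivity
  rw [integral_zero, Metric.tendsto_nhds] at hlim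
  obtain ⟨S, hS, hSsub⟩ := Filter.mem_comap.1 (hlim _ hδ)
  obtain ⟨R0, hR0⟩ := Filter.mem_atTop_sets.1 hS
  refine ⟨max R0 1, lt_of_lt_of_le one_pos (le_max_right _ _), fun x hx => ?_⟩
  have hK : ‖∫ s, (∫ t, f t * (ψ (x - t) - ψ (x - t + s))) ∂ν‖ < θ * ε := by
    have := hSsub (show x ∈ (fun x : ℝ => |x|) ⁻¹' S from
      hR0 _ ((le_max_left _ _).trans hx.le))
    simpa using this
  have hswap : ∫ s, (∫ t, f t * (ψ (x - t) - ψ (x - t + s))) ∂ν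
      = ∫ t, (∫ s, f t * (ψ (x - t) - ψ (x - t + s)) ∂ν) :=
    integral_integral_swap (hprod x)
  have hinner : ∀ t, ∫ s, f t * (ψ (x - t) - ψ (x - t + s)) ∂ν
      = f t * ((2 * θ : ℝ) * ψ (x - t) - ∫ u in (x - t - θ)..(x - t + θ), ψ u) := by
    intro t
    rw [integral_const_mul, integral_sub (integrable_const _)]
    · congr 2
      · rw [integral_const, hν]
        simp [hθ.le]
        left
        ring
      · rw [hν, ← intervalIntegral.integral_of_le (by linarith),
          intervalIntegral.integral_comp_add_left (fun u => ψ u)]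
        rfl
    · refine Integrable.of_bound (Measurable.aestronglyMeasurable (by fun_prop)) C
        (Filter.Eventually.of_forall fun _ => hC _)
  have hmain : ‖(2 * θ : ℝ) * ((∫ t, f t * ψ (x - t)) - α * ∫ t, f t)
      - ∫ t, (∫ s, f t * (ψ (x - t) - ψ (x - t + s)) ∂ν)‖ ≤ N * (2 * θ * ε1) := by
    have i1 : Integrable (fun t => ((2 * θ : ℝ) : ℂ) * (f t * ψ (x - t) - α * f t)) volume :=
      ((hfψ x).sub (hf.const_mul α)).const_mul _
    have i2 : Integrable (fun t => ∫ s, f t * (ψ (x - t) - ψ (x - t + s)) ∂ν) volume :=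
      (hprod x).integral_prod_right
    rw [← integral_const_mul, ← integral_sub (hfψ x) (hf.const_mul α), ← integral_const_mul,
      ← integral_sub i1 i2,
      hNdef, ← integral_mul_const]
    refine norm_integral_le_of_norm_le (hf.norm.mul_const _)
      (Filter.Eventually.of_forall fun t => ?_)
    have hθC : (θ : ℂ) ≠ 0 := by exact_mod_cast hθ.ne'
    have e : (2 * θ : ℝ) * (f t * ψ (x - t) - α * f t)
        - ∫ s, f t * (ψ (x - t) - ψ (x - t + s)) ∂ν
        = f t * ((2 * θ : ℝ) * (((1 / (2 * θ) : ℝ) : ℂ) *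
          (∫ u in (x - t - θ)..(x - t + θ), ψ u) - α)) := by
      rw [hinner]
      push_cast
      field_simp
      ring
    simp only [e]
    rw [norm_mul, norm_mul, Complex.norm_real, Real.norm_of_nonneg (by positivity)]
    exact mul_le_mul_of_nonneg_left
      (mul_le_mul_of_nonneg_left (hA (x - t)).le (by positivity)) (norm_nonneg _)
  rw [hswap] at hK
  have htot := norm_le_norm_add_norm_sub'
    ((2 * θ : ℝ) * ((∫ t, f t * ψ (x - t)) - α * ∫ t, f t))
    (∫ t, (∫ s, f t * (ψ (x - t) - ψ (x - t + s)) ∂ν))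
  rw [norm_mul, Complex.norm_real, Real.norm_of_nonneg (by positivity)] at htot
  have hNe : N * ε1 ≤ ε / 2 := by
    rw [hε1def, mul_div_assoc', div_le_div_iff₀ (by positivity) (by positivity)]
    nlinarith
  have h3 : N * (2 * θ * ε1) ≤ θ * ε := by nlinarith
  have h4 : 2 * θ * ‖(∫ t, f t * ψ (x - t)) - α * ∫ t, f t‖ < 2 * θ * ε := by linarith
  exact lt_of_mul_lt_mul_left h4 (by positivity)
end

section
/- Let Φ be a translation-invariant linear subspace of L^∞(ℝ) (ψ ∈ Φ implies ψ(·+s) ∈ Φ for all s ∈ ℝ) which is weak*-closed, in the sense that Φ equals its double annihilator under the pairing ⟨f, ψ⟩ = ∫_ℝ f(t)ψ(t)dt between L^1(ℝ) and L^∞(ℝ) (i.e., ψ ∈ Φ whenever ∫ f ψ = 0 for every f ∈ L^1(ℝ) satisfying ∫ f φ = 0 for all φ ∈ Φ). Define J(Φ) = {f ∈ L^1(ℝ) : f*ψ = 0 a.e. for every ψ ∈ Φ} and sp(Φ) = ⋂_{f ∈ J(Φ)} {λ ∈ ℝ : f̂(λ) = 0}. Then sp(Φ) = {λ ∈ ℝ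 : the character x ↦ e^{iλx} belongs to Φ}. -/
open MeasureTheory

/-- The Fourier transform `f̂(λ) = ∫ f(x) e^{−iλx} dx` of an integrable function. -/
noncomputable def fourierT (f : ℝ → ℂ) (l : ℝ) : ℂ :=
  ∫ x : ℝ, f x * Complex.exp (-(Complex.I * l * x))

/-- For a translation-invariant, weak*-closed linear subspace `Φ` of `L^∞(ℝ)`
(weak*-closedness expressed as: `Φ` equals its double annihilator under the pairing
with `L^1(ℝ)`), the spectrum `sp(Φ) = ⋂_{f ∈ J(Φ)} {λ : f̂(λ) = 0}` (where
`J(Φ) = {f ∈ L^1 : f*ψ = 0 a.e. for all ψ ∈ Φ}`) is exactly the set of `λ` whose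
character `x ↦ e^{iλx}` belongs to `Φ`. -/
theorem spectrum_eq_set_of_characters
    (Φ : Submodule ℂ (Lp ℂ ⊤ (volume : Measure ℝ)))
    (hinv : ∀ ψ : Lp ℂ ⊤ (volume : Measure ℝ), ψ ∈ Φ → ∀ s : ℝ,
      ∀ χ : Lp ℂ ⊤ (volume : Measure ℝ),
        (⇑χ : ℝ → ℂ) =ᵐ[volume] (fun x => ψ (x + s)) → χ ∈ Φ)
    (hclosed : ∀ ψ : Lp ℂ ⊤ (volume : Measure ℝ),
      (∀ f : ℝ → ℂ, Integrable f volume →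
        (∀ χ : Lp ℂ ⊤ (volume : Measure ℝ), χ ∈ Φ → (∫ t, f t * χ t) = 0) →
        (∫ t, f t * ψ t) = 0) → ψ ∈ Φ) :
    {l : ℝ | ∀ f : ℝ → ℂ, Integrable f volume →
        (∀ ψ : Lp ℂ ⊤ (volume : Measure ℝ), ψ ∈ Φ →
          (fun x => ∫ t, f t * ψ (x - t)) =ᵐ[volume] (fun _ => (0 : ℂ))) →
        fourierT f l = 0} =
    {l : ℝ | ∃ χ : Lp ℂ ⊤ (volume : Measure ℝ), χ ∈ Φ ∧
        (⇑χ : ℝ → ℂ) =ᵐ[volume] (fun x => Complex.exp (Complex.I * l * x))} := by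
  have hchar : ∀ l : ℝ, MemLp (fun x : ℝ => Complex.exp (Complex.I * l * x)) ⊤ (volume : Measure ℝ) := by
    intro l
    refine memLp_top_of_bound (by fun_prop) 1 (Filter.Eventually.of_forall fun x => ?_)
    have : Complex.I * l * x = ((l * x : ℝ) : ℂ) * Complex.I := by push_cast; ring
    rw [this, Complex.norm_exp_ofReal_mul_I]
  ext l
  simp only [Set.mem_setOf_eq]
  constructor
  · intro h
    refine ⟨(hchar l).toLp _, ?_, (hchar l).coeFn_toLp⟩
    apply hclosed
    intro f hf hfΦ
    have hg := h (fun t => f (-t)) hf.comp_neg ?_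
    · unfold fourierT at hg
      rw [← integral_neg_eq_self] at hg
      rw [← hg]
      apply integral_congr_ae
      filter_upwards [(hchar l).coeFn_toLp] with t ht
      rw [ht]
      simp
    · intro ψ hψ
      refine Filter.Eventually.of_forall fun x => ?_
      have hmp : MeasurePreserving (fun t : ℝ => t + x) volume volume :=
        measurePreserving_add_right volume x
      have hm : MemLp (fun t => ψ (t + x)) ⊤ (volume : Measure ℝ) :=
        (Lp.memLp ψ).comp_measurePreserving hmp
      have h0 := hfΦ _ (hinv ψ hψ x (hm.toLp _) hm.coeFn_toLp)
      show (∫ t, f (-t) * ψ (x - t)) = 0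
      rw [← integral_neg_eq_self, ← h0]
      apply integral_congr_ae
      filter_upwards [hm.coeFn_toLp] with t ht
      rw [ht]
      simp [add_comm]
  · rintro ⟨χ, hχ, he⟩ f hf hJ
    obtain ⟨x, hx⟩ := (hJ χ hχ).exists
    have hq : MeasurePreserving (fun t : ℝ => x - t) volume volume :=
      Measure.measurePreserving_sub_left volume x
    have h1 : (∫ t, f t * χ (x - t)) = Complex.exp (Complex.I * l * x) * fourierT f l := by
      unfold fourierT
      rw [← integral_const_mul]
      apply integral_congr_ae
      filter_upwards [hq.quasiMeasurePreserving.ae he] with t ht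
      rw [ht]
      have : Complex.I * l * ((x - t : ℝ) : ℂ) = Complex.I * l * x + -(Complex.I * l * t) := by
        push_cast; ring
      rw [this, Complex.exp_add]
      ring
    have h2 : Complex.exp (Complex.I * l * x) * fourierT f l = 0 := h1 ▸ hx
    exact (mul_eq_zero.mp h2).resolve_left (Complex.exp_ne_zero _)
end

section
/- Let φ be a mean on C_bu(ℝ). Then φ is translation invariant (φ(ψ(·+s)) = φ(ψ) for all ψ ∈ C_bu(ℝ) and s ∈ ℝ) if and only if sp(φ) = {0}, where sp(φ) := ⋂_{f ∈ J(φ)} {λ ∈ ℝ : f̂(λ) = 0} and J(φ) := {f ∈ L^1(ℝ) : φ(f*ψ) = 0 for every ψ ∈ C_bu(ℝ)}. -/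
open MeasureTheory BoundedContinuousFunction

/-- `C_bu(ℝ)`: the subspace of bounded continuous functions `ℝ → ℂ` that are
uniformly continuous, i.e. the bounded uniformly continuous functions. -/
noncomputable def Cbu : Submodule ℂ (ℝ →ᵇ ℂ) where
  carrier := {ψ | UniformContinuous ⇑ψ}
  add_mem' := by
    intro f g hf hg
    simp only [Set.mem_setOf_eq, coe_add]
    exact hf.add hg
  zero_mem' := by
    simp only [Set.mem_setOf_eq, coe_zero]
    exact uniformContinuous_const
  smul_mem' := by
    intro c f hf
    simp only [Set.mem_setOf_eq, coe_smul]
    exact hf.const_smul c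

/-- The constant function `1` as an element of `C_bu(ℝ)`. -/
noncomputable def oneCbu : Cbu := ⟨1, by
  simp only [Cbu, Submodule.mem_mk, AddSubmonoid.mem_mk, AddSubsemigroup.mem_mk,
    Set.mem_setOf_eq, coe_one]
  exact uniformContinuous_const⟩

/-- A mean on `C_bu(ℝ)`: positive on nonnegative real-valued functions and
normalized at the constant function `1`. -/
def IsMeanCbu (φ : Cbu →L[ℂ] ℂ) : Prop :=
  (∀ ψ : Cbu, (∀ x : ℝ, 0 ≤ ((ψ : ℝ →ᵇ ℂ) x).re ∧ ((ψ : ℝ →ᵇ ℂ) x).im = 0) →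
      0 ≤ (φ ψ).re ∧ (φ ψ).im = 0) ∧
  φ oneCbu = 1

/-- `J(φ) = {f ∈ L^1(ℝ) : φ(f*ψ) = 0 for every ψ ∈ C_bu(ℝ)}`, where the convolution
`f*ψ` is represented by any `χ ∈ C_bu(ℝ)` with `χ(x) = ∫ f(t) ψ(x−t) dt`. -/
def JsetCbu (φ : Cbu →L[ℂ] ℂ) : Set (ℝ → ℂ) :=
  {f | Integrable f volume ∧ ∀ ψ χ : Cbu,
    (∀ x : ℝ, (χ : ℝ →ᵇ ℂ) x = ∫ t, f t * (ψ : ℝ →ᵇ ℂ) (x - t)) → φ χ = 0}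

/-- The spectrum `sp(φ) = ⋂_{f ∈ J(φ)} {λ : f̂(λ) = 0}` of `φ ∈ C_bu(ℝ)*`. -/
noncomputable def spCbu (φ : Cbu →L[ℂ] ℂ) : Set ℝ :=
  ⋂ f ∈ JsetCbu φ, {l : ℝ | (∫ x : ℝ, f x * Complex.exp (-(Complex.I * l * x))) = 0}


lemma cbu_uc (ψ : Cbu) : UniformContinuous (ψ : ℝ →ᵇ ℂ) := ψ.2

lemma cbu_ext {ψ χ : Cbu} (h : ∀ x, (ψ : ℝ →ᵇ ℂ) x = (χ : ℝ →ᵇ ℂ) x) : ψ = χ :=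
  Subtype.ext (BoundedContinuousFunction.ext h)

lemma cbu_norm_le (ψ : Cbu) (x : ℝ) : ‖(ψ : ℝ →ᵇ ℂ) x‖ ≤ ‖ψ‖ :=
  BoundedContinuousFunction.norm_coe_le_norm (ψ : ℝ →ᵇ ℂ) x

lemma cbu_norm_le_of (ψ : Cbu) {C : ℝ} (hC : 0 ≤ C) (h : ∀ x, ‖(ψ : ℝ →ᵇ ℂ) x‖ ≤ C) : ‖ψ‖ ≤ C :=
  (BoundedContinuousFunction.norm_le hC).2 h

lemma conv_integrable {f : ℝ → ℂ} (hf : Integrable f) (ψ : Cbu) (x : ℝ) :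
    Integrable (fun t => f t * (ψ : ℝ →ᵇ ℂ) (x - t)) := by
  refine hf.mul_bdd (c := ‖ψ‖) ?_ (Filter.Eventually.of_forall fun t => cbu_norm_le ψ _)
  have : Continuous (ψ : ℝ →ᵇ ℂ) := (cbu_uc ψ).continuous
  exact (by fun_prop : Continuous fun t => (ψ : ℝ →ᵇ ℂ) (x - t)).aestronglyMeasurable

lemma conv_norm_le {f : ℝ → ℂ} (hf : Integrable f) (ψ : Cbu) (x : ℝ) :
    ‖∫ t, f t * (ψ : ℝ →ᵇ ℂ) (x - t)‖ ≤ (∫ t, ‖f t‖) * ‖ψ‖ := by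
  rw [← integral_mul_const]
  refine norm_integral_le_of_norm_le (hf.norm.mul_const _) (Filter.Eventually.of_forall fun t => ?_)
  rw [norm_mul]
  exact mul_le_mul_of_nonneg_left (cbu_norm_le ψ _) (norm_nonneg _)

lemma conv_uc {f : ℝ → ℂ} (hf : Integrable f) (ψ : Cbu) :
    UniformContinuous (fun x => ∫ t, f t * (ψ : ℝ →ᵇ ℂ) (x - t)) := by
  rw [Metric.uniformContinuous_iff]
  intro ε hε
  set M := ∫ t, ‖f t‖ with hM
  have hM0 : 0 ≤ M := integral_nonneg fun _ => norm_nonneg _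
  obtain ⟨δ, hδ, h⟩ := Metric.uniformContinuous_iff.1 (cbu_uc ψ) (ε / (M + 1)) (by positivity)
  refine ⟨δ, hδ, fun {x y} hxy => ?_⟩
  rw [dist_eq_norm, ← integral_sub (conv_integrable hf ψ x) (conv_integrable hf ψ y)]
  have : ‖∫ t, (f t * (ψ : ℝ →ᵇ ℂ) (x - t) - f t * (ψ : ℝ →ᵇ ℂ) (y - t))‖ ≤ M * (ε / (M + 1)) := by
    rw [hM, ← integral_mul_const]
    refine norm_integral_le_of_norm_le (hf.norm.mul_const _)
      (Filter.Eventually.of_forall fun t => ?_)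
    rw [← mul_sub, norm_mul]
    refine mul_le_mul_of_nonneg_left ?_ (norm_nonneg _)
    rw [← dist_eq_norm]
    exact (h (by simpa using hxy)).le
  refine this.trans_lt ?_
  rw [mul_div_assoc', div_lt_iff₀ (by positivity)]
  nlinarith

noncomputable def convC (f : ℝ → ℂ) (hf : Integrable f) (ψ : Cbu) : Cbu :=
  ⟨BoundedContinuousFunction.ofNormedAddCommGroup (fun x => ∫ t, f t * (ψ : ℝ →ᵇ ℂ) (x - t))
    (conv_uc hf ψ).continuous _ (conv_norm_le hf ψ), conv_uc hf ψ⟩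

lemma convC_apply {f : ℝ → ℂ} (hf : Integrable f) (ψ : Cbu) (x : ℝ) :
    (convC f hf ψ : ℝ →ᵇ ℂ) x = ∫ t, f t * (ψ : ℝ →ᵇ ℂ) (x - t) := rfl

lemma convC_norm {f : ℝ → ℂ} (hf : Integrable f) (ψ : Cbu) :
    ‖convC f hf ψ‖ ≤ (∫ t, ‖f t‖) * ‖ψ‖ :=
  cbu_norm_le_of _ (mul_nonneg (integral_nonneg fun _ => norm_nonneg _) (norm_nonneg _))
    (conv_norm_le hf ψ)

lemma mem_J_iff (φ : Cbu →L[ℂ] ℂ) {f : ℝ → ℂ} (hf : Integrable f) :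
    f ∈ JsetCbu φ ↔ ∀ ψ, φ (convC f hf ψ) = 0 := by
  constructor
  · intro h ψ
    exact h.2 ψ _ (fun x => rfl)
  · intro h
    refine ⟨hf, fun ψ χ hχ => ?_⟩
    rw [← h ψ]; congr 1
    exact cbu_ext fun x => by rw [hχ, convC_apply]

lemma convC_sub_right {f : ℝ → ℂ} (hf : Integrable f) (ψ χ : Cbu) :
    convC f hf (ψ - χ) = convC f hf ψ - convC f hf χ := by
  apply cbu_ext
  intro x
  simp only [Submodule.coe_sub, BoundedContinuousFunction.sub_apply, convC_apply, mul_sub]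
  exact integral_sub (conv_integrable hf ψ x) (conv_integrable hf χ x)

lemma convC_smul_right {f : ℝ → ℂ} (hf : Integrable f) (c : ℂ) (ψ : Cbu) :
    convC f hf (c • ψ) = c • convC f hf ψ := by
  apply cbu_ext
  intro x
  simp only [Submodule.coe_smul, BoundedContinuousFunction.smul_apply, convC_apply, smul_eq_mul]
  rw [← integral_const_mul]
  congr 1; ext t; ring

lemma convC_sub_left {f g : ℝ → ℂ} (hf : Integrable f) (hg : Integrable g)
    (hfg : Integrable (fun x => f x - g x)) (ψ : Cbu) :
    convC (fun x => f x - g x) hfg ψ = convC f hf ψ - convC g hg ψ := by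
  apply cbu_ext
  intro x
  simp only [Submodule.coe_sub, BoundedContinuousFunction.sub_apply, convC_apply, sub_mul]
  exact integral_sub (conv_integrable hf ψ x) (conv_integrable hg ψ x)

lemma conv_prod_integrable {f g : ℝ → ℂ} (hf : Integrable f) (hg : Integrable g) (ψ : Cbu) (x : ℝ) :
    Integrable (fun p : ℝ × ℝ => f p.1 * (g p.2 * (ψ : ℝ →ᵇ ℂ) (x - p.1 - p.2)))
      (volume.prod volume) := by
  simp_rw [← mul_assoc]
  refine (hf.mul_prod hg).mul_bdd (c := ‖ψ‖) ?_ (Filter.Eventually.of_forall fun t => cbu_norm_le ψ _)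
  have : Continuous (ψ : ℝ →ᵇ ℂ) := (cbu_uc ψ).continuous
  exact (by fun_prop : Continuous fun p : ℝ × ℝ =>
    (ψ : ℝ →ᵇ ℂ) (x - p.1 - p.2)).aestronglyMeasurable

lemma convC_comm {f g : ℝ → ℂ} (hf : Integrable f) (hg : Integrable g) (ψ : Cbu) :
    convC f hf (convC g hg ψ) = convC g hg (convC f hf ψ) := by
  apply cbu_ext
  intro x
  simp only [convC_apply, ← integral_const_mul]
  rw [integral_integral_swap (conv_prod_integrable hf hg ψ x)]
  congr 1; ext s; congr 1; ext t
  rw [show x - t - s = x - s - t by ring]; ring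

/-- if `W * g = g` then `W * (g * ψ) = g * ψ`. -/
lemma convC_absorb {W g : ℝ → ℂ} (hW : Integrable W) (hg : Integrable g)
    (h : ∀ s, ∫ t, W t * g (s - t) = g s) (ψ : Cbu) :
    convC W hW (convC g hg ψ) = convC g hg ψ := by
  apply cbu_ext
  intro x
  simp only [convC_apply]
  have h1 : ∀ t, ∫ s, g s * (ψ : ℝ →ᵇ ℂ) (x - t - s) = ∫ s, g (s - t) * (ψ : ℝ →ᵇ ℂ) (x - s) := by
    intro t
    rw [← integral_sub_right_eq_self (fun s => g s * (ψ : ℝ →ᵇ ℂ) (x - t - s)) t]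
    congr 1; ext s; congr 2; ring
  simp only [h1, ← integral_const_mul]
  have hi : Integrable (Function.uncurry fun t s => W t * (g (s - t) * (ψ : ℝ →ᵇ ℂ) (x - s)))
      (volume.prod volume) := by
    have := hW.convolution_integrand (ContinuousLinearMap.mul ℝ ℂ) hg
    have := this.swap
    have h2 : Integrable (fun p : ℝ × ℝ => W p.1 * g (p.2 - p.1)) (volume.prod volume) := this
    have hc : Continuous (ψ : ℝ →ᵇ ℂ) := (cbu_uc ψ).continuous
    have := h2.mul_bdd (c := ‖ψ‖) (g := fun p : ℝ × ℝ => (ψ : ℝ →ᵇ ℂ) (x - p.2))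
      (by fun_prop : Continuous fun p : ℝ × ℝ =>
        (ψ : ℝ →ᵇ ℂ) (x - p.2)).aestronglyMeasurable
      (Filter.Eventually.of_forall fun t => cbu_norm_le ψ _)
    convert this using 2
    simp [Function.uncurry, mul_assoc]
  rw [integral_integral_swap hi]
  congr 1; ext s
  simp only [← mul_assoc]
  rw [integral_mul_const, h]

/-- translation -/
noncomputable def trC (s : ℝ) (ψ : Cbu) : Cbu :=
  ⟨BoundedContinuousFunction.compContinuous (ψ : ℝ →ᵇ ℂ) ⟨fun x => x + s, by fun_prop⟩, by
    have : UniformContinuous fun x : ℝ => x + s := uniformContinuous_id.add uniformContinuous_const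
    exact (cbu_uc ψ).comp this⟩

lemma trC_apply (s : ℝ) (ψ : Cbu) (x : ℝ) :
    (trC s ψ : ℝ →ᵇ ℂ) x = (ψ : ℝ →ᵇ ℂ) (x + s) := rfl

noncomputable def om (V : ℝ → ℂ) (a : ℝ) : ℝ := ∫ x, ‖V (x - a) - V x‖

lemma om_nonneg (V : ℝ → ℂ) (a : ℝ) : 0 ≤ om V a := integral_nonneg fun _ => norm_nonneg _

lemma om_zero (V : ℝ → ℂ) : om V 0 = 0 := by simp [om]

lemma om_le {V : ℝ → ℂ} (hV : Integrable V) (a : ℝ) : om V a ≤ 2 * ∫ x, ‖V x‖ := by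
  have h1 : Integrable fun x => V (x - a) := hV.comp_sub_right a
  calc om V a ≤ ∫ x, (‖V (x - a)‖ + ‖V x‖) :=
        integral_mono (h1.sub hV).norm (h1.norm.add hV.norm) fun x => norm_sub_le _ _
    _ = (∫ x, ‖V (x - a)‖) + ∫ x, ‖V x‖ := integral_add h1.norm hV.norm
    _ = _ := by rw [integral_sub_right_eq_self (fun x => ‖V x‖) a]; ring

lemma om_continuous {V : ℝ → ℂ} (hV : Integrable V) : Continuous (om V) := by
  have hL : MemLp V 1 volume := memLp_one_iff_integrable.2 hV
  let g : C(ℝ, C(ℝ, ℝ)) :=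
    (ContinuousMap.mk (fun p : ℝ × ℝ => p.2 - p.1) (by fun_prop)).curry
  have hg : ∀ a, MeasurePreserving (g a) volume volume := fun a =>
    measurePreserving_sub_right volume a
  have hc : Continuous fun a : ℝ => Lp.compMeasurePreserving (g a) (hg a) (hL.toLp V) :=
    (continuous_const (y := hL.toLp V)).compMeasurePreservingLp g.continuous hg ENNReal.one_ne_top
  have : om V = fun a => ‖Lp.compMeasurePreserving (g a) (hg a) (hL.toLp V) - hL.toLp V‖ := by
    ext a
    rw [L1.norm_eq_integral_norm]
    apply integral_congr_ae
    filter_upwards [Lp.coeFn_sub (Lp.compMeasurePreserving (g a) (hg a) (hL.toLp V)) (hL.toLp V),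
      Lp.coeFn_compMeasurePreserving (hL.toLp V) (hg a), hL.coeFn_toLp,
      (hg a).quasiMeasurePreserving.ae_eq_comp hL.coeFn_toLp] with x h1 h2 h3 h4
    rw [h1, Pi.sub_apply, h2, h3, h4]
    rfl
  rw [this]
  exact (hc.sub continuous_const).norm

noncomputable def ee (y : ℝ) : ℂ := Complex.exp (((2 * Real.pi * y : ℝ) : ℂ) * Complex.I)

lemma ee_norm (y : ℝ) : ‖ee y‖ = 1 := Complex.norm_exp_ofReal_mul_I _

lemma ee_add (x y : ℝ) : ee (x + y) = ee x * ee y := by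
  rw [ee, ee, ee, ← Complex.exp_add]; congr 1; push_cast; ring

lemma ee_zero : ee 0 = 1 := by simp [ee]

lemma ee_continuous : Continuous ee := by unfold ee; fun_prop

noncomputable def modK (V : ℝ → ℂ) (ξ δ : ℝ) (x : ℝ) : ℂ := ee (ξ * x) * (δ * V (δ * x))

lemma modK_integrable {V : ℝ → ℂ} (hV : Integrable V) (ξ : ℝ) {δ : ℝ} (hδ : 0 < δ) :
    Integrable (modK V ξ δ) := by
  refine Integrable.bdd_mul (c := 1) ((hV.comp_mul_left' hδ.ne').const_mul (δ : ℂ)) ?_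
    (Filter.Eventually.of_forall fun t => (ee_norm _).le)
  exact (ee_continuous.comp (by fun_prop : Continuous fun x : ℝ => ξ * x)).aestronglyMeasurable

lemma modK_norm_integral (V : ℝ → ℂ) (ξ : ℝ) {δ : ℝ} (hδ : 0 < δ) (t : ℝ) :
    ∫ s, ‖modK V ξ δ (s - t) - ee (-(ξ * t)) * modK V ξ δ s‖ = om V (δ * t) := by
  have h1 : ∀ s, ‖modK V ξ δ (s - t) - ee (-(ξ * t)) * modK V ξ δ s‖
      = δ * (fun y => ‖V (y - δ * t) - V y‖) (δ * s) := by
    intro s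
    have : modK V ξ δ (s - t) - ee (-(ξ * t)) * modK V ξ δ s
        = (ee (-(ξ * t)) * ee (ξ * s)) * (δ * (V (δ * s - δ * t) - V (δ * s))) := by
      simp only [modK]
      rw [show ξ * (s - t) = -(ξ * t) + ξ * s by ring, ee_add, mul_sub δ]
      ring
    rw [this, norm_mul, norm_mul, norm_mul, ee_norm, ee_norm]
    simp [abs_of_pos hδ]
  simp_rw [h1]
  rw [integral_const_mul,
    Measure.integral_comp_mul_left (fun y => ‖V (y - δ * t) - V y‖) δ]
  rw [abs_of_pos (inv_pos.2 hδ), smul_eq_mul, ← mul_assoc, mul_inv_cancel₀ hδ.ne', one_mul]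
  rfl

lemma kbound {V : ℝ → ℂ} (hV : Integrable V) (ξ : ℝ) {δ : ℝ} (hδ : 0 < δ) (ψ : Cbu) (x t : ℝ) :
    ‖(convC _ (modK_integrable hV ξ hδ) ψ : ℝ →ᵇ ℂ) (x - t)
      - ee (-(ξ * t)) * (convC _ (modK_integrable hV ξ hδ) ψ : ℝ →ᵇ ℂ) x‖
      ≤ om V (δ * t) * ‖ψ‖ := by
  have hW := modK_integrable hV ξ hδ
  have hW2 : Integrable fun s => modK V ξ δ (s - t) := hW.comp_sub_right t
  rw [convC_apply, convC_apply]
  have h1 : ∫ s, modK V ξ δ s * (ψ : ℝ →ᵇ ℂ) (x - t - s)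
      = ∫ s, modK V ξ δ (s - t) * (ψ : ℝ →ᵇ ℂ) (x - s) := by
    rw [← integral_sub_right_eq_self (fun s => modK V ξ δ s * (ψ : ℝ →ᵇ ℂ) (x - t - s)) t]
    congr 1; ext s; congr 2; ring
  rw [h1, ← integral_const_mul, ← integral_sub (conv_integrable hW2 ψ x)
    ((conv_integrable hW ψ x).const_mul _), ← modK_norm_integral V ξ hδ t]
  have h2 := conv_norm_le (hW2.sub (hW.const_mul (ee (-(ξ * t))))) ψ x
  refine le_trans (le_of_eq ?_) h2
  congr 2; ext s; simp only [Pi.sub_apply]; ring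

lemma rint {f V : ℝ → ℂ} (hf : Integrable f) (hV : Integrable V) (δ : ℝ) :
    Integrable fun t => ‖f t‖ * om V (δ * t) := by
  refine hf.norm.mul_bdd (c := 2 * ∫ x, ‖V x‖) ?_ (Filter.Eventually.of_forall fun t => ?_)
  · exact ((om_continuous hV).comp (by fun_prop : Continuous fun t : ℝ => δ * t)).aestronglyMeasurable
  · rw [Real.norm_of_nonneg (om_nonneg _ _)]; exact om_le hV _

lemma rbound {f V : ℝ → ℂ} (hf : Integrable f) (hV : Integrable V) (ξ : ℝ) {δ : ℝ} (hδ : 0 < δ)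
    (ψ : Cbu) :
    ‖convC f hf (convC _ (modK_integrable hV ξ hδ) ψ)
      - (∫ t, f t * ee (-(ξ * t))) • convC _ (modK_integrable hV ξ hδ) ψ‖
      ≤ (∫ t, ‖f t‖ * om V (δ * t)) * ‖ψ‖ := by
  refine cbu_norm_le_of _ (mul_nonneg (integral_nonneg fun t =>
    mul_nonneg (norm_nonneg _) (om_nonneg _ _)) (norm_nonneg _)) fun x => ?_
  simp only [Submodule.coe_sub, BoundedContinuousFunction.sub_apply, Submodule.coe_smul,
    BoundedContinuousFunction.smul_apply, smul_eq_mul]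
  rw [convC_apply hf, ← integral_mul_const, ← integral_sub (conv_integrable hf _ x), 
    ← integral_mul_const]
  · refine norm_integral_le_of_norm_le ((rint hf hV δ).mul_const _)
      (Filter.Eventually.of_forall fun t => ?_)
    rw [mul_assoc, ← mul_sub, norm_mul, mul_assoc]
    exact mul_le_mul_of_nonneg_left (kbound hV ξ hδ ψ x t) (norm_nonneg _)
  · refine Integrable.mul_const ?_ _
    refine hf.mul_bdd (c := 1) ?_ (Filter.Eventually.of_forall fun t => (ee_norm _).le)
    exact (ee_continuous.comp (by fun_prop : Continuous fun x : ℝ => -(ξ * x))).aestronglyMeasurable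

open Filter Topology in
lemma rlim {f V : ℝ → ℂ} (hf : Integrable f) (hV : Integrable V) :
    Tendsto (fun δ : ℝ => ∫ t, ‖f t‖ * om V (δ * t)) (𝓝 0) (𝓝 0) := by
  have : Tendsto (fun δ : ℝ => ∫ t, ‖f t‖ * om V (δ * t)) (𝓝 0) (𝓝 (∫ _ : ℝ, (0 : ℝ))) := by
    refine tendsto_integral_filter_of_dominated_convergence
      (fun t => ‖f t‖ * (2 * ∫ x, ‖V x‖)) ?_ ?_ (hf.norm.mul_const _) ?_
    · exact Eventually.of_forall fun δ => (rint hf hV δ).aestronglyMeasurable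
    · refine Eventually.of_forall fun δ => Eventually.of_forall fun t => ?_
      rw [norm_mul, norm_norm, Real.norm_of_nonneg (om_nonneg _ _)]
      exact mul_le_mul_of_nonneg_left (om_le hV _) (norm_nonneg _)
    · refine Eventually.of_forall fun t => ?_
      have hc : Continuous fun δ : ℝ => ‖f t‖ * om V (δ * t) :=
        continuous_const.mul ((om_continuous hV).comp (by fun_prop))
      have := hc.tendsto 0
      simpa [om_zero] using this
  simpa using this

lemma phi_bound (φ : Cbu →L[ℂ] ℂ) : ∃ N : ℝ, 0 ≤ N ∧ ∀ χ, ‖φ χ‖ ≤ N * ‖χ‖ :=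
  ⟨_, φ.opNorm_nonneg, φ.le_opNorm⟩

set_option maxHeartbeats 2000000 in
open Filter Topology in
lemma local_kill (φ : Cbu →L[ℂ] ℂ) {f V : ℝ → ℂ} (hfJ : f ∈ JsetCbu φ) (hV : Integrable V) (ξ : ℝ)
    (hc : (∫ t, f t * ee (-(ξ * t))) ≠ 0) :
    ∃ δ > 0, ∀ (g : ℝ → ℂ) (hg : Integrable g),
      (∀ s, ∫ t, modK V ξ δ t * g (s - t) = g s) → ∀ ψ, φ (convC g hg ψ) = 0 := by
  have hf : Integrable f := hfJ.1
  set c := ∫ t, f t * ee (-(ξ * t)) with hcdef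
  have hc0 : 0 < ‖c‖ := norm_pos_iff.2 hc
  have hev := (rlim hf hV).eventually (gt_mem_nhds (half_pos hc0))
  obtain ⟨δ, hδ, hlt⟩ : ∃ δ > 0, (∫ t, ‖f t‖ * om V (δ * t)) < ‖c‖ / 2 := by
    obtain ⟨δ, h1, h2⟩ := ((hev.filter_mono nhdsWithin_le_nhds).and
      (self_mem_nhdsWithin : Set.Ioi (0:ℝ) ∈ 𝓝[>] 0)).exists
    exact ⟨δ, h2, h1⟩
  refine ⟨δ, hδ, fun g hg habs => ?_⟩
  have hW := modK_integrable hV ξ hδ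
  obtain ⟨N, hN0, hN⟩ := phi_bound φ
  obtain ⟨C, hC0, hC⟩ : ∃ C : ℝ, 0 ≤ C ∧ C = N * ∫ t, ‖g t‖ :=
    ⟨_, mul_nonneg hN0 (integral_nonneg fun _ => norm_nonneg _), rfl⟩
  have key : ∀ n : ℕ, ∀ ψ, ‖φ (convC g hg ψ)‖ ≤ (1 / 2) ^ n * C * ‖ψ‖ := by
    intro n
    induction n with
    | zero =>
      intro ψ
      refine (hN _).trans ?_
      rw [pow_zero, one_mul, hC, mul_assoc]
      exact mul_le_mul_of_nonneg_left (convC_norm hg ψ) hN0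
    | succ n ih =>
      intro ψ
      set R : Cbu := convC f hf (convC _ hW ψ) - c • convC _ hW ψ with hR
      have h1 : convC g hg R = convC f hf (convC g hg ψ) - c • convC g hg ψ := by
        rw [hR, convC_sub_right, convC_smul_right, convC_comm hg hf, convC_comm hg hW,
          convC_absorb hW hg habs]
      have h2 : φ (convC g hg R) = - (c * φ (convC g hg ψ)) := by
        rw [h1, map_sub, map_smul, (mem_J_iff φ hf).1 hfJ, smul_eq_mul, zero_sub]
      have h3 : ‖R‖ ≤ ‖c‖ / 2 * ‖ψ‖ := (rbound hf hV ξ hδ ψ).trans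
        (mul_le_mul_of_nonneg_right hlt.le (norm_nonneg _))
      have h4 := ih R
      rw [h2, norm_neg, norm_mul] at h4
      have h5 : ‖c‖ * ‖φ (convC g hg ψ)‖ ≤ ‖c‖ * ((1 / 2) ^ (n + 1) * C * ‖ψ‖) := by
        calc _ ≤ _ := h4
          _ ≤ (1 / 2) ^ n * C * (‖c‖ / 2 * ‖ψ‖) :=
            mul_le_mul_of_nonneg_left h3 (mul_nonneg (by positivity) hC0)
          _ = _ := by ring
      exact le_of_mul_le_mul_left h5 hc0
  intro ψ
  have hl : Tendsto (fun n : ℕ => (1 / 2 : ℝ) ^ n * C * ‖ψ‖) atTop (𝓝 (0 * C * ‖ψ‖)) :=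
    ((tendsto_pow_atTop_nhds_zero_of_lt_one (by norm_num) (by norm_num)).mul_const _).mul_const _
  have := ge_of_tendsto' hl (fun n => key n ψ)
  simpa using this

open SchwartzMap FourierTransform in
lemma finv_eq (h : 𝓢(ℝ, ℂ)) (x : ℝ) : (𝓕⁻ h) x = ∫ ξ, ee (ξ * x) * h ξ := by
  rw [SchwartzMap.fourierInv_coe, Real.fourierInv_eq']
  simp [ee, mul_comm]

open SchwartzMap FourierTransform in
lemma f_eq (h : 𝓢(ℝ, ℂ)) (x : ℝ) : (𝓕 h) x = ∫ ξ, ee (-(ξ * x)) * h ξ := by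
  rw [SchwartzMap.fourier_coe, Real.fourier_eq']
  simp [ee, mul_comm]

open SchwartzMap FourierTransform in
lemma absorb_schwartz (b h : 𝓢(ℝ, ℂ)) (hbh : ∀ ξ, b ξ * h ξ = h ξ) (s : ℝ) :
    ∫ t, (𝓕⁻ b) t * (𝓕⁻ h) (s - t) = (𝓕⁻ h) s := by
  simp only [finv_eq h, ← integral_const_mul]
  rw [integral_integral_swap]
  · congr 1; ext ξ
    have : ∀ t, (𝓕⁻ b) t * (ee (ξ * (s - t)) * h ξ) =
        (ee (ξ * s) * h ξ) * (ee (-(t * ξ)) * (𝓕⁻ b) t) := by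
      intro t
      rw [show ξ * (s - t) = ξ * s + -(t * ξ) by ring, ee_add]; ring
    simp_rw [this]
    rw [integral_const_mul, ← f_eq, FourierTransform.fourier_fourierInv_eq, mul_assoc,
      mul_comm (h ξ), hbh]
  · have h1 : Integrable (fun p : ℝ × ℝ => (𝓕⁻ b) p.1 * h p.2) (volume.prod volume) :=
      (𝓕⁻ b).integrable.mul_prod h.integrable
    have h2 := h1.bdd_mul (c := 1) (f := fun p : ℝ × ℝ => ee (p.2 * (s - p.1)))
      (ee_continuous.comp (by fun_prop)).aestronglyMeasurable
      (Filter.Eventually.of_forall fun t => (ee_norm _).le)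
    refine h2.congr (Filter.Eventually.of_forall fun p => ?_)
    simp only [Function.uncurry]; ring

noncomputable def bump0 : ContDiffBump (0 : ℝ) := ⟨1, 2, by norm_num, by norm_num⟩

noncomputable def bumpF (ξ δ : ℝ) (x : ℝ) : ℂ := ((bump0 ((x - ξ) / δ) : ℝ) : ℂ)

lemma bumpF_contDiff (ξ δ : ℝ) : ContDiff ℝ (↑(⊤ : ℕ∞)) (bumpF ξ δ) := by
  unfold bumpF
  exact Complex.ofRealCLM.contDiff.comp (bump0.contDiff.comp (by fun_prop))

lemma bumpF_one {ξ δ x : ℝ} (hδ : 0 < δ) (h : |x - ξ| ≤ δ) : bumpF ξ δ x = 1 := by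
  unfold bumpF
  rw [bump0.one_of_mem_closedBall]
  · simp
  · simp only [bump0, mem_closedBall_zero_iff, Real.norm_eq_abs, abs_div, abs_of_pos hδ]
    exact (div_le_one hδ).2 h

lemma bumpF_zero {ξ δ x : ℝ} (hδ : 0 < δ) (h : 2 * δ ≤ |x - ξ|) : bumpF ξ δ x = 0 := by
  unfold bumpF
  rw [bump0.zero_of_le_dist]
  · simp
  · simp only [bump0, dist_zero_right, Real.norm_eq_abs, abs_div, abs_of_pos hδ]
    exact (le_div_iff₀ hδ).2 h

lemma bumpF_compact (ξ : ℝ) {δ : ℝ} (hδ : 0 < δ) : HasCompactSupport (bumpF ξ δ) := by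
  refine HasCompactSupport.intro (isCompact_closedBall ξ (2 * δ)) fun x hx => ?_
  refine bumpF_zero hδ ?_
  rw [Metric.mem_closedBall, Real.dist_eq, not_le] at hx
  exact hx.le

open SchwartzMap in
noncomputable def bumpS (ξ : ℝ) {δ : ℝ} (hδ : 0 < δ) : 𝓢(ℝ, ℂ) :=
  (bumpF_compact ξ hδ).toSchwartzMap (bumpF_contDiff ξ δ)

lemma bumpS_apply (ξ : ℝ) {δ : ℝ} (hδ : 0 < δ) (x : ℝ) : bumpS ξ hδ x = bumpF ξ δ x := rfl

open SchwartzMap FourierTransform in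
noncomputable def V0 : 𝓢(ℝ, ℂ) := 𝓕⁻ (bumpS 0 one_pos)

open SchwartzMap FourierTransform in
lemma finv_bumpS (ξ : ℝ) {δ : ℝ} (hδ : 0 < δ) (x : ℝ) :
    (𝓕⁻ (bumpS ξ hδ)) x = modK V0 ξ δ x := by
  have h1 : ∀ y, ee (y * x) * bumpS ξ hδ y
      = (fun z => ee ((δ * z + ξ) * x) * bumpS 0 one_pos z) (δ⁻¹ * (y - ξ)) := by
    intro y
    simp only [bumpS_apply, bumpF]
    rw [show (δ * (δ⁻¹ * (y - ξ)) + ξ) * x = y * x by field_simp; ring,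
      show (δ⁻¹ * (y - ξ) - 0) / 1 = (y - ξ) / δ by ring]
  rw [finv_eq]
  simp_rw [h1]
  rw [integral_sub_right_eq_self (fun y => (fun z => ee ((δ * z + ξ) * x) * bumpS 0 one_pos z) (δ⁻¹ * y)),
    Measure.integral_comp_mul_left (fun z => ee ((δ * z + ξ) * x) * bumpS 0 one_pos z), inv_inv, abs_of_pos hδ, modK, V0, finv_eq,
    ← integral_const_mul, ← integral_const_mul, ← integral_smul]
  congr 1; ext z
  rw [show (δ * z + ξ) * x = ξ * x + z * (δ * x) by ring, ee_add]
  simp only [Complex.real_smul]; ring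

lemma V0_integral : ∫ t, V0 t = 1 := by
  have h := f_eq V0 0
  rw [V0, FourierTransform.fourier_fourierInv_eq, bumpS_apply, bumpF_one one_pos (by simp)] at h
  rw [V0, h]; simp [ee_zero]

lemma convC_congr {f g : ℝ → ℂ} (hf : Integrable f) (hg : Integrable g) (h : ∀ x, f x = g x)
    (ψ : Cbu) : convC f hf ψ = convC g hg ψ := by
  obtain rfl : f = g := funext h
  rfl

open SchwartzMap FourierTransform in
noncomputable abbrev iF (h : 𝓢(ℝ, ℂ)) : 𝓢(ℝ, ℂ) := 𝓕⁻ h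

open SchwartzMap FourierTransform in
def NN (φ : Cbu →L[ℂ] ℂ) (h : 𝓢(ℝ, ℂ)) : Prop :=
  ∀ ψ, φ (convC (iF h) (iF h).integrable ψ) = 0

open SchwartzMap FourierTransform in
lemma finv_sub (h k : 𝓢(ℝ, ℂ)) (x : ℝ) : (𝓕⁻ (h - k)) x = (𝓕⁻ h) x - (𝓕⁻ k) x := by
  rw [sub_eq_add_neg, FourierTransform.fourierInv_add, FourierTransform.fourierInv_neg]
  simp [sub_eq_add_neg]

open SchwartzMap FourierTransform in
lemma phi_finv_sub (φ : Cbu →L[ℂ] ℂ) (h k : 𝓢(ℝ, ℂ)) (ψ : Cbu) :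
    φ (convC (iF (h - k)) (iF (h - k)).integrable ψ) =
      φ (convC (iF h) (iF h).integrable ψ) - φ (convC (iF k) (iF k).integrable ψ) := by
  rw [convC_congr _ ((iF h).integrable.sub (iF k).integrable) (finv_sub h k),
    ← map_sub]
  congr 1
  exact convC_sub_left (iF h).integrable (iF k).integrable _ ψ

open SchwartzMap FourierTransform Topology in
lemma global_kill (φ : Cbu →L[ℂ] ℂ)
    (hsp : ∀ ξ : ℝ, ξ ≠ 0 → ∃ f ∈ JsetCbu φ, (∫ t, f t * ee (-(ξ * t))) ≠ 0)
    {K : Set ℝ} (hK : IsCompact K) (hK0 : (0 : ℝ) ∉ K) (h : 𝓢(ℝ, ℂ)) (hh : ∀ ξ, ξ ∉ K → h ξ = 0) :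
    NN φ h := by
  have main : ∀ h : 𝓢(ℝ, ℂ), ∃ h' : 𝓢(ℝ, ℂ), NN φ (h - h') ∧ (∀ ξ, h ξ = 0 → h' ξ = 0) ∧
      ∀ ξ ∈ K, h' ξ = 0 := by
    refine hK.induction_on (p := fun K => ∀ h : 𝓢(ℝ, ℂ), ∃ h' : 𝓢(ℝ, ℂ), NN φ (h - h') ∧
      (∀ ξ, h ξ = 0 → h' ξ = 0) ∧ ∀ ξ ∈ K, h' ξ = 0) ?_ ?_ ?_ ?_
    · refine fun h => ⟨h, fun ψ => ?_, fun _ => id, by simp⟩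
      rw [phi_finv_sub, sub_self]
    · intro s t hst ht h
      obtain ⟨h', h1, h2, h3⟩ := ht h
      exact ⟨h', h1, h2, fun ξ hξ => h3 ξ (hst hξ)⟩
    · intro s t hs ht h
      obtain ⟨h', h1, h2, h3⟩ := hs h
      obtain ⟨k', k1, k2, k3⟩ := ht h'
      refine ⟨k', fun ψ => ?_, fun ξ hξ => k2 _ (h2 _ hξ), ?_⟩
      · have a := h1 ψ
        have b := k1 ψ
        rw [phi_finv_sub] at a b ⊢
        linear_combination a + b
      · rintro ξ (hξ | hξ)
        · exact k2 _ (h3 _ hξ)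
        · exact k3 _ hξ
    · intro ξ hξ
      have hξ0 : ξ ≠ 0 := fun h0 => hK0 (h0 ▸ hξ)
      obtain ⟨f, hfJ, hfc⟩ := hsp ξ hξ0
      obtain ⟨δ, hδ, hkill⟩ := local_kill φ hfJ V0.integrable ξ hfc
      have hδ2 : 0 < δ / 2 := by positivity
      refine ⟨Metric.closedBall ξ (δ / 2),
        mem_nhdsWithin_of_mem_nhds (Metric.closedBall_mem_nhds ξ hδ2), fun h => ?_⟩
      have hT : (bumpF ξ (δ / 2)).HasTemperateGrowth := (bumpS ξ hδ2).hasTemperateGrowth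
      set ρh := smulLeftCLM ℂ (bumpF ξ (δ / 2)) h with hρ
      have hρa : ∀ x, ρh x = bumpF ξ (δ / 2) x * h x := fun x => by
        rw [hρ, smulLeftCLM_apply_apply hT, smul_eq_mul]
      refine ⟨h - ρh, ?_, ?_, ?_⟩
      · rw [sub_sub_cancel]
        refine hkill _ (𝓕⁻ ρh).integrable fun s => ?_
        simp_rw [← finv_bumpS ξ hδ]
        refine absorb_schwartz _ _ (fun x => ?_) s
        rw [hρa, bumpS_apply]
        by_cases hx : |x - ξ| ≤ δ
        · rw [bumpF_one hδ hx, one_mul]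
        · rw [bumpF_zero hδ2 (by linarith [not_le.1 hx])]; simp
      · intro x hx
        rw [_root_.sub_apply, hρa, hx]; simp
      · intro x hx
        rw [Metric.mem_closedBall, Real.dist_eq] at hx
        rw [_root_.sub_apply, hρa, bumpF_one hδ2 hx]; simp
  obtain ⟨h', h1, h2, h3⟩ := main h
  have : h' = 0 := by
    ext ξ
    by_cases hξ : ξ ∈ K
    · exact h3 ξ hξ
    · exact h2 ξ (hh ξ hξ)
  rwa [this, sub_zero] at h1

noncomputable abbrev VV {δ : ℝ} (hδ : 0 < δ) (ψ : Cbu) : Cbu :=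
  convC _ (modK_integrable V0.integrable 0 hδ) ψ

lemma VV_eq (φ : Cbu →L[ℂ] ℂ)
    (hsp : ∀ ξ : ℝ, ξ ≠ 0 → ∃ f ∈ JsetCbu φ, (∫ t, f t * ee (-(ξ * t))) ≠ 0)
    {ε R : ℝ} (hε : 0 < ε) (hR : 0 < R) (h : ε ≤ R) (ψ : Cbu) :
    φ (VV hR ψ) = φ (VV hε ψ) := by
  have hK : IsCompact {x : ℝ | ε ≤ |x| ∧ |x| ≤ 2 * R} := by
    refine (isCompact_closedBall (0 : ℝ) (2 * R)).of_isClosed_subset ?_ ?_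
    · exact (isClosed_le continuous_const continuous_abs).inter
        (isClosed_le continuous_abs continuous_const)
    · intro x hx
      simpa using hx.2
  have := global_kill φ hsp hK (by simp [hε]) (bumpS 0 hR - bumpS 0 hε) (fun x hx => ?_) ψ
  · rw [phi_finv_sub, sub_eq_zero, convC_congr _ (modK_integrable V0.integrable 0 hR) (finv_bumpS 0 hR),
      convC_congr _ (modK_integrable V0.integrable 0 hε) (finv_bumpS 0 hε)] at this
    exact this
  · rw [_root_.sub_apply, bumpS_apply, bumpS_apply]
    by_cases h1 : ε ≤ |x|
    · have h2 : 2 * R < |x| := by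
        by_contra h3
        exact hx ⟨h1, not_lt.1 h3⟩
      rw [bumpF_zero hR (by simpa using h2.le), bumpF_zero hε (by rw [sub_zero]; linarith), sub_zero]
    · have h2 := not_le.1 h1
      rw [bumpF_one hR (by rw [sub_zero]; linarith), bumpF_one hε (by simpa using h2.le), sub_self]

open Filter Topology in
lemma VV_lim (ψ : Cbu) {η : ℝ} (hη : 0 < η) :
    ∃ R0 > 0, ∀ R, (hR : 0 < R) → R0 ≤ R → ‖VV hR ψ - ψ‖ ≤ η := by
  have hI1 : Integrable (fun t => ‖V0 t‖) := V0.integrable.norm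
  have hI2 : Integrable (fun t : ℝ => |t| * ‖V0 t‖) := by
    simpa using V0.integrable_pow_mul volume 1
  set A := ∫ t, ‖V0 t‖ with hA
  set B := ∫ t : ℝ, |t| * ‖V0 t‖ with hB
  have hA0 : 0 ≤ A := integral_nonneg fun _ => norm_nonneg _
  have hB0 : 0 ≤ B := integral_nonneg fun _ => mul_nonneg (abs_nonneg _) (norm_nonneg _)
  set e := η / (2 * (A + 1)) with he
  have he0 : 0 < e := by positivity
  obtain ⟨d, hd, hdψ⟩ := Metric.uniformContinuous_iff.1 (cbu_uc ψ) e he0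
  set M := 2 * ‖ψ‖ / d with hM
  have hM0 : 0 ≤ M := div_nonneg (mul_nonneg two_pos.le (norm_nonneg _)) hd.le
  have hmod : ∀ x a : ℝ, ‖(ψ : ℝ →ᵇ ℂ) (x - a) - (ψ : ℝ →ᵇ ℂ) x‖ ≤ e + M * |a| := by
    intro x a
    by_cases ha : |a| < d
    · have := @hdψ (x - a) x (by rw [Real.dist_eq]; simpa using ha)
      rw [dist_eq_norm] at this
      have h2 : 0 ≤ M * |a| := mul_nonneg hM0 (abs_nonneg _)
      linarith
    · have h1 : ‖(ψ : ℝ →ᵇ ℂ) (x - a) - (ψ : ℝ →ᵇ ℂ) x‖ ≤ 2 * ‖ψ‖ := by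
        refine (norm_sub_le _ _).trans ?_
        linarith [cbu_norm_le ψ (x - a), cbu_norm_le ψ x]
      have h2 : M * d = 2 * ‖ψ‖ := div_mul_cancel₀ _ hd.ne'
      have h3 : M * d ≤ M * |a| := mul_le_mul_of_nonneg_left (not_lt.1 ha) hM0
      linarith
  refine ⟨2 * (M * B) / η + 1, by positivity, fun R hR hRR => ?_⟩
  refine cbu_norm_le_of _ hη.le fun x => ?_
  have h1 : (VV hR ψ : ℝ →ᵇ ℂ) x = ∫ t, V0 t * (ψ : ℝ →ᵇ ℂ) (x - R⁻¹ * t) := by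
    rw [convC_apply]
    have : ∀ t, modK V0 0 R t * (ψ : ℝ →ᵇ ℂ) (x - t)
        = (R : ℂ) * (fun t => V0 t * (ψ : ℝ →ᵇ ℂ) (x - R⁻¹ * t)) (R * t) := by
      intro t
      simp only [modK, zero_mul, ee_zero, one_mul]
      rw [show R⁻¹ * (R * t) = t by field_simp, mul_assoc]
    simp_rw [this]
    rw [integral_const_mul,
      Measure.integral_comp_mul_left (fun t => V0 t * (ψ : ℝ →ᵇ ℂ) (x - R⁻¹ * t)) R,
      abs_of_pos (inv_pos.2 hR), Complex.real_smul, ← mul_assoc]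
    rw [← Complex.ofReal_mul, mul_inv_cancel₀ hR.ne', Complex.ofReal_one, one_mul]
  have hint : Integrable fun t => V0 t * (ψ : ℝ →ᵇ ℂ) (x - R⁻¹ * t) := by
    refine V0.integrable.mul_bdd (c := ‖ψ‖) ?_ (Eventually.of_forall fun t => cbu_norm_le ψ _)
    have : Continuous (ψ : ℝ →ᵇ ℂ) := (cbu_uc ψ).continuous
    exact (by fun_prop : Continuous fun t => (ψ : ℝ →ᵇ ℂ) (x - R⁻¹ * t)).aestronglyMeasurable
  have h2 : (ψ : ℝ →ᵇ ℂ) x = ∫ t, V0 t * (ψ : ℝ →ᵇ ℂ) x := by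
    rw [integral_mul_const, V0_integral, one_mul]
  have h3 : ((VV hR ψ - ψ : Cbu) : ℝ →ᵇ ℂ) x
      = ∫ t, (V0 t * (ψ : ℝ →ᵇ ℂ) (x - R⁻¹ * t) - V0 t * (ψ : ℝ →ᵇ ℂ) x) := by
    rw [integral_sub hint (V0.integrable.mul_const _), ← h2, ← h1]
    rfl
  rw [h3]
  have h4 : ‖∫ t, (V0 t * (ψ : ℝ →ᵇ ℂ) (x - R⁻¹ * t) - V0 t * (ψ : ℝ →ᵇ ℂ) x)‖
      ≤ ∫ t : ℝ, (e * ‖V0 t‖ + M * R⁻¹ * (|t| * ‖V0 t‖)) := by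
    refine norm_integral_le_of_norm_le ((hI1.const_mul _).add (hI2.const_mul _))
      (Eventually.of_forall fun t => ?_)
    rw [← mul_sub, norm_mul]
    refine (mul_le_mul_of_nonneg_left (hmod x _) (norm_nonneg _)).trans (le_of_eq ?_)
    rw [abs_mul, abs_of_pos (inv_pos.2 hR)]; ring
  rw [integral_add (hI1.const_mul _) (hI2.const_mul _), integral_const_mul, integral_const_mul,
    ← hA, ← hB] at h4
  refine h4.trans ?_
  have h5 : e * A ≤ η / 2 := by
    rw [he, div_mul_eq_mul_div, div_le_div_iff₀ (by positivity) (by positivity)]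
    nlinarith
  have h6 : M * R⁻¹ * B ≤ η / 2 := by
    have : 2 * (M * B) / η ≤ R := by linarith
    rw [div_le_iff₀ hη] at this
    rw [show M * R⁻¹ * B = (M * B) / R by ring, div_le_iff₀ hR]
    linarith
  linarith

lemma VV_phi (φ : Cbu →L[ℂ] ℂ)
    (hsp : ∀ ξ : ℝ, ξ ≠ 0 → ∃ f ∈ JsetCbu φ, (∫ t, f t * ee (-(ξ * t))) ≠ 0)
    {ε : ℝ} (hε : 0 < ε) (ψ : Cbu) :
    φ (VV hε ψ) = φ ψ := by
  obtain ⟨N, hN0, hN⟩ := phi_bound φ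
  rw [← sub_eq_zero, ← norm_le_zero_iff]
  refine le_of_forall_pos_le_add fun η hη => ?_
  obtain ⟨R0, hR0, h⟩ := VV_lim ψ (η := η / (N + 1)) (by positivity)
  have hR : 0 < max R0 ε := lt_max_of_lt_left hR0
  rw [← VV_eq φ hsp hε hR (le_max_right _ _) ψ, ← map_sub]
  refine (hN _).trans ?_
  refine (mul_le_mul_of_nonneg_left (h _ hR (le_max_left _ _)) hN0).trans ?_
  rw [zero_add, mul_div_assoc', div_le_iff₀ (by positivity)]
  nlinarith

set_option maxHeartbeats 1000000 in
open Filter Topology in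
lemma inv_of_sp (φ : Cbu →L[ℂ] ℂ)
    (hsp : ∀ ξ : ℝ, ξ ≠ 0 → ∃ f ∈ JsetCbu φ, (∫ t, f t * ee (-(ξ * t))) ≠ 0)
    (ψ : Cbu) (s : ℝ) : φ (trC s ψ) = φ ψ := by
  obtain ⟨N, hN0, hN⟩ := phi_bound φ
  have key : ∀ ε, 0 < ε → ‖φ (trC s ψ) - φ ψ‖ ≤ N * (om V0 (ε * -s) * ‖ψ‖) := by
    intro ε hε
    rw [← VV_phi φ hsp hε (trC s ψ), ← VV_phi φ hsp hε ψ, ← map_sub]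
    refine (hN _).trans (mul_le_mul_of_nonneg_left ?_ hN0)
    refine cbu_norm_le_of _ (mul_nonneg (om_nonneg _ _) (norm_nonneg _)) fun x => ?_
    have h := kbound V0.integrable 0 hε ψ x (-s)
    rw [zero_mul, neg_zero, ee_zero, one_mul] at h
    convert h using 2
    rw [Submodule.coe_sub, BoundedContinuousFunction.sub_apply]
    congr 1
    simp only [convC_apply, trC_apply]
    congr 1; ext t; congr 2; ring
  have hc : Continuous fun ε : ℝ => N * (om V0 (ε * -s) * ‖ψ‖) :=
    continuous_const.mul (((om_continuous V0.integrable).comp (by fun_prop)).mul continuous_const)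
  have hl : Tendsto (fun ε : ℝ => N * (om V0 (ε * -s) * ‖ψ‖)) (𝓝[>] 0) (𝓝 0) := by
    have := (hc.tendsto 0).mono_left (nhdsWithin_le_nhds (s := Set.Ioi 0))
    have h0 : N * (om V0 (0 * -s) * ‖ψ‖) = 0 := by rw [zero_mul, om_zero, zero_mul, mul_zero]
    rw [h0] at this
    exact this
  have := ge_of_tendsto hl (by filter_upwards [self_mem_nhdsWithin] with ε hε using key ε hε)
  exact sub_eq_zero.1 (norm_le_zero_iff.1 this)

lemma sp_of_inv (φ : Cbu →L[ℂ] ℂ) (h : ∀ ψ s, φ (trC s ψ) = φ ψ) {ξ : ℝ} (hξ : ξ ≠ 0) :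
    ∃ f ∈ JsetCbu φ, (∫ t, f t * ee (-(ξ * t))) ≠ 0 := by
  set g := modK V0 ξ 1 with hgdef
  have hg : Integrable g := modK_integrable V0.integrable ξ one_pos
  set a := 1 / (2 * ξ) with ha
  have hg2 : Integrable fun t => g (t - a) := hg.comp_sub_right a
  have hg3 : Integrable fun t => g t - g (t - a) := hg.sub hg2
  refine ⟨fun t => g t - g (t - a), (mem_J_iff φ hg3).2 fun ψ => ?_, ?_⟩
  · rw [convC_sub_left hg hg2 hg3, map_sub, sub_eq_zero, ← h (convC g hg ψ) (-a)]
    congr 1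
    apply cbu_ext; intro x
    rw [trC_apply, convC_apply, convC_apply,
      ← integral_sub_right_eq_self (fun t => g t * (ψ : ℝ →ᵇ ℂ) (x + -a - t)) a]
    congr 1; ext t; congr 2; ring
  · have h1 : ∀ t, (g t - g (t - a)) * ee (-(ξ * t)) = V0 t + V0 (t - a) := by
      intro t
      have e1 : ee (ξ * t) * ee (-(ξ * t)) = 1 := by rw [← ee_add, add_neg_cancel, ee_zero]
      have e2 : ee (ξ * (t - a)) * ee (-(ξ * t)) = -1 := by
        rw [← ee_add, show ξ * (t - a) + -(ξ * t) = -(1 / 2) by rw [ha]; field_simp; ring, ee]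
        rw [show (((2 * Real.pi * -(1 / 2) : ℝ) : ℂ) * Complex.I) = -(Real.pi * Complex.I) by
          push_cast; ring, Complex.exp_neg, Complex.exp_pi_mul_I]
        norm_num
      simp only [hgdef, modK, Complex.ofReal_one, one_mul]
      linear_combination (V0 t) * e1 - (V0 (t - a)) * e2
    simp_rw [h1]
    rw [integral_add V0.integrable (V0.integrable.comp_sub_right a),
      integral_sub_right_eq_self (fun t => V0 t) a, V0_integral]
    norm_num

lemma ee_eq (l x : ℝ) :
    Complex.exp (-(Complex.I * l * x)) = ee (-(l / (2 * Real.pi) * x)) := by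
  rw [ee]; congr 1
  have : (Real.pi : ℂ) ≠ 0 := by exact_mod_cast Real.pi_ne_zero
  push_cast; field_simp

lemma zero_mem_sp (φ : Cbu →L[ℂ] ℂ) (hφ : IsMeanCbu φ) : (0 : ℝ) ∈ spCbu φ := by
  simp only [spCbu, Set.mem_iInter]
  intro f hf
  have h := hf.2 oneCbu ((∫ t, f t) • oneCbu) (fun x => by simp [oneCbu])
  rw [map_smul, hφ.2] at h
  simpa using h

/-- A mean `φ` on `C_bu(ℝ)` is translation invariant iff `sp(φ) = {0}`. -/
theorem invariantMean_iff_sp_eq_singleton_zero (φ : Cbu →L[ℂ] ℂ) (hφ : IsMeanCbu φ) :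
    (∀ (ψ χ : Cbu) (s : ℝ),
        (∀ x : ℝ, (χ : ℝ →ᵇ ℂ) x = (ψ : ℝ →ᵇ ℂ) (x + s)) → φ χ = φ ψ) ↔
    spCbu φ = {0} := by
  have hpi := Real.pi_pos
  constructor
  · intro h
    refine Set.eq_singleton_iff_unique_mem.2 ⟨zero_mem_sp φ hφ, fun l hl => ?_⟩
    by_contra hl0
    obtain ⟨f, hfJ, hf⟩ := sp_of_inv φ (fun ψ s => h ψ (trC s ψ) s fun x => rfl)
      (ξ := l / (2 * Real.pi)) (by positivity)
    simp only [spCbu, Set.mem_iInter] at hl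
    have h2 : (∫ x : ℝ, f x * Complex.exp (-(Complex.I * l * x))) = 0 := hl f hfJ
    simp_rw [ee_eq] at h2
    exact hf h2
  · intro h ψ χ s hχ
    have hsp : ∀ ξ : ℝ, ξ ≠ 0 → ∃ f ∈ JsetCbu φ, (∫ t, f t * ee (-(ξ * t))) ≠ 0 := by
      intro ξ hξ
      by_contra hcon
      push Not at hcon
      have hmem : 2 * Real.pi * ξ ∈ spCbu φ := by
        simp only [spCbu, Set.mem_iInter]
        intro f hf
        have h3 := hcon f hf
        change (∫ x : ℝ, f x * Complex.exp (-(Complex.I * ((2 * Real.pi * ξ : ℝ) : ℂ) * x))) = 0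
        simp_rw [ee_eq]
        rwa [show 2 * Real.pi * ξ / (2 * Real.pi) = ξ by field_simp]
      rw [h, Set.mem_singleton_iff] at hmem
      have : 2 * Real.pi * ξ ≠ 0 := by positivity
      exact this hmem
    rw [← inv_of_sp φ hsp ψ s]
    congr 1
    exact cbu_ext hχ
end

section
/- Let ψ ∈ L^∞(ℝ). Then φ(ψ) = 0 for every topologically invariant mean φ on L^∞(ℝ) if and only if for every ε > 0 there exist ψ₁ ∈ L^∞(ℝ) and δ > 0 such that sp(ψ₁) ∩ (−δ, δ) = ∅ and ‖ψ − ψ₁‖_∞ ≤ ε. -/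
open MeasureTheory Filter

/-- The convolution `(f*ψ)(x) = ∫ f(t) ψ(x−t) dt`. -/
noncomputable def conv (f ψ : ℝ → ℂ) : ℝ → ℂ := fun x => ∫ t, f t * ψ (x - t)

/-- `J(ψ) = {f ∈ L^1(ℝ) : f*ψ = 0 a.e.}`. -/
def Jset (ψ : ℝ → ℂ) : Set (ℝ → ℂ) :=
  {f | Integrable f volume ∧ conv f ψ =ᵐ[volume] (fun _ => (0 : ℂ))}

/-- The spectrum `sp(ψ) = ⋂_{f ∈ J(ψ)} {λ : f̂(λ) = 0}`. -/
def spectrumOf (ψ : ℝ → ℂ) : Set ℝ :=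
  ⋂ f ∈ Jset ψ, {l : ℝ | fourierT f l = 0}


open Convolution Topology

lemma conv_eq_convolution (f ψ : ℝ → ℂ) :
    conv f ψ = (f ⋆[ContinuousLinearMap.mul ℂ ℂ, volume] ψ) := rfl

lemma ae_sub_left {p : ℝ → Prop} (h : ∀ᵐ x, p x) (x : ℝ) : ∀ᵐ t, p (x - t) :=
  (Measure.measurePreserving_sub_left volume x).quasiMeasurePreserving.ae h

lemma conv_integrand_integrable {f ψ : ℝ → ℂ} {M : ℝ} (hf : Integrable f)
    (hψ : AEStronglyMeasurable ψ) (hM : ∀ᵐ x, ‖ψ x‖ ≤ M) (x : ℝ) :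
    Integrable (fun t => f t * ψ (x - t)) := by
  refine hf.mul_bdd (c := M) ?_ (ae_sub_left hM x)
  exact hψ.comp_quasiMeasurePreserving
    (Measure.measurePreserving_sub_left volume x).quasiMeasurePreserving

lemma conv_aesm {f ψ : ℝ → ℂ} (hf : AEStronglyMeasurable f)
    (hψ : AEStronglyMeasurable ψ) : AEStronglyMeasurable (conv f ψ) := by
  have := (hf.convolution_integrand (μ := volume) (ContinuousLinearMap.mul ℂ ℂ) hψ)
  exact this.integral_prod_right'

lemma conv_bound {f ψ : ℝ → ℂ} {M : ℝ} (hf : Integrable f)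
    (hM : ∀ᵐ x, ‖ψ x‖ ≤ M) (x : ℝ) :
    ‖conv f ψ x‖ ≤ (∫ t, ‖f t‖) * M := by
  unfold conv
  rw [← integral_mul_const]
  refine norm_integral_le_of_norm_le (hf.norm.mul_const M) ?_
  filter_upwards [ae_sub_left hM x] with t ht
  rw [norm_mul]
  gcongr

lemma conv_congr {f ψ χ : ℝ → ℂ} (h : ψ =ᵐ[volume] χ) : conv f ψ = conv f χ := by
  funext x
  refine integral_congr_ae ?_
  filter_upwards [ae_sub_left h x] with t ht
  rw [ht]

lemma conv_sub_right {f ψ χ : ℝ → ℂ} {M N : ℝ} (hf : Integrable f)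
    (hψ : AEStronglyMeasurable ψ) (hM : ∀ᵐ x, ‖ψ x‖ ≤ M)
    (hχ : AEStronglyMeasurable χ) (hN : ∀ᵐ x, ‖χ x‖ ≤ N) :
    conv f (fun x => ψ x - χ x) = fun x => conv f ψ x - conv f χ x := by
  funext x
  unfold conv
  rw [← integral_sub (conv_integrand_integrable hf hψ hM x)
    (conv_integrand_integrable hf hχ hN x)]
  congr 1; funext t; ring

lemma conv_add_right {f ψ χ : ℝ → ℂ} {M N : ℝ} (hf : Integrable f)
    (hψ : AEStronglyMeasurable ψ) (hM : ∀ᵐ x, ‖ψ x‖ ≤ M)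
    (hχ : AEStronglyMeasurable χ) (hN : ∀ᵐ x, ‖χ x‖ ≤ N) :
    conv f (fun x => ψ x + χ x) = fun x => conv f ψ x + conv f χ x := by
  funext x
  unfold conv
  rw [← integral_add (conv_integrand_integrable hf hψ hM x)
    (conv_integrand_integrable hf hχ hN x)]
  congr 1; funext t; ring

lemma conv_sub_left {f g ψ : ℝ → ℂ} {M : ℝ} (hf : Integrable f) (hg : Integrable g)
    (hψ : AEStronglyMeasurable ψ) (hM : ∀ᵐ x, ‖ψ x‖ ≤ M) :
    conv (fun x => f x - g x) ψ = fun x => conv f ψ x - conv g ψ x := by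
  funext x
  unfold conv
  rw [← integral_sub (conv_integrand_integrable hf hψ hM x)
    (conv_integrand_integrable hg hψ hM x)]
  congr 1; funext t; ring

lemma conv_add_left {f g ψ : ℝ → ℂ} {M : ℝ} (hf : Integrable f) (hg : Integrable g)
    (hψ : AEStronglyMeasurable ψ) (hM : ∀ᵐ x, ‖ψ x‖ ≤ M) :
    conv (fun x => f x + g x) ψ = fun x => conv f ψ x + conv g ψ x := by
  funext x
  unfold conv
  rw [← integral_add (conv_integrand_integrable hf hψ hM x)
    (conv_integrand_integrable hg hψ hM x)]
  congr 1; funext t; ring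

lemma conv_smul_left (c : ℂ) (f ψ : ℝ → ℂ) :
    conv (fun x => c * f x) ψ = fun x => c * conv f ψ x := by
  funext x
  unfold conv
  rw [← integral_const_mul]
  congr 1; funext t; ring

lemma conv_smul_right (c : ℂ) (f ψ : ℝ → ℂ) :
    conv f (fun x => c * ψ x) = fun x => c * conv f ψ x := by
  funext x
  unfold conv
  rw [← integral_const_mul]
  congr 1; funext t; ring

lemma conv_integrable_s11 {f g : ℝ → ℂ} (hf : Integrable f) (hg : Integrable g) :
    Integrable (conv f g) :=
  hf.integrable_convolution (ContinuousLinearMap.mul ℂ ℂ) hg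

lemma conv_assoc {f g ψ : ℝ → ℂ} {M : ℝ} (hf : Integrable f) (hg : Integrable g)
    (hψ : AEStronglyMeasurable ψ) (hM : ∀ᵐ x, ‖ψ x‖ ≤ M) :
    conv (conv f g) ψ = conv f (conv g ψ) := by
  funext x
  have hgn : ∀ y : ℝ, ConvolutionExistsAt (fun x => ‖g x‖) (fun x => ‖ψ x‖) y
      (ContinuousLinearMap.mul ℝ ℝ) volume := by
    intro y
    have := (conv_integrand_integrable hg hψ hM y).norm
    simpa [ConvolutionExistsAt, norm_mul] using this
  refine convolution_assoc (ContinuousLinearMap.mul ℂ ℂ) (ContinuousLinearMap.mul ℂ ℂ)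
    (ContinuousLinearMap.mul ℂ ℂ) (ContinuousLinearMap.mul ℂ ℂ)
    (fun a b c => by simp [mul_assoc]) hf.1 hg.1 hψ
    (hf.ae_convolution_exists (ContinuousLinearMap.mul ℂ ℂ) hg)
    (Eventually.of_forall hgn) ?_
  have hb : ∀ y : ℝ, ‖((fun x => ‖g x‖) ⋆[ContinuousLinearMap.mul ℝ ℝ, volume] fun x => ‖ψ x‖) y‖
      ≤ (∫ t, ‖g t‖) * M := by
    intro y
    rw [convolution_def, ← integral_mul_const]
    refine norm_integral_le_of_norm_le (hg.norm.mul_const M) ?_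
    filter_upwards [ae_sub_left hM y] with t ht
    simp only [ContinuousLinearMap.mul_apply', norm_mul, norm_norm]
    gcongr
  have hmeas : AEStronglyMeasurable
      ((fun x => ‖g x‖) ⋆[ContinuousLinearMap.mul ℝ ℝ, volume] fun x => ‖ψ x‖) volume := by
    have := (hg.1.norm.convolution_integrand (μ := volume) (ContinuousLinearMap.mul ℝ ℝ) hψ.norm)
    exact this.integral_prod_right'
  refine hf.norm.mul_bdd (c := (∫ t, ‖g t‖) * M) ?_ (Eventually.of_forall fun t => hb _)
  exact hmeas.comp_quasiMeasurePreserving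
    (Measure.measurePreserving_sub_left volume x).quasiMeasurePreserving

/-! ### Dilations and translation moduli -/

/-- the dilation `x ↦ r f(r x)` -/
noncomputable def dil (r : ℝ) (f : ℝ → ℂ) : ℝ → ℂ := fun x => r * f (r * x)

/-- `L¹` modulus of continuity -/
noncomputable def modul (K : ℝ → ℂ) (s : ℝ) : ℝ := ∫ x, ‖K (x - s) - K x‖

lemma dil_integrable {r : ℝ} (hr : 0 < r) {f : ℝ → ℂ} (hf : Integrable f) :
    Integrable (dil r f) :=
  (hf.comp_mul_left' hr.ne').const_mul _

lemma dil_integral {r : ℝ} (hr : 0 < r) (f : ℝ → ℂ) : ∫ x, dil r f x = ∫ x, f x := by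
  unfold dil
  rw [integral_const_mul, Measure.integral_comp_mul_left (fun x => f x) r, abs_of_pos (by positivity)]
  have : (r : ℂ) ≠ 0 := by exact_mod_cast hr.ne'
  simp [this]

lemma dil_integral_norm {r : ℝ} (hr : 0 < r) (f : ℝ → ℂ) : ∫ x, ‖dil r f x‖ = ∫ x, ‖f x‖ := by
  unfold dil
  simp only [norm_mul, Complex.norm_real, Real.norm_eq_abs, abs_of_pos hr]
  rw [integral_const_mul, Measure.integral_comp_mul_left (fun x => ‖f x‖) r,
    abs_of_pos (by positivity)]
  simp [hr.ne']

lemma dil_conv {r : ℝ} (hr : 0 < r) (f g : ℝ → ℂ) : conv (dil r f) (dil r g) = dil r (conv f g) := by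
  funext x
  have hr' : (r : ℂ) ≠ 0 := by exact_mod_cast hr.ne'
  have h := Measure.integral_comp_mul_left (fun t => f t * g (r * x - t)) r
  rw [abs_of_pos (by positivity)] at h
  unfold conv
  simp only [dil]
  have e : ∀ t : ℝ, (r : ℂ) * f (r * t) * (r * g (r * (x - t)))
      = (r : ℂ) * r * (f (r * t) * g (r * x - r * t)) := by
    intro t; rw [mul_sub]; ring
  simp_rw [e]
  rw [integral_const_mul, h]
  simp only [Complex.real_smul]; push_cast
  field_simp

lemma dil_modul {r : ℝ} (hr : 0 < r) (f : ℝ → ℂ) (s : ℝ) :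
    modul (dil r f) s = modul f (r * s) := by
  have h := dil_integral_norm hr (fun x => f (x - r * s) - f x)
  unfold modul
  rw [← h]
  congr 1; funext x
  simp only [dil]
  congr 1; rw [mul_sub r x s]; ring

lemma dil_fourierT {r : ℝ} (hr : 0 < r) (f : ℝ → ℂ) (l : ℝ) :
    fourierT (dil r f) l = fourierT f (l / r) := by
  have h := dil_integral hr (fun x => f x * Complex.exp (-(Complex.I * (l / r : ℝ) * x)))
  unfold fourierT
  rw [← h]
  congr 1; funext x
  have hr' : (r : ℂ) ≠ 0 := by exact_mod_cast hr.ne'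
  simp only [dil]
  push_cast
  rw [mul_assoc]
  congr 4
  field_simp

lemma modul_le {K : ℝ → ℂ} (hK : Integrable K) (s : ℝ) : modul K s ≤ 2 * ∫ x, ‖K x‖ := by
  unfold modul
  have h1 : Integrable (fun x => K (x - s)) := hK.comp_sub_right s
  calc ∫ x, ‖K (x - s) - K x‖ ≤ ∫ x, (‖K (x - s)‖ + ‖K x‖) :=
        integral_mono (h1.sub hK).norm (h1.norm.add hK.norm) (fun x => norm_sub_le _ _)
    _ = 2 * ∫ x, ‖K x‖ := by
        rw [integral_add h1.norm hK.norm, integral_sub_right_eq_self (fun x => ‖K x‖) s]; ring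

lemma modul_nonneg (K : ℝ → ℂ) (s : ℝ) : 0 ≤ modul K s := integral_nonneg fun _ => norm_nonneg _

lemma modul_continuous {K : ℝ → ℂ} (hK : Integrable K) : Continuous (modul K) := by
  let k : Lp ℂ 1 (volume : Measure ℝ) := hK.toL1 K
  have : Fact ((1 : ENNReal) ≠ ⊤) := ⟨by simp⟩
  have hc : Continuous (fun s : ℝ => ‖(DomAddAct.mk (-s) +ᵥ k) - k‖) := by
    have h1 : Continuous (fun s : ℝ => (DomAddAct.mk (-s) : ℝᵈᵃᵃ)) :=
      DomAddAct.continuous_mk.comp continuous_neg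
    have : Continuous (fun s : ℝ => (DomAddAct.mk (-s) +ᵥ k)) := h1.vadd continuous_const
    exact (this.sub continuous_const).norm
  convert hc using 1
  funext s
  rw [L1.norm_eq_integral_norm]
  unfold modul
  refine integral_congr_ae ?_
  have h2 := Lp.coeFn_sub (DomAddAct.mk (-s) +ᵥ k) k
  have h3 : (DomAddAct.mk (-s) +ᵥ k : Lp ℂ 1 (volume : Measure ℝ)) =ᵐ[volume] fun x => k (-s + x) := by
    exact Lp.coeFn_compMeasurePreserving k (measurePreserving_vadd (-s) (volume : Measure ℝ))
  have h4 : k =ᵐ[volume] K := hK.coeFn_toL1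
  have h5 : ∀ᵐ x, k (-s + x) = K (-s + x) :=
    (measurePreserving_add_left volume (-s)).quasiMeasurePreserving.ae h4
  filter_upwards [h2, h3, h4, h5] with x h2 h3 h4 h5
  rw [h2, Pi.sub_apply, h3, h4, h5, sub_eq_neg_add x s]

lemma L1_bound {f K : ℝ → ℂ} (hf : Integrable f) (hf1 : ∫ t, f t = 1) (hK : Integrable K) :
    ∫ x, ‖conv K f x - K x‖ ≤ ∫ t, ‖f t‖ * modul K t := by
  have hA : Integrable (fun p : ℝ × ℝ => f p.2 * K (p.1 - p.2)) (volume.prod volume) :=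
    hf.convolution_integrand (ContinuousLinearMap.mul ℂ ℂ) hK
  have hB : Integrable (fun p : ℝ × ℝ => K p.1 * f p.2) (volume.prod volume) := hK.mul_prod hf
  have hC : Integrable (fun p : ℝ × ℝ => ‖f p.2 * K (p.1 - p.2) - K p.1 * f p.2‖)
      (volume.prod volume) := (hA.sub hB).norm
  have h1 : ∀ᵐ x, ‖conv K f x - K x‖ ≤ ∫ t, ‖f t * K (x - t) - K x * f t‖ := by
    filter_upwards [hA.prod_right_ae] with x hx
    have e1 : conv K f x = ∫ t, f t * K (x - t) := by
      unfold conv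
      rw [← integral_sub_left_eq_self (fun t => K t * f (x - t)) volume x]
      congr 1; funext t; rw [sub_sub_cancel, mul_comm]
    have e2 : K x = ∫ t, K x * f t := by rw [integral_const_mul, hf1, mul_one]
    have e3 : conv K f x - K x = ∫ t, (f t * K (x - t) - K x * f t) := by
      rw [integral_sub hx (hf.const_mul _), ← e1, ← e2]
    rw [e3]
    exact norm_integral_le_integral_norm _
  calc ∫ x, ‖conv K f x - K x‖ ≤ ∫ x, ∫ t, ‖f t * K (x - t) - K x * f t‖ :=
        integral_mono_ae ((conv_integrable_s11 hK hf).sub hK).norm hC.integral_prod_left h1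
    _ = ∫ t, ∫ x, ‖f t * K (x - t) - K x * f t‖ := integral_integral_swap hC
    _ = ∫ t, ‖f t‖ * modul K t := by
        congr 1; funext t
        unfold modul
        rw [← integral_const_mul]
        congr 1; funext x
        rw [← norm_mul]; congr 1; ring

/-- the scale sequence -/
noncomputable def rs (n : ℕ) : ℝ := 1 / ((n : ℝ) + 1)

lemma rs_pos (n : ℕ) : 0 < rs n := by unfold rs; positivity

lemma rs_tendsto : Tendsto rs atTop (𝓝 0) := tendsto_one_div_add_atTop_nhds_zero_nat

lemma asymp {f K : ℝ → ℂ} (hf : Integrable f) (hf1 : ∫ t, f t = 1) (hK : Integrable K) :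
    Tendsto (fun n => ∫ x, ‖conv (dil (rs n) K) f x - dil (rs n) K x‖) atTop (𝓝 0) := by
  have key : Tendsto (fun n => ∫ t, ‖f t‖ * modul K (rs n * t)) atTop (𝓝 (∫ _t : ℝ, (0 : ℝ))) := by
    refine tendsto_integral_of_dominated_convergence
      (fun t => ‖f t‖ * (2 * ∫ x, ‖K x‖)) ?_ (hf.norm.mul_const _) ?_ ?_
    · intro n
      exact hf.1.norm.mul
        ((modul_continuous hK).comp (continuous_const.mul continuous_id)).aestronglyMeasurable
    · intro n
      refine Eventually.of_forall fun t => ?_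
      rw [norm_mul, norm_norm, Real.norm_of_nonneg (modul_nonneg _ _)]
      gcongr
      exact modul_le hK _
    · refine Eventually.of_forall fun t => ?_
      have h0 : modul K (0 * t) = 0 := by simp [modul]
      have := ((modul_continuous hK).tendsto (0 * t)).comp (rs_tendsto.mul_const t)
      rw [h0] at this
      simpa using this.const_mul ‖f t‖
  rw [integral_zero] at key
  refine squeeze_zero (fun n => integral_nonneg fun _ => norm_nonneg _) (fun n => ?_) key
  refine (L1_bound hf hf1 (dil_integrable (rs_pos n) hK)).trans (le_of_eq ?_)
  congr 1; funext t; rw [dil_modul (rs_pos n)]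

lemma conv_ae_bound {f ψ : ℝ → ℂ} {M : ℝ} (hf : Integrable f)
    (hM : ∀ᵐ x, ‖ψ x‖ ≤ M) : ∀ᵐ x, ‖conv f ψ x‖ ≤ (∫ t, ‖f t‖) * M :=
  Eventually.of_forall (conv_bound hf hM)

lemma diff_bound {f K ψ : ℝ → ℂ} {M : ℝ} (hf : Integrable f) (hK : Integrable K)
    (hψ : AEStronglyMeasurable ψ) (hM : ∀ᵐ x, ‖ψ x‖ ≤ M) (x : ℝ) :
    ‖conv K (conv f ψ) x - conv K ψ x‖ ≤ (∫ x, ‖conv K f x - K x‖) * M := by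
  rw [← conv_assoc hK hf hψ hM]
  have := conv_sub_left (conv_integrable_s11 hK hf) hK hψ hM
  rw [← congrFun this x]
  exact conv_bound ((conv_integrable_s11 hK hf).sub hK) hM x

lemma diff_tendsto {f K ψ : ℝ → ℂ} {M : ℝ} (hf : Integrable f) (hf1 : ∫ t, f t = 1)
    (hK : Integrable K)
    (hψ : AEStronglyMeasurable ψ) (hM : ∀ᵐ x, ‖ψ x‖ ≤ M) (x : ℕ → ℝ) :
    Tendsto (fun n => conv (dil (rs n) K) (conv f ψ) (x n) - conv (dil (rs n) K) ψ (x n))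
      atTop (𝓝 0) := by
  have h := (asymp hf hf1 hK).mul_const M
  rw [zero_mul] at h
  exact squeeze_zero_norm
    (fun n => diff_bound hf (dil_integrable (rs_pos n) hK) hψ hM (x n)) h

lemma Linf_bound (ψ : Lp ℂ ⊤ (volume : Measure ℝ)) : ∀ᵐ x, ‖ψ x‖ ≤ ‖ψ‖ := by
  have h := ae_le_eLpNormEssSup (f := (ψ : ℝ → ℂ)) (μ := volume)
  have hfin := Lp.eLpNorm_ne_top ψ
  filter_upwards [h] with x hx
  rw [Lp.norm_def]
  rw [eLpNorm_exponent_top] at hfin ⊢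
  have := ENNReal.toReal_mono hfin hx
  simpa using this

lemma Linf_norm_le (ψ : Lp ℂ ⊤ (volume : Measure ℝ)) {C : ℝ} (hC : 0 ≤ C)
    (h : ∀ᵐ x, ‖ψ x‖ ≤ C) : ‖ψ‖ ≤ C := by
  rw [Lp.norm_def, eLpNorm_exponent_top]
  exact ENNReal.toReal_le_of_le_ofReal hC (eLpNormEssSup_le_of_ae_bound h)

lemma Linf_aesm (ψ : Lp ℂ ⊤ (volume : Measure ℝ)) : AEStronglyMeasurable ψ volume :=
  Lp.aestronglyMeasurable ψ

lemma conv_pos {f : ℝ → ℝ} (hf : ∀ x, 0 ≤ f x) {ψ : ℝ → ℂ}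
    (hψ : ∀ᵐ x, 0 ≤ (ψ x).re ∧ (ψ x).im = 0) (x : ℝ) :
    0 ≤ (conv (fun t => (f t : ℂ)) ψ x).re ∧ (conv (fun t => (f t : ℂ)) ψ x).im = 0 := by
  have e : conv (fun t => (f t : ℂ)) ψ x = ((∫ t, f t * (ψ (x - t)).re : ℝ) : ℂ) := by
    rw [← integral_complex_ofReal]
    refine integral_congr_ae ?_
    filter_upwards [ae_sub_left hψ x] with t ht
    apply Complex.ext <;> simp [ht.2]
  rw [e]
  refine ⟨?_, Complex.ofReal_im _⟩
  rw [Complex.ofReal_re]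
  refine integral_nonneg_of_ae ?_
  filter_upwards [ae_sub_left hψ x] with t ht
  exact mul_nonneg (hf t) ht.1

lemma exists_kernel : ∃ F : ℝ → ℝ, (∀ x, 0 ≤ F x) ∧ Integrable F ∧ ∫ x, F x = 1 := by
  refine ⟨(Set.Icc (0 : ℝ) 1).indicator (fun _ => 1), ?_, ?_, ?_⟩
  · intro x; exact Set.indicator_nonneg (fun _ _ => zero_le_one) x
  · rw [integrable_indicator_iff measurableSet_Icc]
    exact integrableOn_const (by simp)
  · rw [integral_indicator measurableSet_Icc]; simp

lemma exists_small (ψ : Lp ℂ ⊤ (volume : Measure ℝ))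
    (h : ∀ φ : Lp ℂ ⊤ (volume : Measure ℝ) →L[ℂ] ℂ,
        IsMean φ → IsTopologicallyInvariant φ → φ ψ = 0) {ε : ℝ} (hε : 0 < ε) :
    ∃ F : ℝ → ℂ, Integrable F ∧ ∫ x, F x = 1 ∧ ∀ x, ‖conv F ψ x‖ ≤ ε := by
  by_contra! hcon
  obtain ⟨F, hF0, hFi, hF1⟩ := exists_kernel
  set G : ℕ → ℝ → ℂ := fun n => dil (rs n) (fun t => (F t : ℂ)) with hG
  have hFc : Integrable (fun t => (F t : ℂ)) := hFi.ofReal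
  have hFc1 : ∫ t, (F t : ℂ) = 1 := by rw [integral_complex_ofReal, hF1]; simp
  have hGi : ∀ n, Integrable (G n) := fun n => dil_integrable (rs_pos n) hFc
  have hG1 : ∀ n, ∫ t, G n t = 1 := fun n => by rw [hG, dil_integral (rs_pos n), hFc1]
  have hGn : ∀ n, ∫ t, ‖G n t‖ = 1 := fun n => by
    rw [hG, dil_integral_norm (rs_pos n)]
    simp only [Complex.norm_real, Real.norm_eq_abs, abs_of_nonneg (hF0 _), hF1]
  have hGr : ∀ n, G n = fun t => ((rs n * F (rs n * t) : ℝ) : ℂ) := fun n => by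
    funext t; simp [hG, dil]
  choose x hx using fun n => hcon (G n) (hGi n) (hG1 n)
  let L : ℕ → Lp ℂ ⊤ (volume : Measure ℝ) → ℂ := fun n χ => conv (G n) χ (x n)
  have hLb : ∀ n χ, ‖L n χ‖ ≤ ‖χ‖ := fun n χ => by
    have := conv_bound (hGi n) (Linf_bound χ) (x n)
    rwa [hGn, one_mul] at this
  let U : Ultrafilter ℕ := hyperfilter ℕ
  have hU : (U : Filter ℕ) ≤ atTop := Nat.hyperfilter_le_atTop
  have hlim : ∀ χ, ∃ z, Tendsto (fun n => L n χ) U (𝓝 z) := by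
    intro χ
    have hc : IsCompact (Metric.closedBall (0 : ℂ) ‖χ‖) := isCompact_closedBall _ _
    obtain ⟨z, -, hz⟩ := hc.ultrafilter_le_nhds (U.map (fun n => L n χ)) (by
      rw [le_principal_iff]
      refine Filter.mem_map.2 (Filter.univ_mem' fun n => ?_)
      simpa using hLb n χ)
    exact ⟨z, hz⟩
  choose Φ hΦ using hlim
  have hadd : ∀ χ η, Φ (χ + η) = Φ χ + Φ η := by
    intro χ η
    refine tendsto_nhds_unique (hΦ (χ + η)) (((hΦ χ).add (hΦ η)).congr fun n => ?_)
    have e1 : conv (G n) (χ + η : Lp ℂ ⊤ (volume : Measure ℝ)) = conv (G n) (fun x => χ x + η x) :=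
      conv_congr (Lp.coeFn_add χ η)
    simp only [L]
    rw [e1, conv_add_right (hGi n) (Linf_aesm χ) (Linf_bound χ) (Linf_aesm η) (Linf_bound η)]
  have hsmul : ∀ (c : ℂ) χ, Φ (c • χ) = c * Φ χ := by
    intro c χ
    refine tendsto_nhds_unique (hΦ (c • χ)) (((hΦ χ).const_mul c).congr fun n => ?_)
    have e1 : conv (G n) (c • χ : Lp ℂ ⊤ (volume : Measure ℝ)) = conv (G n) (fun x => c * χ x) :=
      conv_congr (Lp.coeFn_smul c χ)
    simp only [L]
    rw [e1, conv_smul_right]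
  have hnorm : ∀ χ, ‖Φ χ‖ ≤ 1 * ‖χ‖ := by
    intro χ
    rw [one_mul]
    exact le_of_tendsto (hΦ χ).norm (Eventually.of_forall fun n => hLb n χ)
  let Φl : Lp ℂ ⊤ (volume : Measure ℝ) →ₗ[ℂ] ℂ :=
    { toFun := Φ, map_add' := hadd, map_smul' := hsmul }
  let φ : Lp ℂ ⊤ (volume : Measure ℝ) →L[ℂ] ℂ := Φl.mkContinuous 1 hnorm
  have hφ : ∀ χ, φ χ = Φ χ := fun χ => rfl
  have hmean : IsMean φ := by
    refine ⟨fun χ hχ => ?_, fun χ hχ => ?_⟩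
    · have hn : ∀ n, 0 ≤ (L n χ).re ∧ (L n χ).im = 0 := by
        intro n
        have := conv_pos (f := fun t => rs n * F (rs n * t))
          (fun t => mul_nonneg (rs_pos n).le (hF0 _)) hχ (x n)
        rw [← hGr n] at this
        exact this
      rw [hφ]
      constructor
      · exact ge_of_tendsto ((Complex.continuous_re.tendsto _).comp (hΦ χ))
          (Eventually.of_forall fun n => (hn n).1)
      · refine tendsto_nhds_unique ((Complex.continuous_im.tendsto _).comp (hΦ χ)) ?_
        refine tendsto_const_nhds.congr fun n => ?_
        exact (hn n).2.symm
    · rw [hφ]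
      refine tendsto_nhds_unique (hΦ χ) (tendsto_const_nhds.congr fun n => ?_)
      simp only [L]
      rw [conv_congr hχ]
      simp [conv, hG1]
  have hinv : IsTopologicallyInvariant φ := by
    intro f hf _ hf1 χ g hg
    rw [hφ, hφ, ← sub_eq_zero]
    refine tendsto_nhds_unique ((hΦ g).sub (hΦ χ)) ?_
    have hfc1 : ∫ t, (f t : ℂ) = 1 := by rw [integral_complex_ofReal, hf1]; simp
    have := (diff_tendsto (f := fun t => (f t : ℂ)) hf.ofReal hfc1 hFc (Linf_aesm χ)
      (Linf_bound χ) x).mono_left hU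
    refine this.congr fun n => ?_
    simp only [L]
    rw [conv_congr (f := G n) hg]
    rfl
  have h0 := h φ hmean hinv
  rw [hφ] at h0
  have : ε ≤ ‖Φ ψ‖ := ge_of_tendsto (hΦ ψ).norm (Eventually.of_forall fun n => (hx n).le)
  rw [h0, norm_zero] at this
  linarith

lemma exists_scale (ψ : Lp ℂ ⊤ (volume : Measure ℝ))
    (h : ∀ φ : Lp ℂ ⊤ (volume : Measure ℝ) →L[ℂ] ℂ,
        IsMean φ → IsTopologicallyInvariant φ → φ ψ = 0) {K : ℝ → ℂ} (hK : Integrable K)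
    {ε : ℝ} (hε : 0 < ε) :
    ∃ r > 0, ∀ x, ‖conv (dil r K) ψ x‖ ≤ ε := by
  set A := ∫ t, ‖K t‖
  have hA : 0 ≤ A := integral_nonneg fun _ => norm_nonneg _
  obtain ⟨F, hFi, hF1, hF⟩ := exists_small ψ h (ε := ε / (2 * (A + 1))) (by positivity)
  have hlim := (asymp hFi hF1 hK).mul_const ‖ψ‖
  rw [zero_mul] at hlim
  obtain ⟨n, hn⟩ := (hlim.eventually (gt_mem_nhds (half_pos hε))).exists
  refine ⟨rs n, rs_pos n, fun x => ?_⟩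
  have h1 := diff_bound hFi (dil_integrable (rs_pos n) hK) (Linf_aesm ψ) (Linf_bound ψ) x
  have h2 := conv_bound (dil_integrable (rs_pos n) hK)
    (Eventually.of_forall hF : ∀ᵐ x, ‖conv F ψ x‖ ≤ ε / (2 * (A + 1))) x
  rw [dil_integral_norm (rs_pos n)] at h2
  have h3 : A * (ε / (2 * (A + 1))) ≤ ε / 2 := by
    rw [← mul_div_assoc, div_le_div_iff₀ (by positivity) (by positivity)]
    nlinarith
  have h4 := norm_sub_rev (conv (dil (rs n) K) (conv F ψ) x) (conv (dil (rs n) K) ψ x)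
  have h5 := norm_le_norm_add_norm_sub' (conv (dil (rs n) K) ψ x) (conv (dil (rs n) K) (conv F ψ) x)
  change _ ≤ A * _ at h2
  linarith

open FourierTransform SchwartzMap

lemma exists_schwartz_pair : ∃ g K : ℝ → ℂ, Integrable g ∧ Integrable K ∧ conv g K = g ∧
    ∀ l : ℝ, |l| < 1 → fourierT g l ≠ 0 := by
  let b1 : ContDiffBump (0 : ℝ) := ⟨1, 2, by norm_num, by norm_num⟩
  let b2 : ContDiffBump (0 : ℝ) := ⟨2, 3, by norm_num, by norm_num⟩
  have key : ∀ b : ContDiffBump (0 : ℝ), ∃ S : 𝓢(ℝ, ℂ), ∀ x, S x = ((b x : ℝ) : ℂ) := by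
    intro b
    have hs : HasCompactSupport (fun x => ((b x : ℝ) : ℂ)) :=
      b.hasCompactSupport.comp_left (g := fun y : ℝ => (y : ℂ)) (by simp)
    have hd : ContDiff ℝ (⊤ : ℕ∞) (fun x => ((b x : ℝ) : ℂ)) :=
      Complex.ofRealCLM.contDiff.comp b.contDiff
    exact ⟨hs.toSchwartzMap hd, fun x => rfl⟩
  obtain ⟨B1, hB1⟩ := key b1
  obtain ⟨B2, hB2⟩ := key b2
  let g : 𝓢(ℝ, ℂ) := 𝓕⁻ B1
  let K : 𝓢(ℝ, ℂ) := 𝓕⁻ B2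
  refine ⟨g, K, g.integrable, K.integrable, ?_, ?_⟩
  · funext x
    have h := SchwartzMap.convolution_apply (ContinuousLinearMap.mul ℂ ℂ) g K x
    have h2 : SchwartzMap.convolution (ContinuousLinearMap.mul ℂ ℂ) g K = g := by
      have h3 := SchwartzMap.fourier_convolution (ContinuousLinearMap.mul ℂ ℂ) g K
      have h4 : SchwartzMap.pairing (ContinuousLinearMap.mul ℂ ℂ) (𝓕 g) (𝓕 K) = B1 := by
        ext y
        simp only [g, K, FourierTransform.fourier_fourierInv_eq]
        rw [SchwartzMap.pairing_apply_apply, ContinuousLinearMap.mul_apply', hB1, hB2]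
        by_cases hy : y ∈ Metric.ball (0 : ℝ) 2
        · rw [b2.one_of_mem_closedBall (Metric.ball_subset_closedBall hy)]; simp
        · rw [b1.zero_of_le_dist (by simpa using hy)]; simp
      rw [h4] at h3
      have h5 := congrArg (fun S : 𝓢(ℝ, ℂ) => (𝓕⁻ S : 𝓢(ℝ, ℂ))) h3
      simp only [FourierTransform.fourierInv_fourier_eq] at h5
      exact h5
    rw [h2] at h
    exact h.symm
  · intro l hl
    have e : fourierT g l = (𝓕 g : 𝓢(ℝ, ℂ)) (l / (2 * Real.pi)) := by
      rw [SchwartzMap.fourier_coe, Real.fourier_eq']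
      unfold fourierT
      congr 1; funext x
      rw [smul_eq_mul, mul_comm]
      congr 2
      simp only [RCLike.inner_apply, conj_trivial]
      have : (Real.pi : ℂ) ≠ 0 := by exact_mod_cast Real.pi_ne_zero
      push_cast
      field_simp
    rw [e]
    simp only [g, FourierTransform.fourier_fourierInv_eq]
    rw [hB1, b1.one_of_mem_closedBall]
    · simp
    · have hp := Real.pi_gt_three
      simp only [Metric.mem_closedBall, dist_zero_right, Real.norm_eq_abs, b1]
      rw [abs_div, abs_of_pos (by positivity : 0 < 2 * Real.pi), div_le_one (by positivity)]
      linarith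

lemma mkLp {f ψ : ℝ → ℂ} {M : ℝ} (hf : Integrable f)
    (hψ : AEStronglyMeasurable ψ) (hM : ∀ᵐ x, ‖ψ x‖ ≤ M) :
    ∃ χ : Lp ℂ ⊤ (volume : Measure ℝ), χ =ᵐ[volume] conv f ψ := by
  have : MemLp (conv f ψ) ⊤ volume := memLp_top_of_bound (conv_aesm hf.1 hψ) _ (conv_ae_bound hf hM)
  exact ⟨this.toLp _, this.coeFn_toLp⟩

lemma forward (ψ : Lp ℂ ⊤ (volume : Measure ℝ))
    (h : ∀ φ : Lp ℂ ⊤ (volume : Measure ℝ) →L[ℂ] ℂ,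
        IsMean φ → IsTopologicallyInvariant φ → φ ψ = 0) {ε : ℝ} (hε : 0 < ε) :
    ∃ ψ₁ : Lp ℂ ⊤ (volume : Measure ℝ), ∃ δ > (0 : ℝ),
      spectrumOf (⇑ψ₁) ∩ Set.Ioo (-δ) δ = ∅ ∧ ‖ψ - ψ₁‖ ≤ ε := by
  obtain ⟨g, K, hg, hK, hgK, hgl⟩ := exists_schwartz_pair
  obtain ⟨r, hr, hsmall⟩ := exists_scale ψ h hK hε
  have hKr := dil_integrable hr hK
  have hgr := dil_integrable hr hg
  obtain ⟨χ, hχ⟩ := mkLp hKr (Linf_aesm ψ) (Linf_bound ψ)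
  refine ⟨ψ - χ, r, hr, ?_, ?_⟩
  · rw [Set.eq_empty_iff_forall_notMem]
    rintro l ⟨hl, hl1, hl2⟩
    have hmem : dil r g ∈ Jset (ψ - χ : Lp ℂ ⊤ (volume : Measure ℝ)) := by
      refine ⟨hgr, ?_⟩
      have e1 : conv (dil r g) (ψ - χ : Lp ℂ ⊤ (volume : Measure ℝ))
          = conv (dil r g) (fun x => ψ x - conv (dil r K) ψ x) := by
        refine conv_congr ?_
        filter_upwards [Lp.coeFn_sub ψ χ, hχ] with x h1 h2
        rw [h1, Pi.sub_apply, h2]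
      rw [e1, conv_sub_right hgr (Linf_aesm ψ) (Linf_bound ψ) (conv_aesm hKr.1 (Linf_aesm ψ))
        (conv_ae_bound hKr (Linf_bound ψ)), ← conv_assoc hgr hKr (Linf_aesm ψ) (Linf_bound ψ),
        dil_conv hr, hgK]
      simp only [sub_self]
      rfl
    have h0 : fourierT (dil r g) l = 0 := by
      have := Set.mem_iInter₂.1 hl (dil r g) hmem
      exact this
    rw [dil_fourierT hr] at h0
    refine hgl _ ?_ h0
    rw [abs_div, abs_of_pos hr, div_lt_one hr, abs_lt]
    exact ⟨hl1, hl2⟩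
  · rw [sub_sub_cancel]
    refine Linf_norm_le _ hε.le ?_
    filter_upwards [hχ] with x hx
    rw [hx]
    exact hsmall x

/-! ### Converse -/

lemma mean_conv_nonneg {φ : Lp ℂ ⊤ (volume : Measure ℝ) →L[ℂ] ℂ} 
    (hφ : IsTopologicallyInvariant φ) {f : ℝ → ℝ} (hf : Integrable f) (hf0 : 0 ≤ᵐ[volume] f)
    (ψ g : Lp ℂ ⊤ (volume : Measure ℝ)) (hg : g =ᵐ[volume] conv (fun t => (f t : ℂ)) ψ) :
    φ g = (∫ t, (f t : ℂ)) * φ ψ := by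
  rw [integral_complex_ofReal]
  rcases (integral_nonneg_of_ae hf0).eq_or_lt with h0 | hpos
  · rw [← h0]
    have hz := (integral_eq_zero_iff_of_nonneg_ae hf0 hf).1 h0.symm
    have hg0 : g = 0 := by
      rw [Lp.eq_zero_iff_ae_eq_zero]
      filter_upwards [hg] with x hx
      rw [hx]
      refine integral_eq_zero_of_ae ?_
      filter_upwards [hz] with t ht
      simp [ht]
    simp [hg0]
  · set c := ∫ t, f t
    have hc : (c : ℂ) ≠ 0 := by exact_mod_cast hpos.ne'
    have := hφ (fun t => c⁻¹ * f t) (hf.const_mul _) ?_ ?_ ψ (((c : ℂ)⁻¹) • g) ?_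
    · rw [map_smul, smul_eq_mul] at this
      rw [← this]; field_simp
    · filter_upwards [hf0] with t ht
      exact mul_nonneg (by positivity) ht
    · rw [integral_const_mul]; exact inv_mul_cancel₀ hpos.ne'
    · filter_upwards [Lp.coeFn_smul ((c : ℂ)⁻¹) g, hg] with x h1 h2
      rw [h1, Pi.smul_apply, h2, smul_eq_mul]
      rw [← congrFun (conv_smul_left ((c : ℂ)⁻¹) (fun t => (f t : ℂ)) ψ) x]
      simp only [conv]
      push_cast
      rfl

lemma mean_conv_real {φ : Lp ℂ ⊤ (volume : Measure ℝ) →L[ℂ] ℂ} 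
    (hφ : IsTopologicallyInvariant φ) {f : ℝ → ℝ} (hf : Integrable f)
    (ψ g : Lp ℂ ⊤ (volume : Measure ℝ)) (hg : g =ᵐ[volume] conv (fun t => (f t : ℂ)) ψ) :
    φ g = (∫ t, (f t : ℂ)) * φ ψ := by
  have hp : Integrable (fun t => max (f t) 0) := hf.pos_part
  have hn : Integrable (fun t => max (-f t) 0) := hf.neg_part
  have hpc : Integrable (fun t => ((max (f t) 0 : ℝ) : ℂ)) := hp.ofReal
  have hnc : Integrable (fun t => ((max (-f t) 0 : ℝ) : ℂ)) := hn.ofReal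
  obtain ⟨gp, hgp⟩ := mkLp hpc (Linf_aesm ψ) (Linf_bound ψ)
  obtain ⟨gn, hgn⟩ := mkLp hnc (Linf_aesm ψ) (Linf_bound ψ)
  have hfe : (fun t => (f t : ℂ)) = fun t => ((max (f t) 0 : ℝ) : ℂ) - ((max (-f t) 0 : ℝ) : ℂ) := by
    funext t
    rw [← Complex.ofReal_sub]
    congr 1
    rcases le_total 0 (f t) with h | h
    · rw [max_eq_left h, max_eq_right (by linarith)]; ring
    · rw [max_eq_right h, max_eq_left (by linarith)]; ring
  have hge : g = gp - gn := by
    refine Lp.ext ?_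
    filter_upwards [hg, hgp, hgn, Lp.coeFn_sub gp gn] with x h1 h2 h3 h4
    rw [h1, h4, Pi.sub_apply, h2, h3, hfe, conv_sub_left hpc hnc (Linf_aesm ψ) (Linf_bound ψ)]
  rw [hge, map_sub, hfe, integral_sub hpc hnc,
    mean_conv_nonneg hφ hp (Eventually.of_forall fun t => le_max_right _ _) ψ gp hgp,
    mean_conv_nonneg hφ hn (Eventually.of_forall fun t => le_max_right _ _) ψ gn hgn]
  ring

lemma mean_conv {φ : Lp ℂ ⊤ (volume : Measure ℝ) →L[ℂ] ℂ} 
    (hφ : IsTopologicallyInvariant φ) {f : ℝ → ℂ} (hf : Integrable f)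
    (ψ g : Lp ℂ ⊤ (volume : Measure ℝ)) (hg : g =ᵐ[volume] conv f ψ) :
    φ g = (∫ t, f t) * φ ψ := by
  have hp : Integrable (fun t => (f t).re) := hf.re
  have hn : Integrable (fun t => (f t).im) := hf.im
  have hpc : Integrable (fun t => ((f t).re : ℂ)) := hp.ofReal
  have hnc : Integrable (fun t => ((f t).im : ℂ)) := hn.ofReal
  have hnc' : Integrable (fun t => Complex.I * ((f t).im : ℂ)) := hnc.const_mul _
  obtain ⟨gp, hgp⟩ := mkLp hpc (Linf_aesm ψ) (Linf_bound ψ)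
  obtain ⟨gn, hgn⟩ := mkLp hnc (Linf_aesm ψ) (Linf_bound ψ)
  have hfe : f = fun t => ((f t).re : ℂ) + Complex.I * ((f t).im : ℂ) := by
    funext t
    rw [mul_comm, Complex.re_add_im]
  have hge : g = gp + Complex.I • gn := by
    refine Lp.ext ?_
    filter_upwards [hg, hgp, hgn, Lp.coeFn_add gp (Complex.I • gn), Lp.coeFn_smul Complex.I gn]
      with x h1 h2 h3 h4 h5
    rw [h1, h4, Pi.add_apply, h5, Pi.smul_apply, h2, h3, hfe,
      conv_add_left hpc hnc' (Linf_aesm ψ) (Linf_bound ψ), conv_smul_left]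
    simp
  have hint : ∫ t, f t = (∫ t, ((f t).re : ℂ)) + Complex.I * ∫ t, ((f t).im : ℂ) := by
    rw [← integral_const_mul, ← integral_add hpc hnc']
    exact congrArg _ hfe
  rw [hge, map_add, map_smul, hint, mean_conv_real hφ hp ψ gp hgp, mean_conv_real hφ hn ψ gn hgn,
    smul_eq_mul]
  ring

lemma mean_zero_of_spectrum {φ : Lp ℂ ⊤ (volume : Measure ℝ) →L[ℂ] ℂ} 
    (hφ : IsTopologicallyInvariant φ) (ψ : Lp ℂ ⊤ (volume : Measure ℝ)) {δ : ℝ} (hδ : 0 < δ)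
    (h : spectrumOf (⇑ψ) ∩ Set.Ioo (-δ) δ = ∅) : φ ψ = 0 := by
  have h0 : (0 : ℝ) ∉ spectrumOf (⇑ψ) := fun hmem =>
    (Set.eq_empty_iff_forall_notMem.1 h) 0 ⟨hmem, by simpa using hδ, hδ⟩
  simp only [spectrumOf, Set.mem_iInter, not_forall] at h0
  obtain ⟨f, ⟨hf, hconv⟩, hne⟩ := h0
  have hne' : ∫ t, f t ≠ 0 := by
    simpa [fourierT] using hne
  have hz : (0 : Lp ℂ ⊤ (volume : Measure ℝ)) =ᵐ[volume] conv f ψ := by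
    filter_upwards [Lp.coeFn_zero ℂ ⊤ (volume : Measure ℝ), hconv] with x h1 h2
    rw [h1, h2]; rfl
  have := mean_conv hφ hf ψ 0 hz
  rw [map_zero] at this
  exact (mul_eq_zero.1 this.symm).resolve_left hne'

/-- `ψ ∈ L^∞(ℝ)` is annihilated by every topologically invariant mean iff `ψ` can be
approximated in the `L^∞` norm by elements whose spectrum avoids a neighborhood of
`0`. -/
theorem almostConvergentZero_iff_approx_spectrum_away_from_zero
    (ψ : Lp ℂ ⊤ (volume : Measure ℝ)) :
    (∀ φ : Lp ℂ ⊤ (volume : Measure ℝ) →L[ℂ] ℂ,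
        IsMean φ → IsTopologicallyInvariant φ → φ ψ = 0) ↔
    (∀ ε > (0 : ℝ), ∃ ψ₁ : Lp ℂ ⊤ (volume : Measure ℝ), ∃ δ > (0 : ℝ),
      spectrumOf (⇑ψ₁) ∩ Set.Ioo (-δ) δ = ∅ ∧ ‖ψ - ψ₁‖ ≤ ε) := by
  constructor
  · intro h ε hε
    exact forward ψ h hε
  · intro h φ _ hφ
    rw [← norm_le_zero_iff]
    refine le_of_forall_pos_le_add fun η hη => ?_
    obtain ⟨ψ₁, δ, hδ, hsp, hn⟩ := h (η / (‖φ‖ + 1)) (by positivity)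
    have h1 := mean_zero_of_spectrum hφ ψ₁ hδ hsp
    have h2 : φ ψ = φ (ψ - ψ₁) := by rw [map_sub, h1, sub_zero]
    rw [h2, zero_add]
    calc ‖φ (ψ - ψ₁)‖ ≤ ‖φ‖ * ‖ψ - ψ₁‖ := φ.le_opNorm _
      _ ≤ (‖φ‖ + 1) * (η / (‖φ‖ + 1)) := by gcongr; linarith
      _ = η := by field_simp
end

section
/- Let ν be a finite Borel measure on ℝ and g : ℝ → ℂ a ν-integrable function, and define ψ(x) = ∫_ℝ e^{iλx} g(λ) dν(λ) for x ∈ ℝ. Then ψ is almost convergent to g(0)·ν({0}), i.e., lim_{θ→∞} (1/(2θ)) ∫_{x−θ}^{x+θ} ψ(t) dt = g(0)·ν({0}) uniformly in x ∈ ℝ. -/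
open MeasureTheory

lemma fsac_kernel_bound (θ : ℝ) (hθ : 0 < θ) (x l : ℝ) :
    ‖((1 / (2 * θ) : ℝ) : ℂ) * (∫ t in (x - θ)..(x + θ), Complex.exp (Complex.I * l * t)) -
      (if l = 0 then 1 else 0)‖ ≤ if l = 0 then 0 else min 1 (1 / (|l| * θ)) := by
  have hn : ‖((1 / (2 * θ) : ℝ) : ℂ)‖ = 1 / (2 * θ) := by
    rw [Complex.norm_real, Real.norm_of_nonneg (by positivity)]
  have he : ∀ t : ℝ, ‖Complex.exp (Complex.I * l * t)‖ = 1 := by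
    intro t
    have : Complex.I * l * t = ((l * t : ℝ) : ℂ) * Complex.I := by push_cast; ring
    rw [this, Complex.norm_exp_ofReal_mul_I]
  by_cases hl : l = 0
  · subst hl
    have hc : (θ : ℂ) ≠ 0 := by exact_mod_cast hθ.ne'
    have : ((1 / (2 * θ) : ℝ) : ℂ) * (2 * θ) = 1 := by push_cast; field_simp
    simp only [Complex.ofReal_zero, mul_zero, zero_mul, Complex.exp_zero, if_true]
    rw [intervalIntegral.integral_const]
    have h2 : (x + θ - (x - θ)) • (1 : ℂ) = 2 * θ := by
      rw [Complex.real_smul]; push_cast; ring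
    rw [h2, this]; simp
  · simp only [hl, if_false, sub_zero]
    rw [norm_mul, hn]
    refine le_min ?_ ?_
    · have := intervalIntegral.norm_integral_le_of_norm_le_const (a := x - θ) (b := x + θ)
        (f := fun t : ℝ => Complex.exp (Complex.I * l * t)) (C := 1) (fun t _ => (he t).le)
      have h3 : |x + θ - (x - θ)| = 2 * θ := by
        rw [abs_of_nonneg] <;> linarith
      rw [h3, one_mul] at this
      rw [one_div, inv_mul_le_iff₀ (by positivity)]
      linarith
    · have hc : Complex.I * (l : ℂ) ≠ 0 := mul_ne_zero Complex.I_ne_zero (by exact_mod_cast hl)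
      rw [integral_exp_mul_complex hc, norm_div, norm_mul, Complex.norm_I, one_mul,
        Complex.norm_real, Real.norm_eq_abs]
      have h4 := norm_sub_le (Complex.exp (Complex.I * l * (x + θ : ℝ)))
        (Complex.exp (Complex.I * l * (x - θ : ℝ)))
      rw [he, he] at h4
      have hp : 0 < |l| := abs_pos.mpr hl
      calc _ ≤ 1 / (2 * θ) * ((1 + 1) / |l|) := by gcongr
        _ = _ := by field_simp; norm_num

/-- The inverse Fourier–Stieltjes transform `ψ(x) = ∫ e^{iλx} g(λ) dν(λ)` of the
complex measure `μ = g dν` (`ν` a finite Borel measure, `g` ν-integrable) is almost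
convergent to `μ({0}) = g(0)·ν({0})`. -/
theorem fourierStieltjes_almostConvergent
    (ν : Measure ℝ) [IsFiniteMeasure ν] (g : ℝ → ℂ) (hg : Integrable g ν)
    (ψ : ℝ → ℂ)
    (hψ : ∀ x : ℝ, ψ x = ∫ l, Complex.exp (Complex.I * l * x) * g l ∂ν) :
    ∀ ε > (0 : ℝ), ∃ Θ : ℝ, ∀ θ : ℝ, Θ ≤ θ → ∀ x : ℝ,
      ‖((1 / (2 * θ) : ℝ) : ℂ) * (∫ t in (x - θ)..(x + θ), ψ t) -
          g 0 * ((ν {0}).toReal : ℂ)‖ < ε := by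
  have hlim : Filter.Tendsto
      (fun θ : ℝ => ∫ l, (if l = 0 then 0 else min 1 (1 / (|l| * θ))) * ‖g l‖ ∂ν)
      Filter.atTop (nhds (∫ _l, (0 : ℝ) ∂ν)) := by
    refine tendsto_integral_filter_of_dominated_convergence (fun l => ‖g l‖) ?_ ?_ hg.norm ?_
    · refine Filter.Eventually.of_forall fun θ => ?_
      refine AEStronglyMeasurable.mul (Measurable.aestronglyMeasurable ?_) hg.1.norm
      exact Measurable.ite (measurableSet_singleton 0) measurable_const (by fun_prop)
    · filter_upwards [Filter.eventually_gt_atTop 0] with θ hθ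
      refine Filter.Eventually.of_forall fun l => ?_
      have h0 : 0 ≤ (if l = 0 then 0 else min 1 (1 / (|l| * θ)) : ℝ) := by
        split_ifs <;> positivity
      have h1 : (if l = 0 then 0 else min 1 (1 / (|l| * θ)) : ℝ) ≤ 1 := by
        split_ifs
        · norm_num
        · exact min_le_left _ _
      rw [norm_mul, norm_norm, Real.norm_of_nonneg h0]
      exact mul_le_of_le_one_left (norm_nonneg _) h1
    · refine Filter.Eventually.of_forall fun l => ?_
      by_cases hl : l = 0
      · simp [hl]
      · simp only [hl, if_false]
        have hp : 0 < |l| := abs_pos.mpr hl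
        have h1 : Filter.Tendsto (fun θ : ℝ => 1 / (|l| * θ)) Filter.atTop (nhds 0) := by
          simp only [one_div]
          exact (Filter.tendsto_id.const_mul_atTop hp).inv_tendsto_atTop
        have h2 := (Filter.Tendsto.min (tendsto_const_nhds (x := (1 : ℝ))) h1).mul_const ‖g l‖
        simpa using h2
  rw [integral_zero] at hlim
  intro ε hε
  obtain ⟨Θ, hΘ⟩ := Filter.eventually_atTop.mp
    ((hlim.eventually (gt_mem_nhds hε)).and (Filter.eventually_gt_atTop 0))
  refine ⟨Θ, fun θ hθ x => ?_⟩
  obtain ⟨hlt, hpos⟩ := hΘ θ hθ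
  refine lt_of_le_of_lt ?_ hlt
  set E : ℝ → ℝ → ℂ := fun t l => Complex.exp (Complex.I * l * t) * g l with hE
  haveI : IsFiniteMeasure ((volume : Measure ℝ).restrict (Set.uIoc (x - θ) (x + θ))) := by
    rw [Set.uIoc_of_le (by linarith)]
    infer_instance
  have hint : Integrable (Function.uncurry E)
      ((volume.restrict (Set.uIoc (x - θ) (x + θ))).prod ν) := by
    have hg2 : Integrable (fun p : ℝ × ℝ => g p.2)
        ((volume.restrict (Set.uIoc (x - θ) (x + θ))).prod ν) := hg.comp_snd _
    refine hg2.bdd_mul (c := 1) (f := fun p : ℝ × ℝ => Complex.exp (Complex.I * p.2 * p.1)) ?_ ?_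
    · exact Continuous.aestronglyMeasurable (by fun_prop)
    · refine Filter.Eventually.of_forall fun p => ?_
      have : Complex.I * p.2 * p.1 = ((p.2 * p.1 : ℝ) : ℂ) * Complex.I := by push_cast; ring
      rw [this, Complex.norm_exp_ofReal_mul_I]
  have hswap : ∫ t in (x - θ)..(x + θ), ψ t = ∫ l, (∫ t in (x - θ)..(x + θ), E t l) ∂ν := by
    simp only [hψ]
    exact intervalIntegral_integral_swap hint
  have hK : ∀ l, (∫ t in (x - θ)..(x + θ), E t l)
      = (∫ t in (x - θ)..(x + θ), Complex.exp (Complex.I * l * t)) * g l := fun l =>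
    intervalIntegral.integral_mul_const _ _
  have hKi : Integrable (fun l => ∫ t in (x - θ)..(x + θ), E t l) ν := by
    have := hint.integral_prod_right
    rw [Set.uIoc_of_le (by linarith)] at this
    simp only [intervalIntegral.integral_of_le (show x - θ ≤ x + θ by linarith)]
    exact this
  have hpt : g 0 * ((ν {0}).toReal : ℂ) = ∫ l, (if l = 0 then 1 else 0) * g l ∂ν := by
    have : (fun l : ℝ => (if l = 0 then 1 else 0) * g l) = Set.indicator {0} g := by
      funext l
      by_cases hl : l = 0 <;> simp [hl]
    rw [this, integral_indicator (measurableSet_singleton 0), integral_singleton,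
      Complex.real_smul, mul_comm]
    rfl
  have hpi : Integrable (fun l : ℝ => (if l = 0 then 1 else 0) * g l) ν := by
    have : (fun l : ℝ => (if l = 0 then 1 else 0) * g l) = Set.indicator {0} g := by
      funext l
      by_cases hl : l = 0 <;> simp [hl]
    rw [this]
    exact hg.indicator (measurableSet_singleton 0)
  rw [hswap, hpt, ← integral_const_mul, ← integral_sub (hKi.const_mul _) hpi]
  refine norm_integral_le_of_norm_le ?_ (Filter.Eventually.of_forall fun l => ?_)
  · refine hg.norm.bdd_mul (c := 1) (Measurable.aestronglyMeasurable ?_)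
      (Filter.Eventually.of_forall fun l => ?_)
    · exact Measurable.ite (measurableSet_singleton 0) measurable_const (by fun_prop)
    · have h0 : 0 ≤ (if l = 0 then 0 else min 1 (1 / (|l| * θ)) : ℝ) := by
        split_ifs <;> positivity
      rw [Real.norm_of_nonneg h0]
      split_ifs
      · norm_num
      · exact min_le_left _ _
  · rw [hK, ← mul_assoc, ← sub_mul, norm_mul]
    exact mul_le_mul_of_nonneg_right (fsac_kernel_bound θ hpos x l) (norm_nonneg _)
end

section
/- A mean φ on L^∞(ℝ) belongs to 𝒯₊ (i.e., φ is a topologically invariant mean that vanishes on every ψ ∈ L^∞(ℝ) with essential limit 0 at +∞) if and only if φ(ψ) ≤ p̄₊(ψ) := limsup_{θ→∞} sup_{x ≥ 0} (1/θ) ∫_{x}^{x+θ} ψ(t) dt holds for every real-valued ψ ∈ L^∞(ℝ). -/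
open MeasureTheory Filter

/-- `ψ ∈ L^∞(ℝ)` has essential limit `0` at `+∞`, i.e. `ψ ∈ L^∞_{0,+}(ℝ)`. -/
def VanishesAtPosInfty (ψ : Lp ℂ ⊤ (volume : Measure ℝ)) : Prop :=
  ∀ ε > (0 : ℝ), ∃ R : ℝ, ∀ᵐ x ∂(volume : Measure ℝ), R < x → ‖ψ x‖ < ε

/-- `p̄₊(ψ) = limsup_{θ→∞} sup_{x ≥ 0} (1/θ) ∫_x^{x+θ} ψ(t) dt` for real-valued `ψ`. -/
noncomputable def pbarPlus (ψ : ℝ → ℝ) : ℝ :=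
  limsup (fun θ : ℝ =>
    ⨆ x : {x : ℝ // 0 ≤ x}, (1 / θ) * ∫ t in (x : ℝ)..((x : ℝ) + θ), ψ t) atTop

/-- Elements of `L^∞` are a.e. bounded. -/
lemma exists_bound (ψ : Lp ℂ ⊤ (volume : Measure ℝ)) :
    ∃ M : ℝ, 0 ≤ M ∧ ∀ᵐ x ∂(volume : Measure ℝ), ‖ψ x‖ ≤ M := by
  have h := (Lp.memLp ψ).2
  rw [eLpNorm_exponent_top] at h
  refine ⟨(eLpNormEssSup ψ volume).toReal, ENNReal.toReal_nonneg, ?_⟩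
  filter_upwards [ae_le_eLpNormEssSup (f := (ψ : ℝ → ℂ)) (μ := volume)] with x hx
  have := ENNReal.toReal_mono h.ne hx
  simpa using this

lemma intervalIntegrable_of_bound {E : Type*} [NormedAddCommGroup E] {u : ℝ → E} {M : ℝ}
    (hu : AEStronglyMeasurable u volume) (hb : ∀ᵐ x ∂(volume : Measure ℝ), ‖u x‖ ≤ M)
    (a b : ℝ) : IntervalIntegrable u volume a b := by
  rw [intervalIntegrable_iff]
  refine Measure.integrableOn_of_bounded (M := M) ?_ hu (ae_restrict_of_ae hb)
  simp [Set.uIoc]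

lemma avg_bound {E : Type*} [NormedAddCommGroup E] [NormedSpace ℝ E] {u : ℝ → E} {M : ℝ}
    (hb : ∀ᵐ x ∂(volume : Measure ℝ), ‖u x‖ ≤ M) {θ : ℝ} (hθ : 0 < θ) (x : ℝ) :
    ‖(1 / θ) • ∫ t in x..(x + θ), u t‖ ≤ M := by
  have h := intervalIntegral.norm_integral_le_of_norm_le_const_ae (a := x) (b := x + θ)
    (f := u) (C := M) (hb.mono fun y hy _ => hy)
  rw [norm_smul, Real.norm_of_nonneg (by positivity)]
  rw [add_sub_cancel_left, abs_of_pos hθ] at h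
  rw [one_div, inv_mul_le_iff₀ hθ]
  linarith

/-- The supremum in the definition of `pbarPlus`. -/
noncomputable def supAvg (u : ℝ → ℝ) (θ : ℝ) : ℝ :=
  ⨆ x : {x : ℝ // 0 ≤ x}, (1 / θ) * ∫ t in (x : ℝ)..((x : ℝ) + θ), u t

lemma supAvg_bdd {u : ℝ → ℝ} {M : ℝ} (hb : ∀ᵐ x ∂(volume : Measure ℝ), ‖u x‖ ≤ M)
    {θ : ℝ} (hθ : 0 < θ) :
    BddAbove (Set.range fun x : {x : ℝ // 0 ≤ x} =>
      (1 / θ) * ∫ t in (x : ℝ)..((x : ℝ) + θ), u t) := by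
  refine ⟨M, ?_⟩
  rintro _ ⟨x, rfl⟩
  exact (Real.le_norm_self _).trans (avg_bound hb hθ x)

lemma supAvg_abs_le {u : ℝ → ℝ} {M : ℝ} (hb : ∀ᵐ x ∂(volume : Measure ℝ), ‖u x‖ ≤ M)
    {θ : ℝ} (hθ : 0 < θ) : -M ≤ supAvg u θ ∧ supAvg u θ ≤ M := by
  have : Nonempty {x : ℝ // 0 ≤ x} := ⟨⟨0, le_rfl⟩⟩
  constructor
  · refine le_trans ?_ (le_ciSup (supAvg_bdd hb hθ) ⟨0, le_rfl⟩)
    exact (abs_le.1 (avg_bound hb hθ 0)).1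
  · exact ciSup_le fun x => (Real.le_norm_self _).trans (avg_bound hb hθ x)

lemma pbarPlus_le {u : ℝ → ℝ} {M c : ℝ} (hb : ∀ᵐ x ∂(volume : Measure ℝ), ‖u x‖ ≤ M)
    (h : ∀ᶠ θ : ℝ in atTop, ∀ x : ℝ, 0 ≤ x → (1 / θ) * ∫ t in x..(x + θ), u t ≤ c) :
    pbarPlus u ≤ c := by
  have : Nonempty {x : ℝ // 0 ≤ x} := ⟨⟨0, le_rfl⟩⟩
  refine limsup_le_of_le ?_ ?_
  · refine IsBoundedUnder.isCoboundedUnder_le ?_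
    refine ⟨-M, ?_⟩
    rw [eventually_map]
    filter_upwards [eventually_gt_atTop 0] with θ hθ
    exact (supAvg_abs_le hb hθ).1
  · filter_upwards [h] with θ hθ
    exact ciSup_le fun x => hθ x x.2

lemma le_pbarPlus {u : ℝ → ℝ} {M c : ℝ} (hb : ∀ᵐ x ∂(volume : Measure ℝ), ‖u x‖ ≤ M)
    (h : ∀ θ : ℝ, 0 < θ → c ≤ supAvg u θ) : c ≤ pbarPlus u := by
  refine le_limsup_of_frequently_le ?_ ?_
  · refine Eventually.frequently ?_
    filter_upwards [eventually_gt_atTop 0] with θ hθ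
    exact h θ hθ
  · refine ⟨M, ?_⟩
    rw [eventually_map]
    filter_upwards [eventually_gt_atTop 0] with θ hθ
    exact (supAvg_abs_le hb hθ).2

/-- Means are real on real-valued functions. -/
lemma mean_real {φ : Lp ℂ ⊤ (volume : Measure ℝ) →L[ℂ] ℂ} (hφ : IsMean φ)
    (ψ : Lp ℂ ⊤ (volume : Measure ℝ)) (h : ∀ᵐ x ∂(volume : Measure ℝ), (ψ x).im = 0) :
    (φ ψ).im = 0 := by
  obtain ⟨M, hM, hb⟩ := exists_bound ψ
  have hone : MemLp (fun _ : ℝ => (1 : ℂ)) ⊤ (volume : Measure ℝ) := memLp_top_const 1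
  set e := hone.toLp _ with he
  have he1 : (⇑e : ℝ → ℂ) =ᵐ[volume] (fun _ => 1) := hone.coeFn_toLp
  have h1 := hφ.2 e he1
  have h2 := (hφ.1 (ψ + (M : ℂ) • e) ?_).2
  · rw [map_add, map_smul, h1] at h2
    simpa using h2
  · filter_upwards [h, hb, he1, Lp.coeFn_add ψ ((M : ℂ) • e), Lp.coeFn_smul (M : ℂ) e]
      with x h0 hx h3 h4 h5
    rw [h4, Pi.add_apply, h5, Pi.smul_apply, h3]
    have := (abs_le.1 ((Complex.abs_re_le_norm (ψ x)).trans hx)).1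
    simp [h0]
    linarith

lemma phi_eq_zero_of_avg {φ : Lp ℂ ⊤ (volume : Measure ℝ) →L[ℂ] ℂ} (hφ : IsMean φ)
    (H : ∀ ψ : Lp ℂ ⊤ (volume : Measure ℝ),
      (∀ᵐ x ∂(volume : Measure ℝ), (ψ x).im = 0) →
      (φ ψ).re ≤ pbarPlus (fun x => (ψ x).re))
    (h : Lp ℂ ⊤ (volume : Measure ℝ))
    (hh : ∀ ε > (0 : ℝ), ∀ᶠ θ : ℝ in atTop, ∀ x : ℝ, 0 ≤ x →
      ‖(1 / θ) • ∫ t in x..(x + θ), h t‖ ≤ ε) : φ h = 0 := by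
  obtain ⟨M, hM, hb⟩ := exists_bound h
  have hms : AEStronglyMeasurable (h : ℝ → ℂ) volume := Lp.aestronglyMeasurable h
  -- key: for a real-linear contraction `L : ℂ → ℝ`, the function `L ∘ h` has mean with `re ≤ 0`
  have key : ∀ (L : ℂ →L[ℝ] ℝ), (∀ z, ‖L z‖ ≤ ‖z‖) →
      ∀ k : Lp ℂ ⊤ (volume : Measure ℝ), (⇑k : ℝ → ℂ) =ᵐ[volume] (fun x => (L (h x) : ℂ)) →
      (φ k).re ≤ 0 := by
    intro L hL k hk
    refine (H k (hk.mono fun x hx => by rw [hx]; simp)).trans ?_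
    refine le_of_forall_pos_le_add fun ε hε => ?_
    rw [zero_add]
    refine pbarPlus_le (M := M) ?_ ?_
    · filter_upwards [hk, hb] with x h1 h2
      rw [h1, Complex.ofReal_re]
      exact (hL _).trans h2
    · filter_upwards [hh ε hε] with θ hθ x hx
      have e1 : ∫ t in x..(x + θ), (k t).re = L (∫ t in x..(x + θ), h t) := by
        rw [← L.intervalIntegral_comp_comm (intervalIntegrable_of_bound hms hb _ _)]
        refine intervalIntegral.integral_congr_ae ?_
        filter_upwards [hk] with t ht _
        rw [ht, Complex.ofReal_re]
      rw [e1, ← smul_eq_mul, ← map_smul]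
      exact (Real.le_norm_self _).trans ((hL _).trans (hθ x hx))
  have key2 : ∀ (L : ℂ →L[ℝ] ℝ), (∀ z, ‖L z‖ ≤ ‖z‖) →
      ∀ k : Lp ℂ ⊤ (volume : Measure ℝ), (⇑k : ℝ → ℂ) =ᵐ[volume] (fun x => (L (h x) : ℂ)) →
      φ k = 0 := by
    intro L hL k hk
    have a := key L hL k hk
    have b := key (-L) (by simpa using hL) (-k) (by
      filter_upwards [hk, Lp.coeFn_neg k] with x h1 h2
      rw [h2, Pi.neg_apply, h1]; simp)
    have c := mean_real hφ k (hk.mono fun x hx => by rw [hx]; simp)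
    rw [map_neg, Complex.neg_re] at b
    apply Complex.ext
    · simp; linarith
    · simpa using c
  have mem : ∀ (L : ℂ →L[ℝ] ℝ), (∀ z, ‖L z‖ ≤ ‖z‖) →
      MemLp (fun x => (L (h x) : ℂ)) ⊤ (volume : Measure ℝ) := by
    intro L hL
    refine memLp_top_of_bound ?_ M ?_
    · exact (Complex.continuous_ofReal.comp L.continuous).comp_aestronglyMeasurable hms
    · filter_upwards [hb] with x hx
      rw [Complex.norm_real]
      exact (hL _).trans hx
  have hre : ∀ z, ‖Complex.reCLM z‖ ≤ ‖z‖ := fun z => Complex.abs_re_le_norm z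
  have him : ∀ z, ‖Complex.imCLM z‖ ≤ ‖z‖ := fun z => Complex.abs_im_le_norm z
  have z1 := key2 _ hre _ (mem _ hre).coeFn_toLp
  have z2 := key2 _ him _ (mem _ him).coeFn_toLp
  have dec : h = (mem _ hre).toLp _ + Complex.I • (mem _ him).toLp _ := by
    apply Lp.ext
    filter_upwards [(mem _ hre).coeFn_toLp, (mem _ him).coeFn_toLp,
      Lp.coeFn_add ((mem _ hre).toLp _) (Complex.I • (mem _ him).toLp _),
      Lp.coeFn_smul Complex.I ((mem _ him).toLp _)] with x h1 h2 h3 h4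
    rw [h3, Pi.add_apply, h4, Pi.smul_apply, h1, h2]
    simp only [Complex.reCLM_apply, Complex.imCLM_apply, smul_eq_mul]
    rw [mul_comm, Complex.re_add_im]
  rw [dec, map_add, map_smul, z1, z2]
  simp

lemma vanish_avg (h : Lp ℂ ⊤ (volume : Measure ℝ)) (hv : VanishesAtPosInfty h) :
    ∀ ε > (0 : ℝ), ∀ᶠ θ : ℝ in atTop, ∀ x : ℝ, 0 ≤ x →
      ‖(1 / θ) • ∫ t in x..(x + θ), h t‖ ≤ ε := by
  intro ε hε
  obtain ⟨M, hM, hb⟩ := exists_bound h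
  have hms : AEStronglyMeasurable (h : ℝ → ℂ) volume := Lp.aestronglyMeasurable h
  obtain ⟨R, hR⟩ := hv (ε / 2) (by positivity)
  have ii := intervalIntegrable_of_bound hms hb
  filter_upwards [eventually_gt_atTop 0, eventually_ge_atTop (2 * M * |R| / ε)] with θ hθ hθ2 x hx
  have hθ3 : 2 * M * |R| ≤ θ * ε := by rwa [div_le_iff₀ hε] at hθ2
  have hmain : ‖∫ t in x..(x + θ), h t‖ ≤ M * |R| + ε / 2 * θ := by
    -- split at `m = min (max x R) (x+θ)`
    set m := min (max x R) (x + θ) with hm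
    have hxm : x ≤ m := le_min (le_max_left _ _) (by linarith)
    have hmx : m ≤ x + θ := min_le_right _ _
    have hmR : m - x ≤ |R| := by
      have : m ≤ max x R := min_le_left _ _
      have : max x R ≤ x + |R| := max_le (by linarith [abs_nonneg R]) (by linarith [le_abs_self R])
      linarith
    rw [← intervalIntegral.integral_add_adjacent_intervals (ii x m) (ii m (x + θ))]
    refine (norm_add_le _ _).trans (add_le_add ?_ ?_)
    · refine (intervalIntegral.norm_integral_le_of_norm_le_const_ae (C := M)
        (hb.mono fun y hy _ => hy)).trans ?_
      rw [abs_of_nonneg (by linarith)]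
      exact mul_le_mul_of_nonneg_left hmR hM
    · refine (intervalIntegral.norm_integral_le_of_norm_le_const_ae (C := ε / 2) ?_).trans ?_
      · filter_upwards [hR] with y hy hy2
        rw [Set.uIoc_of_le hmx] at hy2
        refine (hy ?_).le
        by_contra hlt
        push Not at hlt
        rcases min_le_iff.1 (le_of_eq hm.symm) with h1 | h1
        · linarith [le_max_right x R, hy2.1]
        · linarith [hy2.1, hy2.2]
      · rw [abs_of_nonneg (by linarith)]
        exact mul_le_mul_of_nonneg_left (by linarith) (by positivity)
  rw [norm_smul, Real.norm_of_nonneg (by positivity), one_div, inv_mul_le_iff₀ hθ]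
  linarith

lemma conv_avg {f : ℝ → ℝ} (hf : Integrable f volume) (hf0 : 0 ≤ᵐ[volume] f)
    (hf1 : (∫ t, f t) = 1) {u : ℝ → ℂ} (hu : StronglyMeasurable u) {M : ℝ} (hM : 0 ≤ M)
    (hb : ∀ x, ‖u x‖ ≤ M) :
    ∀ ε > (0 : ℝ), ∀ᶠ θ : ℝ in atTop, ∀ x : ℝ,
      ‖(1 / θ) • ∫ s in x..(x + θ), (u s - ∫ t, (f t : ℂ) * u (s - t))‖ ≤ ε := by
  intro ε hε
  have lim : Tendsto (fun θ : ℝ => ∫ t, f t * (2 * M * min (|t| / θ) 1)) atTop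
      (nhds (∫ _t : ℝ, (0 : ℝ))) := by
    refine tendsto_integral_filter_of_dominated_convergence (fun t => ‖f t‖ * (2 * M)) ?_ ?_
      (hf.norm.mul_const _) ?_
    · refine Eventually.of_forall fun θ => hf.aestronglyMeasurable.mul ?_
      exact Continuous.aestronglyMeasurable (by fun_prop)
    · filter_upwards [eventually_gt_atTop 0] with θ hθ
      refine Eventually.of_forall fun t => ?_
      rw [norm_mul]
      refine mul_le_mul_of_nonneg_left ?_ (norm_nonneg _)
      have h0 : 0 ≤ min (|t| / θ) 1 := le_min (by positivity) zero_le_one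
      rw [Real.norm_of_nonneg (by positivity)]
      exact mul_le_of_le_one_right (by positivity) (min_le_right _ _)
    · refine Eventually.of_forall fun t => ?_
      have h1 : Tendsto (fun θ : ℝ => |t| / θ) atTop (nhds 0) :=
        tendsto_const_nhds.div_atTop tendsto_id
      have h2 : Tendsto (fun θ : ℝ => min (|t| / θ) 1) atTop (nhds (min 0 1)) :=
        h1.min tendsto_const_nhds
      have h3 := (h2.const_mul (2 * M)).const_mul (f t)
      simpa using h3
  rw [integral_zero] at lim
  filter_upwards [eventually_gt_atTop 0, lim.eventually_le_const hε] with θ hθ hK x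
  refine le_trans ?_ hK
  have ii := intervalIntegrable_of_bound hu.aestronglyMeasurable
    (Eventually.of_forall (f := ae volume) hb)
  have hfc : Integrable (fun t => (f t : ℂ)) volume := hf.ofReal
  have c1 : ∀ s, Integrable (fun t => (f t : ℂ) * u (s - t)) volume := fun s =>
    hfc.mul_bdd (c := M)
      ((hu.comp_measurable (measurable_const.sub measurable_id)).aestronglyMeasurable)
      (Eventually.of_forall fun t => hb _)
  have e1 : ∀ s, u s - ∫ t, (f t : ℂ) * u (s - t) = ∫ t, (f t : ℂ) * (u s - u (s - t)) := by
    intro s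
    simp_rw [mul_sub]
    rw [integral_sub (hfc.mul_const _) (c1 s), integral_mul_const, integral_complex_ofReal, hf1]
    simp
  simp_rw [e1]
  have e2 : ∫ s in x..(x + θ), ∫ t, (f t : ℂ) * (u s - u (s - t)) =
      ∫ t, ∫ s in x..(x + θ), (f t : ℂ) * (u s - u (s - t)) := by
    simp_rw [intervalIntegral.integral_of_le (show x ≤ x + θ by linarith)]
    refine integral_integral_swap ?_
    refine Integrable.mul_bdd (c := 2 * M) (f := fun p : ℝ × ℝ => (f p.2 : ℂ))
      (g := fun p : ℝ × ℝ => u p.1 - u (p.1 - p.2)) ?_ ?_ ?_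
    · exact hfc.comp_snd _
    · exact ((hu.comp_measurable measurable_fst).sub
        (hu.comp_measurable (measurable_fst.sub measurable_snd))).aestronglyMeasurable
    · exact Eventually.of_forall fun p => (norm_sub_le _ _).trans (by linarith [hb p.1, hb (p.1 - p.2)])
  rw [e2, ← integral_smul]
  refine norm_integral_le_of_norm_le ?_ ?_
  · refine hf.mul_bdd (c := 2 * M) (Continuous.aestronglyMeasurable (by fun_prop)) ?_
    refine Eventually.of_forall fun t => ?_
    have h0 : 0 ≤ min (|t| / θ) 1 := le_min (by positivity) zero_le_one
    rw [Real.norm_of_nonneg (by positivity)]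
    exact mul_le_of_le_one_right (by positivity) (min_le_right _ _)
  · filter_upwards [hf0] with t ht
    have ht : 0 ≤ f t := ht
    rw [intervalIntegral.integral_const_mul, ← mul_smul_comm, norm_mul, Complex.norm_real,
      Real.norm_of_nonneg ht]
    refine mul_le_mul_of_nonneg_left ?_ ht
    rw [mul_min_of_nonneg _ _ (by positivity)]
    refine le_min ?_ ?_
    · have e3 : ∫ s in x..(x + θ), (u s - u (s - t)) =
          (∫ s in x..(x - t), u s) - ∫ s in (x + θ)..(x + θ - t), u s := by
        rw [intervalIntegral.integral_sub (ii _ _)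
          (by simpa using (ii (x - t) (x + θ - t)).comp_sub_right t),
          intervalIntegral.integral_comp_sub_right,
          intervalIntegral.integral_interval_sub_interval_comm (ii _ _) (ii _ _) (ii _ _)]
      have b1 := intervalIntegral.norm_integral_le_of_norm_le_const (a := x) (b := x - t)
        (f := u) (C := M) (fun y _ => hb y)
      have b2 := intervalIntegral.norm_integral_le_of_norm_le_const (a := x + θ) (b := x + θ - t)
        (f := u) (C := M) (fun y _ => hb y)
      rw [sub_sub_cancel_left, abs_neg] at b1 b2
      rw [norm_smul, Real.norm_of_nonneg (by positivity), one_div, inv_mul_le_iff₀ hθ, e3]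
      refine (norm_sub_le _ _).trans ?_
      have : θ * (2 * M * (|t| / θ)) = 2 * M * |t| := by field_simp
      rw [this]; linarith
    · rw [mul_one]
      refine avg_bound (Eventually.of_forall fun s => ?_) hθ x
      exact (norm_sub_le _ _).trans (by linarith [hb s, hb (s - t)])

lemma backward {φ : Lp ℂ ⊤ (volume : Measure ℝ) →L[ℂ] ℂ} (hφ : IsMean φ)
    (H : ∀ ψ : Lp ℂ ⊤ (volume : Measure ℝ),
      (∀ᵐ x ∂(volume : Measure ℝ), (ψ x).im = 0) →
      (φ ψ).re ≤ pbarPlus (fun x => (ψ x).re)) : IsTopologicallyInvariant φ := by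
  intro f hf hf0 hf1 ψ g hg
  obtain ⟨M, hM, hb⟩ := exists_bound ψ
  have hsm := Lp.stronglyMeasurable ψ
  set S : Set ℝ := {x | ‖ψ x‖ ≤ M} with hS
  have hSm : MeasurableSet S := measurableSet_le hsm.norm.measurable measurable_const
  set u : ℝ → ℂ := S.indicator ψ with hu
  have hum : StronglyMeasurable u := hsm.indicator hSm
  have hub : ∀ x, ‖u x‖ ≤ M := by
    intro x
    by_cases hx : x ∈ S
    · rw [hu, Set.indicator_of_mem hx]; exact hx
    · rw [hu, Set.indicator_of_notMem hx]; simpa using hM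
  have hae : ∀ᵐ x ∂(volume : Measure ℝ), ψ x = u x := by
    filter_upwards [hb] with x hx
    rw [hu, Set.indicator_of_mem (show x ∈ S from hx)]
  have hconv : ∀ x, ∫ t, (f t : ℂ) * ψ (x - t) = ∫ t, (f t : ℂ) * u (x - t) := by
    intro x
    refine integral_congr_ae ?_
    filter_upwards [(quasiMeasurePreserving_sub_left volume x).ae hae] with t ht
    rw [ht]
  have hz := phi_eq_zero_of_avg hφ H (ψ - g) ?_
  · rw [map_sub, sub_eq_zero] at hz
    exact hz.symm
  · intro ε hε
    filter_upwards [conv_avg hf hf0 hf1 hum hM hub ε hε] with θ hθ x _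
    convert hθ x using 3
    refine intervalIntegral.integral_congr_ae ?_
    filter_upwards [hg, hae, Lp.coeFn_sub ψ g] with s h1 h2 h3 _
    rw [h3, Pi.sub_apply, h1, ← h2, hconv]

lemma forward_s14 {φ : Lp ℂ ⊤ (volume : Measure ℝ) →L[ℂ] ℂ} (hφ : IsMean φ)
    (hinv : IsTopologicallyInvariant φ)
    (hvan : ∀ ψ : Lp ℂ ⊤ (volume : Measure ℝ), VanishesAtPosInfty ψ → φ ψ = 0)
    (ψ : Lp ℂ ⊤ (volume : Measure ℝ)) (hr : ∀ᵐ x ∂(volume : Measure ℝ), (ψ x).im = 0) :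
    (φ ψ).re ≤ pbarPlus (fun x => (ψ x).re) := by
  obtain ⟨M, hM, hb⟩ := exists_bound ψ
  have hms : AEStronglyMeasurable (ψ : ℝ → ℂ) volume := Lp.aestronglyMeasurable ψ
  have hbr : ∀ᵐ x ∂(volume : Measure ℝ), ‖(ψ x).re‖ ≤ M :=
    hb.mono fun x hx => (Complex.abs_re_le_norm _).trans hx
  have hmr : AEStronglyMeasurable (fun x => (ψ x).re) volume :=
    Complex.continuous_re.comp_aestronglyMeasurable hms
  have ii := intervalIntegrable_of_bound hmr hbr
  refine le_pbarPlus hbr fun θ hθ => ?_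
  set c := supAvg (fun x => (ψ x).re) θ with hc
  -- the averaged function
  set a : ℝ → ℝ := fun x => (1 / θ) * ∫ t in x..(x + θ), (ψ t).re with ha
  have haM : ∀ x, ‖a x‖ ≤ M := fun x => avg_bound hbr hθ x
  have hac : ∀ x, 0 ≤ x → a x ≤ c := fun x hx => le_ciSup (supAvg_bdd hbr hθ) ⟨x, hx⟩
  have hcont : Continuous a := by
    have hp := intervalIntegral.continuous_primitive ii 0
    have : a = fun x => (1 / θ) *
        ((∫ t in (0:ℝ)..(x + θ), (ψ t).re) - ∫ t in (0:ℝ)..x, (ψ t).re) := by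
      funext x
      rw [ha, intervalIntegral.integral_interval_sub_left (ii _ _) (ii _ _)]
    rw [this]
    exact continuous_const.mul ((hp.comp (continuous_id.add continuous_const)).sub hp)
  have hac' : Continuous (fun x => (a x : ℂ)) := Complex.continuous_ofReal.comp hcont
  have mg : MemLp (fun x => (a x : ℂ)) ⊤ (volume : Measure ℝ) :=
    memLp_top_of_bound hac'.aestronglyMeasurable M
      (Eventually.of_forall fun x => by rw [Complex.norm_real]; exact haM x)
  set g := mg.toLp _ with hgdef
  have hg : (⇑g : ℝ → ℂ) =ᵐ[volume] (fun x => (a x : ℂ)) := mg.coeFn_toLp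
  have hgφ : φ g = φ ψ := by
    refine hinv ((Set.Ico (-θ) 0).indicator fun _ => 1 / θ) ?_ ?_ ?_ ψ g ?_
    · exact (integrable_indicator_iff measurableSet_Ico).2 (integrableOn_const (by simp))
    · exact Eventually.of_forall fun x => Set.indicator_nonneg (fun _ _ => by positivity) x
    · rw [integral_indicator measurableSet_Ico]
      simp [hθ.le, hθ.ne']
    · filter_upwards [hg] with x hx
      rw [hx]
      have e1 : (fun t => (((Set.Ico (-θ) 0).indicator (fun _ => 1 / θ) t : ℝ) : ℂ) * ψ (x - t))
          = fun t => (fun s => (Set.Ioc x (x + θ)).indicator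
            (fun s => ((1 / θ : ℝ) : ℂ) * ψ s) s) (x - t) := by
        funext t
        by_cases h : t ∈ Set.Ico (-θ) 0
        · have h' : x - t ∈ Set.Ioc x (x + θ) := ⟨by linarith [h.2], by linarith [h.1]⟩
          simp only [Set.indicator_of_mem h, Set.indicator_of_mem h']
        · have h' : x - t ∉ Set.Ioc x (x + θ) := fun h' =>
            h ⟨by linarith [h'.2], by linarith [h'.1]⟩
          simp only [Set.indicator_of_notMem h, Set.indicator_of_notMem h']
          simp
      rw [e1, integral_sub_left_eq_self (fun s => (Set.Ioc x (x + θ)).indicator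
            (fun s => ((1 / θ : ℝ) : ℂ) * ψ s) s) volume x,
        integral_indicator measurableSet_Ioc, integral_const_mul, ha]
      simp only
      rw [Complex.ofReal_mul, ← intervalIntegral.integral_ofReal,
        intervalIntegral.integral_of_le (by linarith)]
      congr 1
      refine integral_congr_ae (ae_restrict_of_ae ?_)
      filter_upwards [hr] with t ht
      apply Complex.ext <;> simp [ht]
  -- the correction supported on the negative half line
  have mw : MemLp ((Set.Iio (0:ℝ)).indicator fun x => ((a x - c : ℝ) : ℂ)) ⊤
      (volume : Measure ℝ) := by
    refine memLp_top_of_bound ?_ (M + |c|) (Eventually.of_forall fun x => ?_)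
    · refine AEStronglyMeasurable.indicator ?_ measurableSet_Iio
      exact (Complex.continuous_ofReal.comp
        (hcont.sub continuous_const)).aestronglyMeasurable
    · refine (norm_indicator_le_norm_self _ _).trans ?_
      rw [Complex.norm_real]
      exact (norm_sub_le _ _).trans (add_le_add (haM x) le_rfl)
  set w := mw.toLp _ with hwdef
  have hw : (⇑w : ℝ → ℂ) =ᵐ[volume] _ := mw.coeFn_toLp
  have hwφ : φ w = 0 := by
    refine hvan w fun ε hε => ⟨0, ?_⟩
    filter_upwards [hw] with x hx h0
    rw [hx, Set.indicator_of_notMem (by simpa using h0.le)]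
    simpa using hε
  have hone : MemLp (fun _ : ℝ => (1 : ℂ)) ⊤ (volume : Measure ℝ) := memLp_top_const 1
  set e := hone.toLp _ with he
  have he1 : (⇑e : ℝ → ℂ) =ᵐ[volume] (fun _ => 1) := hone.coeFn_toLp
  have h1 := hφ.2 e he1
  have h2 := (hφ.1 ((c : ℂ) • e - g + w) ?_).1
  · rw [map_add, map_sub, map_smul, h1, hwφ, hgφ] at h2
    simp at h2
    exact h2
  · filter_upwards [hw, hg, he1, Lp.coeFn_add ((c : ℂ) • e - g) w, Lp.coeFn_sub ((c : ℂ) • e) g,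
      Lp.coeFn_smul (c : ℂ) e] with x x1 x2 x3 x4 x5 x6
    rw [x4, Pi.add_apply, x5, Pi.sub_apply, x6, Pi.smul_apply, x1, x2, x3]
    by_cases hx : x < 0
    · rw [Set.indicator_of_mem (show x ∈ Set.Iio 0 from hx)]
      simp
    · rw [Set.indicator_of_notMem (by simpa using hx)]
      have := hac x (not_lt.1 hx)
      simpa using this

/-- A mean `φ` on `L^∞(ℝ)` belongs to `𝒯₊` (topologically invariant and vanishing on
`L^∞_{0,+}(ℝ)`) iff `φ(ψ) ≤ p̄₊(ψ)` for every real-valued `ψ ∈ L^∞(ℝ)`. -/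
theorem mem_TPlus_iff_le_pbarPlus
    (φ : Lp ℂ ⊤ (volume : Measure ℝ) →L[ℂ] ℂ) (hφ : IsMean φ) :
    (IsTopologicallyInvariant φ ∧
      ∀ ψ : Lp ℂ ⊤ (volume : Measure ℝ), VanishesAtPosInfty ψ → φ ψ = 0) ↔
    (∀ ψ : Lp ℂ ⊤ (volume : Measure ℝ),
      (∀ᵐ x ∂(volume : Measure ℝ), (ψ x).im = 0) →
      (φ ψ).re ≤ pbarPlus (fun x => (ψ x).re)) := by
  constructor
  · rintro ⟨hinv, hvan⟩ ψ hr
    exact forward_s14 hφ hinv hvan ψ hr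
  · intro H
    exact ⟨backward hφ H, fun ψ hv => phi_eq_zero_of_avg hφ H ψ (vanish_avg ψ hv)⟩
end
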